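/- arXiv:2011.08025 — 2 statements merged into one kernel-verified Lean document; each statement's English description precedes it below -/
import Mathlib

section
/- Let n = 2r be an integer divisible by 4 and let F be a field with char F = 0 or char F > r. Let f be the determinant of the r×r submatrix of the matrix of indeterminates Y consisting of the rows r+1, r+2, …, n and columns r+1, r+2, …, n. Then the image of f in F[V] is not a zero divisor. -/
open scoped Matrix

noncomputable section

namespace PR

/-- The polynomial ring `R[Y_{ij} : 1 ≤ i, j ≤ n]`, `n = 2r`. -/
abbrev PolyRing (r : ℕ) (R : Type*) [CommRing R] :=
  MvPolynomial (Fin (2 * r) × Fin (2 * r)) R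

/-- The standard symplectic form matrix `J` (`n = 2r`). -/
def Jmat (r : ℕ) (R : Type*) [CommRing R] : Matrix (Fin (2 * r)) (Fin (2 * r)) R :=
  Matrix.of fun i j =>
    if (j : ℕ) = (i : ℕ) + r then 1 else if (i : ℕ) = (j : ℕ) + r then -1 else 0

/-- The generic `n × n` matrix of indeterminates. -/
def Ygen (r : ℕ) (R : Type*) [CommRing R] :
    Matrix (Fin (2 * r)) (Fin (2 * r)) (MvPolynomial (Fin (2 * r) × Fin (2 * r)) R) :=
  Matrix.of fun i j => MvPolynomial.X (i, j)

/-- The defining ideal of the scheme `V`. -/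
def VIdeal (r : ℕ) (R : Type*) [CommRing R] :
    Ideal (MvPolynomial (Fin (2 * r) × Fin (2 * r)) R) :=
  Ideal.span
    ({p | ∃ i j, p = (Ygen r R + (Ygen r R)ᵀ) i j} ∪
     {p | ∃ i, p = Ygen r R i i} ∪
     {p | ∃ i j, p = ((Ygen r R)ᵀ * Jmat r (PolyRing r R) * Ygen r R) i j} ∪
     {p | ∃ k, p = (Matrix.charpoly (-(Jmat r (PolyRing r R) * Ygen r R)) - Polynomial.X ^ (2 * r)).coeff k})

/-- The coordinate ring `R[V]`. -/
abbrev FV (r : ℕ) (R : Type*) [CommRing R] :=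
  MvPolynomial (Fin (2 * r) × Fin (2 * r)) R ⧸ VIdeal r R

/-- The pfaffian of an `m × m` matrix (nonzero only for even `m`), defined as a signed sum over
permutations `σ` with `σ(2i-1) < σ(2i)` for each pair and `σ(1) < σ(3) < ⋯` (here 0-indexed). -/
def pf {m : ℕ} {R : Type*} [CommRing R] (A : Matrix (Fin m) (Fin m) R) : R :=
  ∑ σ ∈ Finset.univ.filter (fun σ : Equiv.Perm (Fin m) =>
      (∀ i : Fin (m / 2),
        σ ⟨2 * i.val, by have := i.isLt; omega⟩ < σ ⟨2 * i.val + 1, by have := i.isLt; omega⟩) ∧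
      ∀ i j : Fin (m / 2), i < j →
        σ ⟨2 * i.val, by have := i.isLt; omega⟩ < σ ⟨2 * j.val, by have := j.isLt; omega⟩),
    (Equiv.Perm.sign σ : ℤ) •
      ∏ i : Fin (m / 2),
        A (σ ⟨2 * i.val, by have := i.isLt; omega⟩) (σ ⟨2 * i.val + 1, by have := i.isLt; omega⟩)

/-- `[i₁, …, i₂ₗ]`: the pfaffian of the submatrix of `Y` given by a list of indices. -/
def listPf {n : ℕ} {R : Type*} [CommRing R] (Y : Matrix (Fin n) (Fin n) R)
    (L : List (Fin n)) : R :=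
  pf (Matrix.of fun a b : Fin L.length => Y (L.get a) (L.get b))

/-- The product of pfaffians associated to a tableau (rows as lists of entries),
as a polynomial. -/
def tabPoly (r : ℕ) (R : Type*) [CommRing R] (T : List (List (Fin (2 * r)))) :
    MvPolynomial (Fin (2 * r) × Fin (2 * r)) R :=
  (T.map (listPf (Ygen r R))).prod

/-- `[T]`, the class of the product of pfaffians of the rows of `T` in `R[V]`. -/
def tabElem (r : ℕ) (R : Type*) [CommRing R] (T : List (List (Fin (2 * r)))) : FV r R :=
  Ideal.Quotient.mk (VIdeal r R) (tabPoly r R T)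

/-- Position of an index in the order `1̄ ≺ 1 ≺ 2̄ ≺ 2 ≺ ⋯ ≺ r̄ ≺ r`, where `ī := r + i`
(0-indexed: `ī` is `r + i - 1` and `i` is `i - 1`). -/
def ordIdx (r : ℕ) (x : Fin (2 * r)) : ℕ :=
  if x.val < r then 2 * x.val + 1 else 2 * (x.val - r)

/-- A list of rows represents a tableau of shape a partition: row lengths weakly decreasing
and positive. -/
def IsShape {α : Type*} (T : List (List α)) : Prop :=
  (T.map List.length).Chain' (fun a b => b ≤ a) ∧ ∀ row ∈ T, row ≠ []

/-- An even-tableau: every row has even length. -/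
def IsEvenTab {α : Type*} (T : List (List α)) : Prop :=
  ∀ row ∈ T, Even row.length

/-- Standard: entries strictly increase along each row and weakly increase down each column,
with respect to the order `≺`. -/
def IsStandard (r : ℕ) (T : List (List (Fin (2 * r)))) : Prop :=
  (∀ row ∈ T, row.Chain' (fun a b => ordIdx r a < ordIdx r b)) ∧
  ∀ (i t : ℕ) (hi : i + 1 < T.length) (ht' : t < (T[i]'(Nat.lt_of_succ_lt hi)).length)
    (ht : t < (T[i + 1]'hi).length),
    ordIdx r ((T[i]'(Nat.lt_of_succ_lt hi))[t]'ht') ≤ ordIdx r ((T[i + 1]'hi)[t]'ht)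

/-- The symplectic condition: the entries `p` and `p̄` (0-indexed: values `p` and `r + p`
for `p < r`) occur only in the first `p + 1` columns (0-indexed: columns `t ≤ p`). -/
def IsSymplectic (r : ℕ) (T : List (List (Fin (2 * r)))) : Prop :=
  ∀ (i t : ℕ) (hi : i < T.length) (ht : t < (T[i]'hi).length) (p : ℕ), p < r →
    (((T[i]'hi)[t]'ht).val = p ∨ ((T[i]'hi)[t]'ht).val = r + p) → t ≤ p

/-- A symplectic standard even-tableau. -/
def IsSSET (r : ℕ) (T : List (List (Fin (2 * r)))) : Prop :=
  IsShape T ∧ IsEvenTab T ∧ IsStandard r T ∧ IsSymplectic r T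

/-- A canonical tableau: in column `j` only `j̄` appears (0-indexed: column `t` contains
only the value `r + t`). -/
def IsCanonical (r : ℕ) (T : List (List (Fin (2 * r)))) : Prop :=
  ∀ (i t : ℕ) (hi : i < T.length) (ht : t < (T[i]'hi).length), ((T[i]'hi)[t]'ht).val = r + t

/-- The set `V(C)` of matrices. -/
def MemV (r : ℕ) {C : Type*} [CommRing C] (Y : Matrix (Fin (2 * r)) (Fin (2 * r)) C) : Prop :=
  Y = -Yᵀ ∧ (∀ i, Y i i = 0) ∧ Yᵀ * Jmat r C * Y = 0 ∧
    Matrix.charpoly (-(Jmat r C * Y)) = Polynomial.X ^ (2 * r)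

/-- The embedding `i ↦ i` of `{1, …, r}` into `{1, …, n}`. -/
def emb (r : ℕ) (i : Fin r) : Fin (2 * r) := ⟨i.val, by have := i.isLt; omega⟩

/-- The embedding `i ↦ ī = r + i` of `{1, …, r}` into `{1, …, n}`. -/
def embBar (r : ℕ) (i : Fin r) : Fin (2 * r) := ⟨r + i.val, by have := i.isLt; omega⟩

/-- The index list of `[P, Q̄]`: with `Γ₀ = P ∩ Q = {γ₁ < ⋯ < γ_λ}`, the list
`γ₁, γ̄₁, …, γ_λ, γ̄_λ` followed by `P ∖ Γ₀` in increasing order and then the bars of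
`Q ∖ Γ₀` in increasing order. -/
def pqList (r : ℕ) (P Q : Finset (Fin r)) : List (Fin (2 * r)) :=
  ((P ∩ Q).sort (· ≤ ·)).flatMap (fun γ => [emb r γ, embBar r γ]) ++
    ((P \ Q).sort (· ≤ ·)).map (emb r) ++ ((Q \ P).sort (· ≤ ·)).map (embBar r)

/-- The pfaffian `[P, Q̄]` of the matrix `Y`. -/
def pfPQ (r : ℕ) {C : Type*} [CommRing C] (Y : Matrix (Fin (2 * r)) (Fin (2 * r)) C)
    (P Q : Finset (Fin r)) : C :=
  listPf Y (pqList r P Q)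

/-- The defining ideal of the scheme `W`. -/
def WIdeal (r : ℕ) (R : Type*) [CommRing R] : Ideal (PolyRing r R) :=
  Ideal.span
    ({p | ∃ i j, p = (Jmat r (PolyRing r R) * (Ygen r R)ᵀ * Jmat r (PolyRing r R)
            + Ygen r R) i j} ∪
     {p | ∃ i j, p = (Ygen r R * Ygen r R) i j} ∪
     {p | ∃ k, p = (Matrix.charpoly (Ygen r R) - Polynomial.X ^ (2 * r)).coeff k})

/-- The coordinate ring `R[W]`. -/
abbrev FW (r : ℕ) (R : Type*) [CommRing R] := PolyRing r R ⧸ WIdeal r R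

section Grassmann

variable {n : ℕ} {R : Type*} [CommRing R]

/-- The generator `e a` of the exterior algebra of `Fin n → R`. -/
def gen (n : ℕ) (R : Type*) [CommRing R] (a : Fin n) : ExteriorAlgebra R (Fin n → R) :=
  ExteriorAlgebra.ι R (Pi.single a 1)

/-- The contraction of the exterior algebra by the `a`-th coordinate. -/
def del (R : Type*) [CommRing R] (a : Fin n) :
    ExteriorAlgebra R (Fin n → R) →ₗ[R] ExteriorAlgebra R (Fin n → R) :=
  CliffordAlgebra.contractLeft (Q := (0 : QuadraticForm R (Fin n → R))) (LinearMap.proj a)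

/-- The grading automorphism of the exterior algebra. -/
def inv (n : ℕ) (R : Type*) [CommRing R] :
    ExteriorAlgebra R (Fin n → R) →ₐ[R] ExteriorAlgebra R (Fin n → R) :=
  CliffordAlgebra.involute (Q := (0 : QuadraticForm R (Fin n → R)))

/-- The augmentation of the exterior algebra. -/
def aug (n : ℕ) (R : Type*) [CommRing R] : ExteriorAlgebra R (Fin n → R) →ₐ[R] R :=
  ExteriorAlgebra.algebraMapInv

theorem inv_ι (v : Fin n → R) : inv n R (ExteriorAlgebra.ι R v) = -ExteriorAlgebra.ι R v :=
  CliffordAlgebra.involute_ι _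

theorem aug_ι (v : Fin n → R) : aug n R (ExteriorAlgebra.ι R v) = 0 := by
  simp [aug, ExteriorAlgebra.algebraMapInv]

theorem ι_anticomm (v w : Fin n → R) :
    ExteriorAlgebra.ι R v * ExteriorAlgebra.ι R w
      = -(ExteriorAlgebra.ι R w * ExteriorAlgebra.ι R v) :=
  eq_neg_of_add_eq_zero_left (ExteriorAlgebra.ι_add_mul_swap v w)

theorem del_one (a : Fin n) : del R a 1 = 0 := CliffordAlgebra.contractLeft_one (Q :=
    (0 : QuadraticForm R (Fin n → R))) (LinearMap.proj a)

theorem del_ι_mul (a : Fin n) (v : Fin n → R) (u : ExteriorAlgebra R (Fin n → R)) :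
    del R a (ExteriorAlgebra.ι R v * u) = v a • u - ExteriorAlgebra.ι R v * del R a u :=
  CliffordAlgebra.contractLeft_ι_mul (Q := (0 : QuadraticForm R (Fin n → R))) (d :=
    LinearMap.proj a) v u

theorem del_ι (a : Fin n) (v : Fin n → R) :
    del R a (ExteriorAlgebra.ι R v) = algebraMap R _ (v a) :=
  CliffordAlgebra.contractLeft_ι (Q := (0 : QuadraticForm R (Fin n → R))) (LinearMap.proj a) v

theorem del_del (a : Fin n) (u : ExteriorAlgebra R (Fin n → R)) : del R a (del R a u) = 0 :=
  CliffordAlgebra.contractLeft_contractLeft _ _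

theorem del_comm (a b : Fin n) (u : ExteriorAlgebra R (Fin n → R)) :
    del R a (del R b u) = -del R b (del R a u) :=
  CliffordAlgebra.contractLeft_comm _ _ _

theorem del_mul (a : Fin n) (u v : ExteriorAlgebra R (Fin n → R)) :
    del R a (u * v) = del R a u * v + inv n R u * del R a v := by
  induction u using ExteriorAlgebra.induction generalizing v with
  | algebraMap r =>
    have : del R a (algebraMap R _ r) = 0 := by
      rw [Algebra.algebraMap_eq_smul_one, map_smul, del_one, smul_zero]
    rw [this, AlgHom.commutes, zero_mul, zero_add, ← Algebra.smul_def, ← Algebra.smul_def, map_smul]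
  | ι x =>
    rw [del_ι_mul, del_ι, inv_ι, Algebra.smul_def, neg_mul, sub_eq_add_neg]
  | mul p q hp hq =>
    rw [mul_assoc, hp, hq, hp, map_mul]
    simp only [mul_add, add_mul, mul_assoc, add_assoc]
  | add p q hp hq =>
    simp only [add_mul, map_add, hp, hq]
    abel

theorem inv_del (a : Fin n) (u : ExteriorAlgebra R (Fin n → R)) :
    inv n R (del R a u) = -del R a (inv n R u) := by
  induction u using ExteriorAlgebra.induction with
  | algebraMap r =>
    have : del R a (algebraMap R _ r) = 0 := by
      rw [Algebra.algebraMap_eq_smul_one, map_smul, del_one, smul_zero]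
    rw [AlgHom.commutes, this, map_zero, neg_zero]
  | ι x => rw [inv_ι, map_neg, neg_neg, del_ι, AlgHom.commutes]
  | mul p q hp hq =>
    rw [map_mul (inv n R) p q, del_mul, del_mul, map_add, map_mul, map_mul, hp, hq]
    simp only [neg_mul, mul_neg]
    abel
  | add p q hp hq => rw [map_add, map_add, hp, hq, map_add, map_add]; abel

/-- The linear form `∑ b, Y a b • e b`. -/
def lin (Y : Fin n → Fin n → R) (a : Fin n) : ExteriorAlgebra R (Fin n → R) :=
  ExteriorAlgebra.ι R (Y a)

/-- `G` behaves like the exponential of the alternating form `Y`. -/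
structure IsGauss (Y : Fin n → Fin n → R) (G : ExteriorAlgebra R (Fin n → R)) : Prop where
  inv_eq : inv n R G = G
  aug_eq : aug n R G = 1
  del_eq : ∀ a, del R a G = lin Y a * G
  comm : ∀ u, G * u = u * G

theorem IsGauss.mul {A B : Fin n → Fin n → R} {G H : ExteriorAlgebra R (Fin n → R)}
    (hG : IsGauss A G) (hH : IsGauss B H) : IsGauss (A + B) (G * H) where
  inv_eq := by rw [map_mul, hG.inv_eq, hH.inv_eq]
  aug_eq := by rw [map_mul, hG.aug_eq, hH.aug_eq, mul_one]
  del_eq a := by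
    rw [del_mul, hG.del_eq, hH.del_eq, hG.inv_eq, ← mul_assoc G, hG.comm (lin B a)]
    simp only [lin, Pi.add_apply, map_add, add_mul, mul_assoc]
  comm u := by rw [mul_assoc, hH.comm, ← mul_assoc, hG.comm, mul_assoc]

theorem isGauss_zero : IsGauss (0 : Fin n → Fin n → R) 1 where
  inv_eq := map_one _
  aug_eq := map_one _
  del_eq a := by simp [lin, del_one]
  comm u := by simp

theorem gen_mul_gen_comm (a b : Fin n) (u : ExteriorAlgebra R (Fin n → R)) :
    gen n R a * gen n R b * u = u * (gen n R a * gen n R b) := by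
  induction u using ExteriorAlgebra.induction with
  | algebraMap r => exact (Algebra.commutes _ _).symm
  | ι x =>
    rw [gen, gen, mul_assoc, ι_anticomm _ x, mul_neg, ← mul_assoc, ι_anticomm _ x, neg_mul, neg_neg,
      mul_assoc]
  | mul p q hp hq => rw [← mul_assoc, hp, mul_assoc, hq, mul_assoc]
  | add p q hp hq => rw [mul_add, hp, hq, add_mul]

theorem isGauss_pair (a b : Fin n) (hab : a ≠ b) (y : R) :
    IsGauss (y • (Pi.single a (Pi.single b 1) - Pi.single b (Pi.single a 1)) : Fin n → Fin n → R)
      (1 + y • (gen n R a * gen n R b)) where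
  inv_eq := by
    simp [gen, inv_ι]
  aug_eq := by simp [gen, aug_ι]
  del_eq c := by
    have hb : gen n R b * (gen n R a * gen n R b) = 0 := by
      rw [← gen_mul_gen_comm, mul_assoc, gen, gen, ExteriorAlgebra.ι_sq_zero, mul_zero]
    have ha : gen n R a * (gen n R a * gen n R b) = 0 := by
      rw [← mul_assoc, gen, gen, ExteriorAlgebra.ι_sq_zero, zero_mul]
    have h : ∀ x : R, lin (y • (Pi.single a (Pi.single b 1) - Pi.single b (Pi.single a 1)) :
        Fin n → Fin n → R) c = y • ((if c = a then gen n R b else 0) - 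
          (if c = b then gen n R a else 0)) := by
      intro x
      simp only [lin, Pi.smul_apply, Pi.sub_apply, map_smul, map_sub]
      congr 2
      · split_ifs with h
        · subst h; simp [gen]
        · simp [Pi.single_eq_of_ne h]
      · split_ifs with h
        · subst h; simp [gen]
        · simp [Pi.single_eq_of_ne h]
    rw [h 0, map_add, del_one, zero_add, map_smul, mul_add, mul_one]
    have : del R c (gen n R a * gen n R b) = (if c = a then gen n R b else 0) - 
          (if c = b then gen n R a else 0) := by
      rw [gen, del_ι_mul, gen, del_ι, Algebra.algebraMap_eq_smul_one]
      simp only [Pi.single_apply, ite_smul, one_smul, zero_smul, mul_ite, mul_one, mul_zero]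
    rw [this, left_eq_add, mul_smul_comm, smul_mul_assoc, sub_mul, ite_mul, ite_mul, ha, hb]
    simp
  comm u := by
    rw [add_mul, mul_add, one_mul, mul_one, smul_mul_assoc, mul_smul_comm, gen_mul_gen_comm]

theorem exists_isGauss (Y : Fin n → Fin n → R) (h0 : ∀ a, Y a a = 0)
    (h1 : ∀ a b, Y b a = -Y a b) : ∃ G, IsGauss Y G := by
  have key : ∀ s : Finset (Fin n × Fin n), (∀ p ∈ s, p.1 ≠ p.2) →
      ∃ G, IsGauss (∑ p ∈ s, (Y p.1 p.2 • (Pi.single p.1 (Pi.single p.2 1) -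
        Pi.single p.2 (Pi.single p.1 1)) : Fin n → Fin n → R)) G := by
    intro s
    induction s using Finset.induction_on with
    | empty => intro _; exact ⟨1, isGauss_zero⟩
    | insert p s hp ih =>
      intro hs
      obtain ⟨G, hG⟩ := ih fun q hq => hs q (Finset.mem_insert_of_mem hq)
      rw [Finset.sum_insert hp]
      exact ⟨_, (isGauss_pair p.1 p.2 (hs p (Finset.mem_insert_self _ _)) _).mul hG⟩
  obtain ⟨G, hG⟩ := key (Finset.univ.filter fun p => p.1 < p.2) (by
    intro p hp; exact (Finset.mem_filter.1 hp).2.ne)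
  refine ⟨G, ?_⟩
  convert hG using 1
  funext a b
  rw [Finset.sum_apply, Finset.sum_apply]
  have : ∀ p : Fin n × Fin n, ((Y p.1 p.2 • (Pi.single p.1 (Pi.single p.2 1) -
        Pi.single p.2 (Pi.single p.1 1)) : Fin n → Fin n → R)) a b =
        (if p = (a, b) then Y a b else 0) - (if p = (b, a) then Y b a else 0) := by
    rintro ⟨c, d⟩
    simp only [Pi.smul_apply, Pi.sub_apply, Pi.single_apply, smul_eq_mul, Prod.mk.injEq,
      mul_sub, apply_ite (fun f : Fin n → R => f b), Pi.zero_apply]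
    congr 1
    · by_cases h1 : a = c <;> by_cases h2 : b = d <;> simp [h1, h2, eq_comm]
    · by_cases h1 : a = d <;> by_cases h2 : b = c <;> simp [h1, h2, eq_comm]
  simp only [this, Finset.sum_sub_distrib, Finset.sum_ite_eq', Finset.mem_filter, Finset.mem_univ,
    true_and]
  rcases lt_trichotomy a b with h | h | h
  · simp [h, h.not_gt]
  · subst h; simp [h0]
  · simp [h, h.not_gt, h1 b a]

end Grassmann

section Grassmann

variable {n : ℕ} {R : Type*} [CommRing R]

/-- Successive contraction along a list, the head being applied first. -/
def delL (R : Type*) [CommRing R] : List (Fin n) →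
    ExteriorAlgebra R (Fin n → R) →ₗ[R] ExteriorAlgebra R (Fin n → R)
  | [] => LinearMap.id
  | a :: l => delL R l ∘ₗ del R a

theorem delL_nil (u : ExteriorAlgebra R (Fin n → R)) : delL R [] u = u := rfl

theorem delL_cons (a : Fin n) (l : List (Fin n)) (u : ExteriorAlgebra R (Fin n → R)) :
    delL R (a :: l) u = delL R l (del R a u) := rfl

theorem delL_append (l m : List (Fin n)) (u : ExteriorAlgebra R (Fin n → R)) :
    delL R (l ++ m) u = delL R m (delL R l u) := by
  induction l generalizing u with
  | nil => rfl
  | cons a l ih => rw [List.cons_append, delL_cons, ih, delL_cons]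

theorem delL_ι_mul (l : List (Fin n)) (v : Fin n → R) (u : ExteriorAlgebra R (Fin n → R)) :
    delL R l (ExteriorAlgebra.ι R v * u) =
      ∑ i : Fin l.length, ((-1) ^ (i : ℕ) * v l[i]) • delL R (l.eraseIdx i) u +
        (-1 : R) ^ l.length • (ExteriorAlgebra.ι R v * delL R l u) := by
  induction l generalizing u with
  | nil => simp [delL_nil]
  | cons a l ih =>
    rw [delL_cons, del_ι_mul, map_sub, map_smul, ih]
    refine Eq.trans ?_ (congrArg (· + _) (Fin.sum_univ_succ (n := l.length) _).symm)
    simp only [List.length_cons, Fin.val_zero, pow_zero, one_mul, Fin.getElem_fin,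
      List.getElem_cons_zero,
      List.eraseIdx_cons_zero, Fin.val_succ, List.getElem_cons_succ, List.eraseIdx_cons_succ,
      delL_cons, pow_succ, mul_neg, neg_mul, mul_one, neg_smul, Finset.sum_neg_distrib]
    abel

theorem delL_perm {l m : List (Fin n)} (h : l.Perm m) :
    ∃ ε : ℤˣ, ∀ u : ExteriorAlgebra R (Fin n → R), delL R l u = ε • delL R m u := by
  induction h with
  | nil => exact ⟨1, fun u => by simp⟩
  | cons a _ ih =>
    obtain ⟨ε, h⟩ := ih
    exact ⟨ε, fun u => by rw [delL_cons, delL_cons, h]⟩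
  | swap a b l =>
    exact ⟨-1, fun u => by simp only [delL_cons]; rw [del_comm, map_neg]; simp⟩
  | trans _ _ ih1 ih2 =>
    obtain ⟨ε, h⟩ := ih1
    obtain ⟨η, h'⟩ := ih2
    exact ⟨ε * η, fun u => by rw [h, h', mul_smul]⟩

theorem delL_of_not_nodup {l : List (Fin n)} (h : ¬ l.Nodup) (u : ExteriorAlgebra R (Fin n → R)) :
    delL R l u = 0 := by
  rw [List.nodup_iff_sublist] at h
  push Not at h
  obtain ⟨a, ha⟩ := h
  obtain ⟨m, hm⟩ := ha.exists_perm_append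
  obtain ⟨ε, hε⟩ := delL_perm (R := R) hm
  rw [hε, List.cons_append, List.cons_append, List.nil_append, delL_cons, delL_cons, del_del,
    map_zero, smul_zero]

/-- The pfaffian of the rows and columns of `Y` listed in a list of indices. -/
def gpf (Y : Fin n → Fin n → R) : List (Fin n) → R
  | [] => 1
  | a :: l => ∑ i : Fin l.length, (-1) ^ (i : ℕ) * Y a l[i] * gpf Y (l.eraseIdx i)
termination_by l => l.length
decreasing_by simp [List.length_eraseIdx]

theorem gpf_nil (Y : Fin n → Fin n → R) : gpf Y [] = 1 := by rw [gpf]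

theorem gpf_cons (Y : Fin n → Fin n → R) (a : Fin n) (l : List (Fin n)) :
    gpf Y (a :: l) = ∑ i : Fin l.length, (-1) ^ (i : ℕ) * Y a l[i] * gpf Y (l.eraseIdx i) := by
  rw [gpf]

theorem gpf_pair (Y : Fin n → Fin n → R) (a b : Fin n) : gpf Y [a, b] = Y a b := by
  simp [gpf_cons, gpf_nil]

/-- Induction on lists following the recursive expansion of pfaffians. -/
theorem eraseIdx_induction {α : Type*} {C : List α → Prop} (nil : C [])
    (cons : ∀ a l, (∀ i : Fin l.length, C (l.eraseIdx i)) → C (a :: l)) (l : List α) : C l := by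
  induction h : l.length using Nat.strong_induction_on generalizing l with
  | _ k ih =>
    cases l with
    | nil => exact nil
    | cons a l =>
      refine cons a l fun i => ih _ ?_ _ rfl
      have := i.2
      simp only [List.length_cons, List.length_eraseIdx] at h ⊢
      split_ifs; omega

theorem IsGauss.aug_delL {Y : Fin n → Fin n → R} {G : ExteriorAlgebra R (Fin n → R)}
    (hG : IsGauss Y G) (l : List (Fin n)) : aug n R (delL R l G) = gpf Y l := by
  induction l using eraseIdx_induction with
  | nil => rw [delL_nil, hG.aug_eq, gpf_nil]
  | cons a l ih =>
    rw [delL_cons, hG.del_eq, lin, delL_ι_mul, map_add, map_sum, map_smul, map_mul, aug_ι, zero_mul,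
      smul_zero, add_zero, gpf_cons]
    exact Finset.sum_congr rfl fun i _ => by rw [map_smul, ih, smul_eq_mul]

theorem gpf_map {S : Type*} [CommRing S] (f : R →+* S) (Y : Fin n → Fin n → R)
    (l : List (Fin n)) : f (gpf Y l) = gpf (fun a b => f (Y a b)) l := by
  induction l using eraseIdx_induction with
  | nil => simp [gpf_nil]
  | cons a l ih => simp [gpf_cons, ih]

theorem gpf_scale (x : Fin n → R) (Y : Fin n → Fin n → R) (l : List (Fin n)) :
    gpf (fun a b => x a * x b * Y a b) l = (l.map x).prod * gpf Y l := by
  induction l using eraseIdx_induction with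
  | nil => simp [gpf_nil]
  | cons a l ih =>
    rw [gpf_cons, gpf_cons, Finset.mul_sum]
    refine Finset.sum_congr rfl fun i _ => ?_
    have h := List.CommMonoid.mul_prod_eraseIdx (l := l.map x) (i := i) (by simp)
    rw [ih, List.map_cons, List.prod_cons, ← h, List.eraseIdx_map, List.getElem_map]
    simp only [Fin.getElem_fin]
    ring

theorem gpf_of_odd (Y : Fin n → Fin n → R) {l : List (Fin n)} (h : Odd l.length) :
    gpf Y l = 0 := by
  induction l using eraseIdx_induction with
  | nil => simp at h
  | cons a l ih =>
    rw [gpf_cons]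
    refine Finset.sum_eq_zero fun i _ => ?_
    rw [ih i, mul_zero]
    have := i.2
    rw [List.length_eraseIdx_of_lt i.2]
    rw [List.length_cons] at h
    obtain ⟨k, hk⟩ := h
    exact ⟨k - 1, by omega⟩

theorem gpf_smul (c : R) (Y : Fin n → Fin n → R) (l : List (Fin n)) :
    gpf (fun a b => c * Y a b) l = c ^ (l.length / 2) * gpf Y l := by
  induction l using eraseIdx_induction with
  | nil => simp [gpf_nil]
  | cons a l ih =>
    rw [gpf_cons, gpf_cons, Finset.mul_sum]
    refine Finset.sum_congr rfl fun i _ => ?_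
    have := i.2
    rw [ih, List.length_eraseIdx_of_lt i.2, List.length_cons,
      show (l.length + 1) / 2 = (l.length - 1) / 2 + 1 by omega]
    ring

/-- `Y` is an alternating matrix. -/
structure IsAltM (Y : Fin n → Fin n → R) : Prop where
  diag : ∀ a, Y a a = 0
  swap : ∀ a b, Y b a = -Y a b

theorem IsAltM.exists_isGauss {Y : Fin n → Fin n → R} (hY : IsAltM Y) : ∃ G, IsGauss Y G :=
  PR.exists_isGauss Y hY.diag hY.swap

theorem IsAltM.gpf_perm {Y : Fin n → Fin n → R} (hY : IsAltM Y) {l m : List (Fin n)}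
    (h : l.Perm m) : ∃ ε : ℤˣ, gpf Y l = ε • gpf Y m := by
  obtain ⟨G, hG⟩ := hY.exists_isGauss
  obtain ⟨ε, hε⟩ := delL_perm (R := R) h
  refine ⟨ε, ?_⟩
  rw [← hG.aug_delL, ← hG.aug_delL, hε, Units.smul_def, Units.smul_def, map_zsmul]

theorem IsAltM.gpf_of_not_nodup {Y : Fin n → Fin n → R} (hY : IsAltM Y) {l : List (Fin n)}
    (h : ¬ l.Nodup) : gpf Y l = 0 := by
  obtain ⟨G, hG⟩ := hY.exists_isGauss
  rw [← hG.aug_delL, delL_of_not_nodup h, map_zero]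

/-- The pfaffian of the rows and columns of `Y` indexed by a finite set. -/
def pfS (Y : Fin n → Fin n → R) (S : Finset (Fin n)) : R := gpf Y S.sort

theorem IsAltM.gpf_eq_pfS {Y : Fin n → Fin n → R} (hY : IsAltM Y) {l : List (Fin n)}
    (h : l.Nodup) : ∃ ε : ℤˣ, gpf Y l = ε • pfS Y l.toFinset := by
  refine hY.gpf_perm ?_
  rw [List.perm_ext_iff_of_nodup h (Finset.sort_nodup _ _)]
  simp

theorem delL_mul (W : Finset (Fin n)) : ∀ η : ℤˣ, ∃ ε : Finset (Fin n) → ℤˣ,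
    ∀ u v : ExteriorAlgebra R (Fin n → R), inv n R u = η • u → 
      delL R W.sort (u * v) =
        ∑ S ∈ W.powerset, ε S • (delL R S.sort u * delL R (W \ S).sort v) := by
  induction W using Finset.induction_on_min with
  | empty => intro η; exact ⟨1, fun u v _ => by simp [delL_nil]⟩
  | insert a s ha ih =>
    intro η
    have has : a ∉ s := fun h => (ha a h).false
    obtain ⟨ε₁, h₁⟩ := ih (-η)
    obtain ⟨ε₂, h₂⟩ := ih η
    refine ⟨fun S => if a ∈ S then ε₁ (S.erase a) else η * ε₂ S, fun u v hu => ?_⟩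
    rw [Finset.sort_insert _ (fun b hb => (ha b hb).le) has, delL_cons, del_mul, hu, map_add,
      smul_mul_assoc, Units.smul_def η, map_zsmul, ← Units.smul_def, h₁, h₂ _ _ hu,
        Finset.sum_powerset_insert has, add_comm,
      Finset.smul_sum]
    · congr 1
      · refine Finset.sum_congr rfl fun S hS => ?_
        have haS : a ∉ S := fun h => has (Finset.mem_powerset.1 hS h)
        simp only [if_neg haS]
        rw [mul_smul, Finset.insert_sdiff_of_notMem _ haS,
          Finset.sort_insert _ (fun b hb => (ha b (Finset.sdiff_subset hb)).le)
          (fun h => has (Finset.sdiff_subset h)), delL_cons]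
      · refine Finset.sum_congr rfl fun S hS => ?_
        have haS : a ∉ S := fun h => has (Finset.mem_powerset.1 hS h)
        simp only [if_pos (Finset.mem_insert_self a S)]
        rw [Finset.erase_insert haS,
          Finset.sort_insert _ (fun b hb => (ha b (Finset.mem_powerset.1 hS hb)).le) haS, delL_cons,
          Finset.insert_sdiff_insert, Finset.sdiff_insert_of_notMem has]
    · rw [inv_del, hu, Units.smul_def, map_zsmul, ← Units.smul_def, Units.neg_smul]

/-- The span of products of at most `j` vectors. -/
def fil (n : ℕ) (R : Type*) [CommRing R] (j : ℕ) : Submodule R (ExteriorAlgebra R (Fin n → R)) :=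
  (1 ⊔ LinearMap.range (ExteriorAlgebra.ι R)) ^ j

theorem fil_induction {C : (j : ℕ) → ExteriorAlgebra R (Fin n → R) → Prop}
    (alg : ∀ r, C 0 (algebraMap R _ r))
    (hadd : ∀ j x y, x ∈ fil n R j → y ∈ fil n R j → C j x → C j y → C j (x + y))
    (mono : ∀ j x, x ∈ fil n R j → C j x → ∀ r : R, C (j + 1) (r • x))
    (mul : ∀ j x, x ∈ fil n R j → C j x → ∀ v, C (j + 1) (ExteriorAlgebra.ι R v * x)) 
    {j : ℕ} {x : ExteriorAlgebra R (Fin n → R)} (hx : x ∈ fil n R j) : C j x := by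
  refine Submodule.pow_induction_on_left' _ (C := fun j x _ => C j x) alg
    (fun x y i hx hy => hadd i x y hx hy) ?_ hx
  intro m hm i x hx hC
  obtain ⟨p, hp, q, ⟨v, rfl⟩, rfl⟩ := Submodule.mem_sup.1 hm
  obtain ⟨r, rfl⟩ := Submodule.mem_one.1 hp
  have hmem : ∀ m ∈ (1 ⊔ LinearMap.range (ExteriorAlgebra.ι R) :
      Submodule R (ExteriorAlgebra R (Fin n → R))), m * x ∈ fil n R (i + 1) := by
    intro m hm
    rw [fil, pow_succ']
    exact Submodule.mul_mem_mul hm hx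
  rw [add_mul]
  refine hadd _ _ _ (hmem _ (Submodule.mem_sup_left hp)) (hmem _ (Submodule.mem_sup_right ⟨v,
    rfl⟩)) ?_ ?_
  · rw [← Algebra.smul_def]; exact mono _ _ hx hC r
  · exact mul _ _ hx hC v

theorem ι_mul_mem_fil {j : ℕ} {x : ExteriorAlgebra R (Fin n → R)} (hx : x ∈ fil n R j)
    (v : Fin n → R) : ExteriorAlgebra.ι R v * x ∈ fil n R (j + 1) := by
  rw [fil, pow_succ']
  exact Submodule.mul_mem_mul (Submodule.mem_sup_right ⟨v, rfl⟩) hx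

theorem mul_mem_fil {i j : ℕ} {x y : ExteriorAlgebra R (Fin n → R)} (hx : x ∈ fil n R i)
    (hy : y ∈ fil n R j) : x * y ∈ fil n R (i + j) := by
  rw [fil, pow_add]
  exact Submodule.mul_mem_mul hx hy

theorem fil_mono {i j : ℕ} (h : i ≤ j) : fil n R i ≤ fil n R j :=
  pow_le_pow_right₀ (le_sup_left) h

theorem algebraMap_mem_fil (r : R) (j : ℕ) : algebraMap R _ r ∈ fil n R j :=
  fil_mono (Nat.zero_le j) (by rw [fil, pow_zero]; exact Submodule.mem_one.2 ⟨r, rfl⟩)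

theorem ι_mem_fil (v : Fin n → R) : ExteriorAlgebra.ι R v ∈ fil n R 1 := by
  rw [fil, pow_one]; exact Submodule.mem_sup_right ⟨v, rfl⟩

theorem inv_mem_fil {j : ℕ} {x : ExteriorAlgebra R (Fin n → R)} (hx : x ∈ fil n R j) :
    inv n R x ∈ fil n R j := by
  refine fil_induction (C := fun j x => inv n R x ∈ fil n R j) ?_ ?_ ?_ ?_ hx
  · intro r; rw [AlgHom.commutes]; exact algebraMap_mem_fil _ _
  · intro j x y _ _ h1 h2; rw [map_add]; exact add_mem h1 h2
  · intro j x _ h r; rw [map_smul]; exact fil_mono (Nat.le_succ _) (Submodule.smul_mem _ _ h)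
  · intro j x _ h v; rw [map_mul, inv_ι, neg_mul]; exact neg_mem (ι_mul_mem_fil h v)

theorem del_mem_fil (a : Fin n) {j : ℕ} {x : ExteriorAlgebra R (Fin n → R)} (hx : x ∈ fil n R j) :
    (j = 0 ∧ del R a x = 0) ∨ (0 < j ∧ del R a x ∈ fil n R (j - 1)) := by
  refine fil_induction (C := fun j x => (j = 0 ∧ del R a x = 0) ∨
    (0 < j ∧ del R a x ∈ fil n R (j - 1))) ?_ ?_ ?_ ?_ hx
  · intro r
    rw [Algebra.algebraMap_eq_smul_one, map_smul, del_one, smul_zero]; simp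
  · rintro j x y _ _ (⟨rfl, h1⟩ | ⟨hj, h1⟩) (⟨h, h2⟩ | ⟨h, h2⟩)
    · simp [h1, h2]
    · simp at h
    · omega
    · right; rw [map_add]; exact ⟨h, add_mem h1 h2⟩
  · rintro j x _ (⟨rfl, h⟩ | ⟨hj, h⟩) r
    · right; rw [map_smul, h]; simp
    · right; rw [map_smul]
      exact ⟨Nat.succ_pos _, Submodule.smul_mem _ _ (fil_mono (by omega) h)⟩
  · rintro j x hx (⟨rfl, h⟩ | ⟨hj, h⟩) v
    · right; rw [del_ι_mul, h]; simpa using Submodule.smul_mem _ _ hx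
    · right; rw [del_ι_mul]
      refine ⟨Nat.succ_pos _, sub_mem (Submodule.smul_mem _ _ hx) ?_⟩
      have := ι_mul_mem_fil h v
      rwa [Nat.sub_add_cancel hj] at this

theorem IsGauss.exists_delL_mul {Y : Fin n → Fin n → R} {G : ExteriorAlgebra R (Fin n → R)}
    (hG : IsGauss Y G) (l : List (Fin n)) {j : ℕ} {c : ExteriorAlgebra R (Fin n → R)}
    (hc : c ∈ fil n R j) : ∃ c' ∈ fil n R (j + l.length), delL R l (c * G) = c' * G := by
  induction l generalizing j c with
  | nil => exact ⟨c, hc, rfl⟩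
  | cons a l ih =>
    have h : del R a (c * G) = (del R a c + inv n R c * lin Y a) * G := by
      rw [del_mul, hG.del_eq, add_mul, mul_assoc]
    have h2 : del R a c + inv n R c * lin Y a ∈ fil n R (j + 1) := by
      refine add_mem ?_ (mul_mem_fil (inv_mem_fil hc) (ι_mem_fil _))
      rcases del_mem_fil a hc with h | h
      · rw [h.2]; exact zero_mem _
      · exact fil_mono (by omega) h.2
    obtain ⟨c', hc', h'⟩ := ih h2
    refine ⟨c', ?_, by rw [delL_cons, h, h']⟩
    rwa [List.length_cons, show j + (l.length + 1) = j + 1 + l.length by ring]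

theorem IsGauss.pow_dvd_aug {Y : Fin n → Fin n → R} {t : R} {G : ExteriorAlgebra R (Fin n → R)}
    (hG : IsGauss (t • Y) G) (l : List (Fin n)) {i j : ℕ} {c : ExteriorAlgebra R (Fin n → R)}
    (hc : c ∈ fil n R j) (h : j + 2 * i ≤ l.length) : t ^ i ∣ aug n R (delL R l (c * G)) := by
  induction l generalizing i j c with
  | nil =>
    rw [show i = 0 by simp at h; omega, pow_zero]; exact one_dvd _
  | cons a l ih =>
    rw [List.length_cons] at h
    cases i with
    | zero => rw [pow_zero]; exact one_dvd _
    | succ i =>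
      have e : del R a (c * G) = del R a c * G + t • (inv n R c * lin Y a * G) := by
        rw [del_mul, hG.del_eq, lin, lin, Pi.smul_apply, map_smul, smul_mul_assoc, mul_smul_comm,
          mul_assoc]
      rw [delL_cons, e, map_add, map_smul, map_add, map_smul]
      refine dvd_add ?_ ?_
      · rcases del_mem_fil a hc with h' | h'
        · rw [h'.2, zero_mul, map_zero, map_zero]; exact dvd_zero _
        · exact ih h'.2 (by omega)
      · rw [pow_succ', smul_eq_mul]
        exact mul_dvd_mul_left _ (ih (mul_mem_fil (inv_mem_fil hc) (ι_mem_fil _)) (by omega))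

end Grassmann

section Straightening

variable {n : ℕ} {R : Type*} [CommRing R]

theorem inv_delL (l : List (Fin n)) (u : ExteriorAlgebra R (Fin n → R)) :
    inv n R (delL R l u) = ((-1 : ℤˣ) ^ l.length) • delL R l (inv n R u) := by
  induction l generalizing u with
  | nil => simp [delL_nil]
  | cons a l ih =>
    rw [delL_cons, ih, inv_del, delL_cons, map_neg, List.length_cons, pow_succ, mul_smul,
      Units.neg_smul, one_smul]

theorem aug_units_smul (ε : ℤˣ) (u : ExteriorAlgebra R (Fin n → R)) :
    aug n R (ε • u) = ε • aug n R u := by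
  rw [Units.smul_def, Units.smul_def, map_zsmul]

theorem IsAltM.map {S : Type*} [CommRing S] (f : R →+* S) {Y : Fin n → Fin n → R}
    (hY : IsAltM Y) : IsAltM fun a b => f (Y a b) where
  diag a := by rw [hY.diag, map_zero]
  swap a b := by rw [hY.swap, map_neg]

theorem IsAltM.smul (c : R) {Y : Fin n → Fin n → R} (hY : IsAltM Y) :
    IsAltM fun a b => c * Y a b where
  diag a := by rw [hY.diag, mul_zero]
  swap a b := by rw [hY.swap, mul_neg]

open Polynomial in
theorem IsAltM.garnir {Y : Fin n → Fin n → R} (hY : IsAltM Y) (A W Z : Finset (Fin n)) (δ : ℕ)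
    (h : A.card + Z.card + 2 * δ ≤ W.card) :
    ∃ ε : Finset (Fin n) → ℤˣ, (1 + X : R[X]) ^ δ ∣ ∑ S ∈ W.powerset,
      ε S • (C (gpf Y (A.sort ++ S.sort)) *
        (X ^ ((Z.card + (W \ S).card) / 2) * C (gpf Y (Z.sort ++ (W \ S).sort)))) := by
  have hY' := hY.map (C : R →+* R[X])
  obtain ⟨G, hG⟩ := hY'.exists_isGauss
  obtain ⟨H, hH⟩ := (hY'.smul X).exists_isGauss
  obtain ⟨ε, hε⟩ := delL_mul (R := R[X]) W ((-1) ^ A.sort.length)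
  refine ⟨ε, ?_⟩
  have key := congrArg (aug n R[X]) (hε (delL R[X] A.sort G) (delL R[X] Z.sort H)
    (by rw [inv_delL, hG.inv_eq]))
  rw [map_sum] at key
  have hGH : IsGauss ((1 + X : R[X]) • fun a b => C (Y a b)) (G * H) := by
    convert hG.mul hH using 1
    funext a b
    simp [add_mul]
  obtain ⟨c, hc, hc'⟩ := hG.exists_delL_mul A.sort (algebraMap_mem_fil (1 : R[X]) 0)
  obtain ⟨d, hd, hd'⟩ := hH.exists_delL_mul Z.sort (algebraMap_mem_fil (1 : R[X]) 0)
  rw [map_one, one_mul] at hc' hd'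
  rw [hc', hd', mul_assoc, ← mul_assoc G, hG.comm, mul_assoc, ← mul_assoc c] at key
  rw [zero_add, Finset.length_sort] at hc hd
  have hdvd := hGH.pow_dvd_aug W.sort (i := δ) (mul_mem_fil hc hd) (by rwa [Finset.length_sort])
  rw [key] at hdvd
  convert hdvd using 1
  refine Finset.sum_congr rfl fun S _ => ?_
  rw [← hc', ← hd', aug_units_smul, map_mul, ← delL_append, ← delL_append, hG.aug_delL,
    hH.aug_delL, gpf_smul, List.length_append, Finset.length_sort, Finset.length_sort]
  simp only [gpf_map]

open Polynomial in
theorem IsAltM.gpf_mul_gpf_eq_zero {Y : Fin n → Fin n → R} (hY : IsAltM Y)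
    {A W Z S₀ : Finset (Fin n)} {δ m : ℕ} (h : A.card + Z.card + 2 * δ ≤ W.card) (hS₀ : S₀ ⊆ W)
    (h1 : m ≤ (Z.card + (W \ S₀).card) / 2) (h2 : (Z.card + (W \ S₀).card) / 2 < m + δ)
    (h3 : ∀ S ⊆ W, S ≠ S₀ →
      gpf Y (A.sort ++ S.sort) * gpf Y (Z.sort ++ (W \ S).sort) = 0 ∨
      (m ≤ (Z.card + (W \ S).card) / 2 ∧ (Z.card + (W \ S).card) / 2 < m + δ ∧
        (Z.card + (W \ S).card) / 2 ≠ (Z.card + (W \ S₀).card) / 2)) :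
    gpf Y (A.sort ++ S₀.sort) * gpf Y (Z.sort ++ (W \ S₀).sort) = 0 := by
  obtain ⟨ε, hε⟩ := hY.garnir A W Z δ h
  set Q := ∑ S ∈ W.powerset, ε S • (C (gpf Y (A.sort ++ S.sort)) *
        (X ^ ((Z.card + (W \ S).card) / 2) * C (gpf Y (Z.sort ++ (W \ S).sort)))) with hQ
  have hQ' : Q = ∑ S ∈ W.powerset, monomial ((Z.card + (W \ S).card) / 2)
      (ε S • (gpf Y (A.sort ++ S.sort) * gpf Y (Z.sort ++ (W \ S).sort))) := by
    refine Finset.sum_congr rfl fun S _ => ?_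
    rw [Units.smul_def, Units.smul_def, map_zsmul, mul_left_comm, ← C_mul, mul_comm,
      C_mul_X_pow_eq_monomial]
  have hcoeff : ∀ d, Q.coeff d = ∑ S ∈ W.powerset, if (Z.card + (W \ S).card) / 2 = d then
      ε S • (gpf Y (A.sort ++ S.sort) * gpf Y (Z.sort ++ (W \ S).sort)) else 0 := by
    intro d
    rw [hQ', finsetSum_coeff]
    exact Finset.sum_congr rfl fun S _ => by rw [coeff_monomial]
  have hout : ∀ d, d < m ∨ m + δ ≤ d → Q.coeff d = 0 := by
    intro d hd
    rw [hcoeff]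
    refine Finset.sum_eq_zero fun S hS => ?_
    by_cases hSS : S = S₀
    · subst hSS; rw [if_neg (by omega)]
    · rcases h3 S (Finset.mem_powerset.1 hS) hSS with h | h
      · rw [h, smul_zero, ite_self]
      · rw [if_neg (by omega)]
  have hX : (X : R[X]) ^ m ∣ Q := X_pow_dvd_iff.2 fun d hd => hout d (Or.inl hd)
  have hcop : IsCoprime ((X : R[X]) ^ m) ((1 + X) ^ δ) :=
    IsCoprime.pow ⟨-1, 1, by ring⟩
  have hdvd := hcop.mul_dvd hX hε
  have hQ0 : Q = 0 := by
    nontriviality R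
    by_contra hne
    have hmon : ((1 : R[X]) + X).Monic := by rw [add_comm, ← C_1]; exact monic_X_add_C 1
    have hdeg : ((1 : R[X]) + X).natDegree = 1 := by
      rw [add_comm, ← C_1]; exact natDegree_X_add_C 1
    refine ((monic_X_pow m).mul (hmon.pow δ)).not_dvd_of_degree_lt hne ?_ hdvd
    rw [degree_eq_natDegree ((monic_X_pow m).mul (hmon.pow δ)).ne_zero,
      (monic_X_pow m).natDegree_mul (hmon.pow δ), natDegree_X_pow, hmon.natDegree_pow,
      hdeg, mul_one, degree_lt_iff_coeff_zero]
    exact fun d hd => hout d (Or.inr hd)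
  have hc := hcoeff ((Z.card + (W \ S₀).card) / 2)
  rw [hQ0, coeff_zero, Finset.sum_eq_single S₀, if_pos rfl] at hc
  · exact (smul_eq_zero_iff_eq _).1 hc.symm
  · intro S hS hSS
    rcases h3 S (Finset.mem_powerset.1 hS) hSS with h | h
    · rw [h, smul_zero, ite_self]
    · rw [if_neg h.2.2]
  · intro h; exact absurd (Finset.mem_powerset.2 hS₀) h

theorem IsAltM.gpf_append {Y : Fin n → Fin n → R} (hY : IsAltM Y) {A S : Finset (Fin n)}
    (h : Disjoint A S) : ∃ ε : ℤˣ, gpf Y (A.sort ++ S.sort) = ε • pfS Y (A ∪ S) := by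
  have := hY.gpf_eq_pfS (l := A.sort ++ S.sort) (List.nodup_append.2 ⟨Finset.sort_nodup _ _,
    Finset.sort_nodup _ _, by
    intro a ha b hb hab
    rw [Finset.mem_sort] at ha hb
    exact Finset.disjoint_left.1 h ha (hab ▸ hb)⟩)
  rwa [List.toFinset_append, Finset.sort_toFinset, Finset.sort_toFinset] at this

theorem IsAltM.gpf_append_eq_zero {Y : Fin n → Fin n → R} (hY : IsAltM Y) {A S : Finset (Fin n)}
    (h : Disjoint A S → (A ∪ S).card = A.card + S.card → pfS Y (A ∪ S) = 0) :
    gpf Y (A.sort ++ S.sort) = 0 := by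
  by_cases hd : Disjoint A S
  · obtain ⟨ε, hε⟩ := hY.gpf_append hd
    rw [hε, h hd (Finset.card_union_of_disjoint hd), smul_zero]
  · refine hY.gpf_of_not_nodup fun hnd => hd ?_
    rw [Finset.disjoint_left]
    intro a ha hb
    exact (List.nodup_append.1 hnd).2.2 a ((Finset.mem_sort _).2 ha) a ((Finset.mem_sort _).2 hb)
      rfl

/-- The number of elements of `N` that are at most `a`. -/
def cnt (N : Finset (Fin n)) (a : Fin n) : ℕ := (N.filter (· ≤ a)).card

theorem cnt_add (N : Finset (Fin n)) (a : Fin n) :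
    cnt N a + (N.filter (a < ·)).card = N.card := by
  rw [cnt, ← Finset.card_filter_add_card_filter_not (s := N) (· ≤ a)]
  simp only [not_le]

theorem IsAltM.pfS_mul_pfS_eq_zero {Y : Fin n → Fin n → R} (hY : IsAltM Y)
    {N M : Finset (Fin n)} (hN : Even N.card) (hM : Even M.card) (hMN : M.card ≤ N.card)
    {q : Fin n} (hq : cnt N q < cnt M q)
    (h1 : ∀ L : Finset (Fin n), Even L.card → N.card < L.card → pfS Y L = 0)
    (h2 : ∀ L : Finset (Fin n), L.card = N.card → (∀ a, cnt N a ≤ cnt L a) →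
      cnt N q < cnt L q → pfS Y L = 0) : pfS Y N * pfS Y M = 0 := by
  obtain ⟨k, hk⟩ := hN
  obtain ⟨l, hl⟩ := hM
  set A := N.filter (· ≤ q) with hA
  set B := N.filter (q < ·) with hB
  set D := M.filter (· ≤ q) with hD
  set Z := M.filter (q < ·) with hZ
  have hNc : A.card + B.card = N.card := cnt_add N q
  have hMc : D.card + Z.card = M.card := cnt_add M q
  have hq' : A.card < D.card := hq
  have hDB : Disjoint D B := by
    rw [Finset.disjoint_left]
    intro a ha hb
    exact absurd (Finset.mem_filter.1 ha).2 (not_le.2 (Finset.mem_filter.1 hb).2)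
  have hW : (D ∪ B).card = D.card + B.card := Finset.card_union_of_disjoint hDB
  have hAB : Disjoint A B := by
    rw [Finset.disjoint_left]
    intro a ha hb
    exact absurd (Finset.mem_filter.1 ha).2 (not_le.2 (Finset.mem_filter.1 hb).2)
  have hDZ : Disjoint Z D := by
    rw [Finset.disjoint_left]
    intro a hb ha
    exact absurd (Finset.mem_filter.1 ha).2 (not_le.2 (Finset.mem_filter.1 hb).2)
  have hWB : (D ∪ B) \ B = D := by
    rw [Finset.union_sdiff_right, Finset.sdiff_eq_self_of_disjoint hDB]
  have hABN : A ∪ B = N := by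
    ext a; simp only [hA, hB, Finset.mem_union, Finset.mem_filter, ← and_or_left, le_or_gt,
      and_true]
  have hZDM : Z ∪ D = M := by
    ext a; simp only [hZ, hD, Finset.mem_union, Finset.mem_filter, ← and_or_left, lt_or_ge,
      and_true]
  have key := hY.gpf_mul_gpf_eq_zero (A := A) (W := D ∪ B) (Z := Z) (S₀ := B) (δ := k - l + 1)
    (m := l) (by omega) Finset.subset_union_right (by rw [hWB]; omega) (by rw [hWB]; omega) ?_
  · rw [hWB] at key
    obtain ⟨ε, hε⟩ := hY.gpf_append hAB
    obtain ⟨η, hη⟩ := hY.gpf_append hDZ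
    rw [hε, hη, hABN, hZDM, smul_mul_smul_comm] at key
    exact (smul_eq_zero_iff_eq _).1 key
  · intro S hS hSB
    have hSc : (((D ∪ B) \ S).card) + S.card = (D ∪ B).card := Finset.card_sdiff_add_card_eq_card hS
    rw [hWB]
    rcases Nat.even_or_odd (A.card + S.card) with ⟨p, hp⟩ | hodd
    swap
    · left
      rw [gpf_of_odd, zero_mul]
      rw [List.length_append, Finset.length_sort, Finset.length_sort]; exact hodd
    rcases lt_trichotomy p k with hpk | hpk | hpk
    · by_cases hpl : p < l
      · left
        rw [mul_comm, hY.gpf_append_eq_zero, zero_mul]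
        intro _ hc
        exact h1 _ ⟨k + l - p, by omega⟩ (by omega)
      · right; omega
    · left
      rw [hY.gpf_append_eq_zero, zero_mul]
      intro hd hc
      refine h2 _ (by omega) ?_ ?_
      · intro a
        rcases le_total a q with haq | haq
        · refine Finset.card_le_card fun b hb => ?_
          rw [Finset.mem_filter] at hb ⊢
          exact ⟨Finset.mem_union_left _ (Finset.mem_filter.2 ⟨hb.1, hb.2.trans haq⟩), hb.2⟩
        · have e1 := cnt_add N a
          have e2 := cnt_add (A ∪ S) a
          have : ((A ∪ S).filter (a < ·)).card ≤ (N.filter (a < ·)).card := by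
            refine Finset.card_le_card fun b hb => ?_
            rw [Finset.mem_filter, Finset.mem_union] at hb
            rw [Finset.mem_filter]
            refine ⟨?_, hb.2⟩
            rcases hb.1 with h | h
            · exact (Finset.mem_filter.1 h).1
            · rcases Finset.mem_union.1 (hS h) with h | h
              · exact absurd (Finset.mem_filter.1 h).2 (not_le.2 (haq.trans_lt hb.2))
              · exact (Finset.mem_filter.1 h).1
          omega
      · have hnot : ¬ S ⊆ B := fun h => hSB (Finset.eq_of_subset_of_card_le h (by omega))
        rw [Finset.not_subset] at hnot
        obtain ⟨b, hbS, hbB⟩ := hnot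
        have hbD : b ∈ D := (Finset.mem_union.1 (hS hbS)).resolve_right hbB
        refine Finset.card_lt_card (Finset.ssubset_iff_of_subset ?_ |>.2 ⟨b, ?_, ?_⟩)
        · intro c hc
          rw [Finset.mem_filter]
          exact ⟨Finset.mem_union_left _ hc, (Finset.mem_filter.1 hc).2⟩
        · rw [Finset.mem_filter]
          exact ⟨Finset.mem_union_right _ hbS, (Finset.mem_filter.1 hbD).2⟩
        · exact fun hbA => Finset.disjoint_left.1 hd hbA hbS
    · left
      rw [hY.gpf_append_eq_zero, zero_mul]
      intro _ hc
      exact h1 _ ⟨p, by omega⟩ (by omega)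

end Straightening

section Standard

variable {n : ℕ}

/-- The entrywise order on rows, allowing the smaller row to be longer. -/
def rowLE (N M : Finset (Fin n)) : Prop := ∀ a, cnt M a ≤ cnt N a

theorem rowLE_trans {N M L : Finset (Fin n)} (h : rowLE N M) (h' : rowLE M L) : rowLE N L :=
  fun a => (h' a).trans (h a)

theorem cnt_le_card (N : Finset (Fin n)) (a : Fin n) : cnt N a ≤ N.card :=
  Finset.card_le_card (Finset.filter_subset _ _)

theorem exists_cnt_eq_card {N : Finset (Fin n)} (h : N.Nonempty) : ∃ a, ∀ M : Finset (Fin n),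
    cnt M a = M.card := by
  obtain ⟨b, _⟩ := h
  have hn : 0 < n := b.pos
  refine ⟨⟨n - 1, by omega⟩, fun M => ?_⟩
  rw [cnt, Finset.filter_true_of_mem]
  intro c _
  exact Fin.le_def.2 (by have := c.2; simp only; omega)

theorem rowLE.card_le {N M : Finset (Fin n)} (h : rowLE N M) : M.card ≤ N.card := by
  rcases M.eq_empty_or_nonempty with rfl | hM
  · simp
  · obtain ⟨a, ha⟩ := exists_cnt_eq_card hM
    have := h a
    rwa [ha, ha] at this

theorem cnt_eq_cnt_pred (N : Finset (Fin n)) (a : Fin n) :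
    cnt N a = (N.filter (· < a)).card + if a ∈ N then 1 else 0 := by
  rw [cnt, ← Finset.card_filter_add_card_filter_not (s := N.filter (· ≤ a)) (· < a),
    Finset.filter_filter, Finset.filter_filter]
  congr 1
  · congr 1; ext b; simp only [Finset.mem_filter]; grind
  · have : N.filter (fun b => b ≤ a ∧ ¬ b < a) = if a ∈ N then {a} else ∅ := by
      ext b; split_ifs <;> simp only [Finset.mem_filter, Finset.mem_singleton,
        Finset.notMem_empty] <;> grind
    rw [this]; split_ifs <;> simp

theorem eq_of_cnt_eq {N M : Finset (Fin n)} (h : ∀ a, cnt N a = cnt M a) : N = M := by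
  have hlt : ∀ (N M : Finset (Fin n)), (∀ a, cnt N a = cnt M a) → ∀ a,
      (N.filter (· < a)).card = (M.filter (· < a)).card := by
    intro N M h a
    by_cases ha : (a : ℕ) = 0
    · have : ∀ b : Fin n, ¬ b < a := fun b hb => by rw [Fin.lt_def] at hb; omega
      simp [this]
    · have e : ∀ L : Finset (Fin n), L.filter (· < a) = L.filter (· ≤ (⟨a - 1,
        by omega⟩ : Fin n)) := by
        intro L; ext b
        have : b < a ↔ b ≤ (⟨a - 1, by omega⟩ : Fin n) := by
          show (b : ℕ) < a ↔ (b : ℕ) ≤ a - 1; omega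
        simp only [Finset.mem_filter, this]
      rw [e, e]; exact h _
  ext a
  have h1 := h a
  rw [cnt_eq_cnt_pred, cnt_eq_cnt_pred, hlt N M h a] at h1
  by_cases hN : a ∈ N <;> by_cases hM : a ∈ M <;> simp_all

/-- The sum of the counting function of a row. -/
def mu (N : Finset (Fin n)) : ℕ := ∑ a, cnt N a

/-- An upward closed family of nonempty rows of even size. -/
structure IsUpper (H : Finset (Finset (Fin n))) : Prop where
  even : ∀ N ∈ H, Even N.card
  nonempty : ∀ N ∈ H, N.Nonempty
  upper : ∀ N ∈ H, ∀ M : Finset (Fin n), Even M.card → M.Nonempty → rowLE N M → M ∈ H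

/-- A standard tableau with rows in `H`. -/
def IsStd (H : Finset (Finset (Fin n))) (T : List (Finset (Fin n))) : Prop :=
  (∀ N ∈ T, N ∈ H) ∧ T.Pairwise rowLE

/-- The product of the pfaffians of the rows of a tableau. -/
def val {R : Type*} [CommRing R] (Y : Fin n → Fin n → R) (T : List (Finset (Fin n))) : R :=
  (T.map (pfS Y)).prod

theorem pfS_map {R S : Type*} [CommRing R] [CommRing S] (f : R →+* S) (Y : Fin n → Fin n → R)
    (N : Finset (Fin n)) : f (pfS Y N) = pfS (fun a b => f (Y a b)) N := gpf_map f Y _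

theorem val_map {R S : Type*} [CommRing R] [CommRing S] (f : R →+* S) (Y : Fin n → Fin n → R)
    (T : List (Finset (Fin n))) : f (val Y T) = val (fun a b => f (Y a b)) T := by
  rw [val, map_list_prod, List.map_map, val]
  congr 2
  funext N
  exact pfS_map f Y N

variable (n) (F : Type*) [Field F]

/-- The index set of the variables of the generic alternating matrix. -/
abbrev Strict := {p : Fin n × Fin n // p.1 < p.2}

/-- The generic alternating matrix. -/
def altY (a b : Fin n) : MvPolynomial (Strict n) F :=
  if h : a < b then MvPolynomial.X ⟨(a, b), h⟩
  else if h : b < a then -MvPolynomial.X ⟨(b, a), h⟩ else 0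

theorem altY_isAltM : IsAltM (altY n F) where
  diag a := by simp [altY]
  swap a b := by
    unfold altY
    rcases lt_trichotomy a b with h | h | h
    · simp [h, h.not_gt]
    · subst h; simp
    · simp [h, h.not_gt]

variable {n}

/-- The weight on variables induced by a weight on indices. -/
def vwt (v : Fin n → ℕ) (p : Strict n) : ℕ := v p.1.1 + v p.1.2

/-- The space of weighted homogeneous polynomials in the generic alternating matrix. -/
abbrev Hom (v : Fin n → ℕ) (w : ℕ) : Submodule F (MvPolynomial (Strict n) F) :=
  MvPolynomial.weightedHomogeneousSubmodule F (vwt v) w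

variable {F}

theorem altY_mem (v : Fin n → ℕ) (a b : Fin n) : altY n F a b ∈ Hom F v (v a + v b) := by
  unfold altY
  split_ifs with h h
  · exact MvPolynomial.isWeightedHomogeneous_X _ _ _
  · rw [add_comm]; exact neg_mem (MvPolynomial.isWeightedHomogeneous_X F (vwt v) (⟨(b, a),
      h⟩ : Strict n))
  · exact zero_mem _

theorem mul_mem_hom {v : Fin n → ℕ} {i j k : ℕ} {p q : MvPolynomial (Strict n) F}
    (hp : p ∈ Hom F v i) (hq : q ∈ Hom F v j) (h : i + j = k) : p * q ∈ Hom F v k := by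
  subst h
  exact MvPolynomial.IsWeightedHomogeneous.mul hp hq

theorem gpf_mem_hom (v : Fin n → ℕ) (l : List (Fin n)) :
    gpf (altY n F) l ∈ Hom F v (l.map v).sum := by
  induction l using eraseIdx_induction with
  | nil => rw [gpf_nil]; exact MvPolynomial.isWeightedHomogeneous_one _ _
  | cons a l ih =>
    rw [gpf_cons]
    refine sum_mem fun i _ => ?_
    have h := ((List.getElem_cons_eraseIdx_perm i.2).map v).sum_eq
    rw [List.map_cons, List.sum_cons] at h
    refine mul_mem_hom (i := v a + v l[i]) ?_ (ih i) ?_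
    · have : (-1 : MvPolynomial (Strict n) F) ^ (i : ℕ) * altY n F a l[i] =
          ((-1 : ℤˣ) ^ (i : ℕ)) • altY n F a l[i] := by
        rw [Units.smul_def, zsmul_eq_mul]; simp
      rw [this]
      rcases Int.units_eq_one_or ((-1 : ℤˣ) ^ (i : ℕ)) with h | h
      · rw [h, one_smul]; exact altY_mem v _ _
      · rw [h, Units.neg_smul, one_smul]; exact neg_mem (altY_mem v _ _)
    · rw [List.map_cons, List.sum_cons, ← h, Fin.getElem_fin, add_assoc]

/-- The weight of a row. -/
def rwt (v : Fin n → ℕ) (N : Finset (Fin n)) : ℕ := ∑ a ∈ N, v a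

theorem pfS_mem_hom (v : Fin n → ℕ) (N : Finset (Fin n)) :
    pfS (altY n F) N ∈ Hom F v (rwt v N) := by
  have : rwt v N = (N.sort.map v).sum := by
    rw [rwt, Finset.sum_eq_multiset_sum, ← Multiset.sum_coe, ← Multiset.map_coe, Finset.sort_eq]
  rw [this]
  exact gpf_mem_hom v _

/-- The weight `w` part of the ideal generated by pfaffians of rows outside `H`. -/
def outer (v : Fin n → ℕ) (H : Finset (Finset (Fin n))) (w : ℕ) :
    Submodule F (MvPolynomial (Strict n) F) :=
  Submodule.span F {p | ∃ (q : MvPolynomial (Strict n) F) (L : Finset (Fin n)) (u : ℕ),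
    Even L.card ∧ L.Nonempty ∧ L ∉ H ∧ q ∈ Hom F v u ∧ u + rwt v L = w ∧
      p = q * pfS (altY n F) L}

theorem mul_mem_outer {v : Fin n → ℕ} {H : Finset (Finset (Fin n))} {w u k : ℕ}
    {p q : MvPolynomial (Strict n) F} (hq : q ∈ Hom F v u) (hp : p ∈ outer v H w)
    (h : u + w = k) : q * p ∈ outer v H k := by
  refine Submodule.span_induction (p := fun p _ => q * p ∈ outer v H k) ?_ ?_ ?_ ?_ hp
  · rintro _ ⟨q', L, u', h1, h2, h3, h4, h5, rfl⟩
    refine Submodule.subset_span ⟨q * q', L, u + u', h1, h2, h3, mul_mem_hom hq h4 rfl, by omega,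
      by rw [mul_assoc]⟩
  · rw [mul_zero]; exact zero_mem _
  · intro x y _ _ hx hy; rw [mul_add]; exact add_mem hx hy
  · intro c x _ hx; rw [mul_smul_comm]; exact Submodule.smul_mem _ _ hx

/-- The ideal generated by pfaffians of rows outside `H`. -/
def outerIdeal (F : Type*) [Field F] (H : Finset (Finset (Fin n))) :
    Ideal (MvPolynomial (Strict n) F) :=
  Ideal.span {p | ∃ L : Finset (Fin n), Even L.card ∧ L.Nonempty ∧ L ∉ H ∧ p = pfS (altY n F) L}

theorem mem_outer_of_mem_outerIdeal {v : Fin n → ℕ} {H : Finset (Finset (Fin n))} {w : ℕ}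
    {p : MvPolynomial (Strict n) F} (hp : p ∈ Hom F v w) (hpI : p ∈ outerIdeal F H) :
    p ∈ outer v H w := by
  classical
  let _ := MvPolynomial.weightedGradedAlgebra F (vwt v)
  have key : ∀ x ∈ outerIdeal F H, ∀ q : MvPolynomial (Strict n) F,
      ((DirectSum.decompose (MvPolynomial.weightedHomogeneousSubmodule F (vwt v)) (q * x)) w :
        MvPolynomial (Strict n) F) ∈ outer v H w := by
    intro x hx
    refine Submodule.span_induction ?_ ?_ ?_ ?_ hx
    · rintro _ ⟨L, h1, h2, h3, rfl⟩ q
      by_cases hw : rwt v L ≤ w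
      · rw [DirectSum.coe_decompose_mul_of_right_mem_of_le _ (pfS_mem_hom v L) hw]
        exact Submodule.subset_span ⟨_, L, w - rwt v L, h1, h2, h3, SetLike.coe_mem _, by omega,
          rfl⟩
      · rw [DirectSum.coe_decompose_mul_of_right_mem_of_not_le _ (pfS_mem_hom v L) hw]
        exact zero_mem _
    · intro q; simp
    · intro x y _ _ hx hy q
      rw [mul_add, DirectSum.decompose_add, DirectSum.add_apply, Submodule.coe_add]
      exact add_mem (hx q) (hy q)
    · intro a x _ hx q
      rw [smul_eq_mul, ← mul_assoc]
      exact hx _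
  have := key p hpI 1
  rwa [one_mul, DirectSum.decompose_of_mem_same _ hp] at this

end Standard

section Spanning

variable {n : ℕ} {F : Type*} [Field F]

theorem pfS_mul_pfS_mem_outerIdeal {H : Finset (Finset (Fin n))} {N M : Finset (Fin n)}
    (hN : Even N.card) (hM : Even M.card) (hcard : ∀ L ∈ H, L.card ≤ N.card)
    (hmu : ∀ L ∈ H, L.card = N.card → mu L ≤ mu N) (hMH : M ∈ H) (h : ¬ rowLE N M) :
    pfS (altY n F) N * pfS (altY n F) M ∈ outerIdeal F H := by
  rw [rowLE] at h
  push Not at h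
  obtain ⟨q, hq⟩ := h
  have hout : ∀ L : Finset (Fin n), Even L.card → L.Nonempty → L ∉ H →
      pfS (fun a b => Ideal.Quotient.mk (outerIdeal F H) (altY n F a b)) L = 0 := by
    intro L h1 h2 h3
    rw [← pfS_map, Ideal.Quotient.eq_zero_iff_mem]
    exact Ideal.subset_span ⟨L, h1, h2, h3, rfl⟩
  rw [← Ideal.Quotient.eq_zero_iff_mem, map_mul, pfS_map, pfS_map]
  refine ((altY_isAltM n F).map _).pfS_mul_pfS_eq_zero hN hM (hcard M hMH) hq ?_ ?_
  · intro L hL hlt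
    exact hout L hL (Finset.card_pos.1 (by omega)) fun hLH => absurd (hcard L hLH) (by omega)
  · intro L hL hle hlt
    refine hout L (hL ▸ hN) (Finset.card_pos.1 ?_) fun hLH => ?_
    · exact lt_of_lt_of_le (Nat.zero_lt_of_lt hlt) (cnt_le_card L q)
    · refine absurd (hmu L hLH hL) (not_le.2 ?_)
      exact Finset.sum_lt_sum (fun a _ => hle a) ⟨q, Finset.mem_univ _, hlt⟩

/-- The span of the standard tableaux with rows in `H`. -/
def stdSpan (F : Type*) [Field F] (H : Finset (Finset (Fin n))) :
    Submodule F (MvPolynomial (Strict n) F) :=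
  Submodule.span F {p | ∃ T, IsStd H T ∧ p = val (altY n F) T}

theorem pfS_pair {R : Type*} [CommRing R] (Y : Fin n → Fin n → R) {a b : Fin n} (h : a < b) :
    pfS Y {a, b} = Y a b := by
  rw [pfS, Finset.sort_insert, Finset.sort_singleton, gpf_pair]
  · intro c hc; rw [Finset.mem_singleton.1 hc]; exact h.le
  · rw [Finset.mem_singleton]; exact h.ne

theorem hom_le_of_empty (v : Fin n → ℕ) (w : ℕ) {p : MvPolynomial (Strict n) F}
    (hp : p ∈ Hom F v w) : p ∈ stdSpan F (∅ : Finset (Finset (Fin n))) ⊔ outer v ∅ w := by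
  classical
  rw [← MvPolynomial.support_sum_monomial_coeff p]
  refine sum_mem fun m hm => ?_
  have hmw : Finsupp.weight (vwt v) m = w := hp (MvPolynomial.mem_support_iff.1 hm)
  by_cases h0 : m = 0
  · refine Submodule.mem_sup_left ?_
    have : MvPolynomial.monomial m (MvPolynomial.coeff m p) =
        MvPolynomial.coeff m p • val (altY n F) [] := by
      rw [h0, val, List.map_nil, List.prod_nil, MvPolynomial.smul_eq_C_mul, mul_one]; rfl
    rw [this]
    exact Submodule.smul_mem _ _ (Submodule.subset_span ⟨[], ⟨by simp, List.Pairwise.nil⟩, rfl⟩)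
  · refine Submodule.mem_sup_right ?_
    obtain ⟨s, hs⟩ := Finsupp.ne_iff.1 h0
    rw [Finsupp.zero_apply] at hs
    have hle : Finsupp.single s 1 ≤ m := by
      rw [Finsupp.single_le_iff]; omega
    have hm' : m - Finsupp.single s 1 + Finsupp.single s 1 = m := tsub_add_cancel_of_le hle
    have hwt := congrArg (Finsupp.weight (vwt v)) hm'
    rw [map_add, hmw, Finsupp.weight_single, one_smul] at hwt
    refine Submodule.subset_span ⟨MvPolynomial.monomial (m - Finsupp.single s 1)
      (MvPolynomial.coeff m p), {s.1.1, s.1.2}, _, ?_, by simp, by simp,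
      MvPolynomial.isWeightedHomogeneous_monomial _ _ _ rfl, ?_, ?_⟩
    · rw [Finset.card_pair s.2.ne]; exact even_two
    · rw [rwt, Finset.sum_pair s.2.ne]; exact hwt
    · rw [pfS_pair _ s.2, altY, dif_pos s.2, MvPolynomial.X, MvPolynomial.monomial_mul, mul_one,
        hm']

theorem stdSpan_mono {H H' : Finset (Finset (Fin n))} (h : H ⊆ H') : stdSpan F H ≤ stdSpan F H' :=
  Submodule.span_mono fun _ ⟨T, hT, e⟩ => ⟨T, ⟨fun N hN => h (hT.1 N hN), hT.2⟩, e⟩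

theorem hom_le (v : Fin n → ℕ) (hv : ∀ a, 0 < v a) (w : ℕ) :
    ∀ H : Finset (Finset (Fin n)), IsUpper H → Hom F v w ≤ stdSpan F H ⊔ outer v H w := by
  classical
  induction w using Nat.strong_induction_on with
  | _ w ihw =>
  intro H
  induction H using Finset.strongInduction with
  | _ H ihH =>
  intro hH p hp
  rcases H.eq_empty_or_nonempty with rfl | hne
  · exact hom_le_of_empty v w hp
  obtain ⟨N₀, hN₀, hmax₀⟩ := H.exists_max_image Finset.card hne
  obtain ⟨N, hN', hmaxN⟩ := (H.filter fun L => L.card = N₀.card).exists_max_image mu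
    ⟨N₀, by simp [hN₀]⟩
  obtain ⟨hN, hNc⟩ := Finset.mem_filter.1 hN'
  have hcard : ∀ L ∈ H, L.card ≤ N.card := fun L hL => hNc ▸ hmax₀ L hL
  have hmu : ∀ L ∈ H, L.card = N.card → mu L ≤ mu N := fun L hL h =>
    hmaxN L (Finset.mem_filter.2 ⟨hL, h.trans hNc⟩)
  have hNwt : 0 < rwt v N := Finset.sum_pos (fun a _ => hv a) (hH.nonempty N hN)
  have hupper : IsUpper (H.erase N) := by
    refine ⟨fun L hL => hH.even L (Finset.mem_of_mem_erase hL),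
      fun L hL => hH.nonempty L (Finset.mem_of_mem_erase hL), fun L hL M h1 h2 h3 => ?_⟩
    have hLH := Finset.mem_of_mem_erase hL
    refine Finset.mem_erase.2 ⟨?_, hH.upper L hLH M h1 h2 h3⟩
    rintro rfl
    refine (Finset.mem_erase.1 hL).1 (eq_of_cnt_eq fun a => ?_)
    have hc : L.card = M.card := le_antisymm (hcard L hLH) h3.card_le
    have hs : mu M = mu L := le_antisymm (Finset.sum_le_sum fun a _ => h3 a) (hmu L hLH hc)
    exact ((Finset.sum_eq_sum_iff_of_le fun a _ => h3 a).1 hs a (Finset.mem_univ _)).symm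
  obtain ⟨s, hs, t, ht, rfl⟩ := Submodule.mem_sup.1 (ihH _ (Finset.erase_ssubset hN) hupper hp)
  refine add_mem (Submodule.mem_sup_left (stdSpan_mono (Finset.erase_subset _ _) hs)) ?_
  refine (Submodule.span_le.2 ?_ : outer v (H.erase N) w ≤ _) ht
  rintro _ ⟨q, L, u, h1, h2, h3, h4, h5, rfl⟩
  by_cases hLH : L ∉ H
  · exact Submodule.mem_sup_right (Submodule.subset_span ⟨q, L, u, h1, h2, hLH, h4, h5, rfl⟩)
  have hLN : L = N := by
    by_contra hne'
    exact h3 (Finset.mem_erase.2 ⟨hne', not_not.1 hLH⟩)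
  subst hLN
  set H' : Finset (Finset (Fin n)) := Finset.univ.filter
    fun M => Even M.card ∧ M.Nonempty ∧ rowLE L M with hH'
  have hmem : ∀ M, M ∈ H' ↔ Even M.card ∧ M.Nonempty ∧ rowLE L M := by simp [hH']
  have hupper' : IsUpper H' := by
    refine ⟨fun M hM => ((hmem M).1 hM).1, fun M hM => ((hmem M).1 hM).2.1,
      fun M hM K h1 h2 h3 => ?_⟩
    exact (hmem K).2 ⟨h1, h2, rowLE_trans ((hmem M).1 hM).2.2 h3⟩
  obtain ⟨s', hs', t', ht', rfl⟩ := Submodule.mem_sup.1 (ihw u (by omega) H' hupper' h4)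
  rw [add_mul]
  refine add_mem (Submodule.mem_sup_left ?_) (Submodule.mem_sup_right ?_)
  · refine Submodule.span_induction ?_ ?_ ?_ ?_ hs'
    · rintro _ ⟨T, hT, rfl⟩
      refine Submodule.subset_span ⟨L :: T, ⟨?_, ?_⟩, ?_⟩
      · intro M hM
        rcases List.mem_cons.1 hM with rfl | hM
        · exact hN
        · have := (hmem M).1 (hT.1 M hM)
          exact hH.upper L hN M this.1 this.2.1 this.2.2
      · exact List.pairwise_cons.2 ⟨fun M hM => ((hmem M).1 (hT.1 M hM)).2.2, hT.2⟩
      · rw [val, val, List.map_cons, List.prod_cons, mul_comm]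
    · rw [zero_mul]; exact zero_mem _
    · intro x y _ _ hx hy; rw [add_mul]; exact add_mem hx hy
    · intro c x _ hx; rw [smul_mul_assoc]; exact Submodule.smul_mem _ _ hx
  · refine Submodule.span_induction ?_ ?_ ?_ ?_ ht'
    · rintro _ ⟨q', M, u', g1, g2, g3, g4, g5, rfl⟩
      by_cases hMH : M ∈ H
      · rw [mul_assoc, mul_comm (pfS _ M)]
        have hle : ¬ rowLE L M := fun h => g3 ((hmem M).2 ⟨g1, g2, h⟩)
        refine mul_mem_outer g4 (mem_outer_of_mem_outerIdeal (mul_mem_hom (pfS_mem_hom v L)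
          (pfS_mem_hom v M) rfl) (pfS_mul_pfS_mem_outerIdeal h1 g1 hcard hmu hMH hle)) (by omega)
      · rw [mul_right_comm]
        exact Submodule.subset_span ⟨_, M, u' + rwt v L, g1, g2, hMH,
          mul_mem_hom g4 (pfS_mem_hom v L) rfl, by omega, rfl⟩
    · rw [zero_mul]; exact zero_mem _
    · intro x y _ _ hx hy; rw [add_mul]; exact add_mem hx hy
    · intro c x _ hx; rw [smul_mul_assoc]; exact Submodule.smul_mem _ _ hx

/-- If pfaffians of rows outside `H` reduce, in a quotient, to pfaffians of smaller weight, then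
the quotient is spanned by standard tableaux with rows in `H`. -/
theorem span_std_of_reduction {A : Type*} [CommRing A] [Algebra F A]
    (π : MvPolynomial (Strict n) F →ₐ[F] A) (v : Fin n → ℕ) (hv : ∀ a, 0 < v a)
    {H : Finset (Finset (Fin n))} (hH : IsUpper H)
    (hred : ∀ L : Finset (Fin n), Even L.card → L.Nonempty → L ∉ H → π (pfS (altY n F) L) ∈
      Submodule.span F {x | ∃ M, rwt v M < rwt v L ∧ x = π (pfS (altY n F) M)})
    (p : MvPolynomial (Strict n) F) :
    π p ∈ Submodule.span F {x | ∃ T, IsStd H T ∧ x = π (val (altY n F) T)} := by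
  have key : ∀ w, ∀ p ∈ Hom F v w,
      π p ∈ Submodule.span F {x | ∃ T, IsStd H T ∧ x = π (val (altY n F) T)} := by
    intro w
    induction w using Nat.strong_induction_on with
    | _ w ih =>
    intro p hp
    obtain ⟨s, hs, t, ht, rfl⟩ := Submodule.mem_sup.1 (hom_le v hv w H hH hp)
    rw [map_add]
    refine add_mem ?_ ?_
    · refine Submodule.span_induction ?_ ?_ ?_ ?_ hs
      · rintro _ ⟨T, hT, rfl⟩; exact Submodule.subset_span ⟨T, hT, rfl⟩
      · rw [map_zero]; exact zero_mem _
      · intro x y _ _ hx hy; rw [map_add]; exact add_mem hx hy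
      · intro c x _ hx; rw [map_smul]; exact Submodule.smul_mem _ _ hx
    · refine Submodule.span_induction ?_ ?_ ?_ ?_ ht
      · rintro _ ⟨q, L, u, h1, h2, h3, h4, h5, rfl⟩
        rw [map_mul]
        refine Submodule.span_induction (p := fun x _ => π q * x ∈ _) ?_ ?_ ?_ ?_ (hred L h1 h2 h3)
        · rintro _ ⟨M, hM, rfl⟩
          rw [← map_mul]
          exact ih (u + rwt v M) (by omega) _ (mul_mem_hom h4 (pfS_mem_hom v M) rfl)
        · rw [mul_zero]; exact zero_mem _
        · intro x y _ _ hx hy; rw [mul_add]; exact add_mem hx hy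
        · intro c x _ hx; rw [mul_smul_comm]; exact Submodule.smul_mem _ _ hx
      · rw [map_zero]; exact zero_mem _
      · intro x y _ _ hx hy; rw [map_add]; exact add_mem hx hy
      · intro c x _ hx; rw [map_smul]; exact Submodule.smul_mem _ _ hx
  rw [← MvPolynomial.support_sum_monomial_coeff p, map_sum]
  exact sum_mem fun m _ => key _ _ (MvPolynomial.isWeightedHomogeneous_monomial _ _ _ rfl)

end Spanning

section SubsetSums

variable {α F A : Type*} [DecidableEq α] [Field F] [AddCommGroup A] [Module F A]

theorem sum_superset_mem (M : Submodule F A) (u : Finset α → A) (E : Finset α) (g : ℕ)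
    (hg : ∀ k : ℕ, 0 < k → k ≤ g → (k : F) ≠ 0)
    (hrel : ∀ G ⊆ E, G.card + 1 = g → ∑ j ∈ E \ G, u (insert j G) ∈ M)
    (B : Finset α) (hB : B.card < g) :
    ∑ G ∈ E.powerset with G.card = g ∧ B ⊆ G, u G ∈ M := by
  have h1 : ((g - B.card : ℕ) : F) • ∑ G ∈ E.powerset with G.card = g ∧ B ⊆ G, u G =
      ∑ G ∈ E.powerset with G.card + 1 = g ∧ B ⊆ G, ∑ j ∈ E \ G, u (insert j G) := by
    rw [Nat.cast_smul_eq_nsmul, Finset.smul_sum]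
    have : ∀ G ∈ E.powerset.filter (fun G => G.card = g ∧ B ⊆ G),
        (g - B.card) • u G = ∑ j ∈ G \ B, u G := by
      intro G hG
      obtain ⟨_, h1, h2⟩ := Finset.mem_filter.1 hG
      rw [Finset.sum_const, Finset.card_sdiff_of_subset h2, h1]
    rw [Finset.sum_congr rfl this, Finset.sum_sigma', Finset.sum_sigma']
    refine Finset.sum_bij' (fun x _ => ⟨x.1.erase x.2, x.2⟩) (fun x _ => ⟨insert x.2 x.1, x.2⟩)
      ?_ ?_ ?_ ?_ ?_
    · rintro ⟨G, j⟩ h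
      simp only [Finset.mem_sigma, Finset.mem_filter, Finset.mem_powerset, Finset.mem_sdiff] at h ⊢
      obtain ⟨⟨h1, h2, h3⟩, h4, h5⟩ := h
      refine ⟨⟨(Finset.erase_subset _ _).trans h1, ?_, ?_⟩, h1 h4, Finset.notMem_erase _ _⟩
      · rw [Finset.card_erase_add_one h4, h2]
      · exact fun b hb => Finset.mem_erase.2 ⟨fun e => h5 (e ▸ hb), h3 hb⟩
    · rintro ⟨G, j⟩ h
      simp only [Finset.mem_sigma, Finset.mem_filter, Finset.mem_powerset, Finset.mem_sdiff] at h ⊢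
      obtain ⟨⟨h1, h2, h3⟩, h4, h5⟩ := h
      refine ⟨⟨Finset.insert_subset h4 h1, ?_, h3.trans (Finset.subset_insert _ _)⟩,
        Finset.mem_insert_self _ _, fun h => h5 (h3 h)⟩
      rw [Finset.card_insert_of_notMem h5, h2]
    · rintro ⟨G, j⟩ h
      simp only [Finset.mem_sigma, Finset.mem_sdiff] at h
      simp only [Finset.insert_erase h.2.1]
    · rintro ⟨G, j⟩ h
      simp only [Finset.mem_sigma, Finset.mem_sdiff] at h
      simp only [Finset.erase_insert h.2.2]
    · rintro ⟨G, j⟩ h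
      simp only [Finset.mem_sigma, Finset.mem_sdiff] at h
      simp only [Finset.insert_erase h.2.1]
  have h2 : ∑ G ∈ E.powerset with G.card + 1 = g ∧ B ⊆ G, ∑ j ∈ E \ G, u (insert j G) ∈ M := by
    refine sum_mem fun G hG => ?_
    simp only [Finset.mem_filter, Finset.mem_powerset] at hG
    exact hrel G hG.1 hG.2.1
  rw [← h1] at h2
  exact (Submodule.smul_mem_iff _ (hg _ (by omega) (by omega))).1 h2

theorem mem_of_subset_relations (M : Submodule F A) (u : Finset α → A) (E : Finset α) (g : ℕ)
    (hg : ∀ k : ℕ, 0 < k → k ≤ g → (k : F) ≠ 0)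
    (hrel : ∀ G ⊆ E, G.card + 1 = g → ∑ j ∈ E \ G, u (insert j G) ∈ M)
    (hE : E.card < 2 * g) {G : Finset α} (hG : G ⊆ E) (hGc : G.card = g) : u G ∈ M := by
  have key : ∀ D B : Finset α, B.card + D.card < g →
      ∑ G ∈ E.powerset with G.card = g ∧ B ⊆ G ∧ Disjoint G D, u G ∈ M := by
    intro D
    induction D using Finset.induction_on with
    | empty =>
      intro B hB
      simpa using sum_superset_mem M u E g hg hrel B (by simpa using hB)
    | insert x D hx ih =>
      intro B hB
      rw [Finset.card_insert_of_notMem hx] at hB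
      have h1 := ih B (by omega)
      have h2 := ih (insert x B) (by have := Finset.card_insert_le x B; omega)
      have h3 : ∑ G ∈ E.powerset with G.card = g ∧ B ⊆ G ∧ Disjoint G D, u G =
          ∑ G ∈ E.powerset with G.card = g ∧ insert x B ⊆ G ∧ Disjoint G D, u G +
          ∑ G ∈ E.powerset with G.card = g ∧ B ⊆ G ∧ Disjoint G (insert x D), u G := by
        rw [← Finset.sum_filter_add_sum_filter_not _ (fun G => x ∈ G), Finset.filter_filter,
          Finset.filter_filter]
        congr 2
        · ext G; simp only [Finset.mem_filter, Finset.insert_subset_iff]; tauto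
        · ext G; simp only [Finset.mem_filter, Finset.disjoint_insert_right]; tauto
      rw [h3] at h1
      exact (Submodule.add_mem_iff_right _ h2).1 h1
  have h := key (E \ G) ∅ (by
    rw [Finset.card_sdiff_of_subset hG, Finset.card_empty]; omega)
  rwa [Finset.sum_eq_single G] at h
  · intro B hB hne
    simp only [Finset.mem_filter, Finset.mem_powerset] at hB
    refine absurd (Finset.eq_of_subset_of_card_le ?_ (by omega)) hne
    intro b hb
    by_contra hbG
    exact Finset.disjoint_left.1 hB.2.2.2 hb (Finset.mem_sdiff.2 ⟨hB.1 hb, hbG⟩)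
  · intro hn
    exact absurd (Finset.mem_filter.2 ⟨Finset.mem_powerset.2 hG, hGc, Finset.empty_subset _,
      Finset.disjoint_sdiff⟩) hn

end SubsetSums

section Symplectic

/-- The barred position of a level. -/
def lo {r : ℕ} (j : Fin r) : Fin (2 * r) := ⟨2 * j, by omega⟩

/-- The unbarred position of a level. -/
def hi {r : ℕ} (j : Fin r) : Fin (2 * r) := ⟨2 * j + 1, by omega⟩

/-- The level of a position. -/
def lev {r : ℕ} (a : Fin (2 * r)) : Fin r := ⟨a / 2, by omega⟩

theorem lev_lo {r : ℕ} (j : Fin r) : lev (lo j) = j := by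
  ext; simp [lev, lo]

theorem lev_hi {r : ℕ} (j : Fin r) : lev (hi j) = j := by
  ext; simp only [lev, hi]; omega

theorem eq_lo_or_hi {r : ℕ} (a : Fin (2 * r)) : a = lo (lev a) ∨ a = hi (lev a) := by
  simp only [Fin.ext_iff, lo, hi, lev]; omega

theorem lo_ne_hi {r : ℕ} (i j : Fin r) : lo i ≠ hi j := by
  simp only [ne_eq, Fin.ext_iff, lo, hi]; omega

variable {r : ℕ} {R : Type*} [CommRing R]

/-- The defining equations of `V`, with indices replaced by positions. -/
structure IsNilSymp (Y : Fin (2 * r) → Fin (2 * r) → R) : Prop extends IsAltM Y where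
  symp : ∀ b c, ∑ j : Fin r, (Y (lo j) b * Y (hi j) c - Y (hi j) b * Y (lo j) c) = 0
  trace : ∑ j : Fin r, Y (lo j) (hi j) = 0

theorem ι_eq_sum {n : ℕ} (v : Fin n → R) : ExteriorAlgebra.ι R v = ∑ b, v b • gen n R b := by
  conv_lhs => rw [pi_eq_sum_univ' v]
  simp only [map_sum, map_smul, gen]

theorem IsNilSymp.sum_lin_eq_zero {Y : Fin (2 * r) → Fin (2 * r) → R} (hY : IsNilSymp Y)
    (h2 : IsUnit (2 : R)) : ∑ j : Fin r, lin Y (lo j) * lin Y (hi j) = 0 := by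
  set S := ∑ j : Fin r, lin Y (lo j) * lin Y (hi j) with hS
  have hexp : S = ∑ b, ∑ c, (∑ j : Fin r, Y (lo j) b * Y (hi j) c) • (gen _ R b * gen _ R c) := by
    rw [hS]
    simp only [lin, ι_eq_sum, Finset.sum_mul_sum, Finset.sum_smul, smul_mul_smul_comm]
    rw [Finset.sum_comm]
    exact Finset.sum_congr rfl fun b _ => Finset.sum_comm
  have hneg : S = -S := by
    calc S = ∑ b, ∑ c, (∑ j : Fin r, Y (lo j) b * Y (hi j) c) • (gen _ R b * gen _ R c) := hexp
      _ = ∑ c, ∑ b, (∑ j : Fin r, Y (lo j) b * Y (hi j) c) • (gen _ R b * gen _ R c) :=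
        Finset.sum_comm
      _ = ∑ b, ∑ c, -((∑ j : Fin r, Y (lo j) b * Y (hi j) c) • (gen _ R b * gen _ R c)) := by
        refine Finset.sum_congr rfl fun b _ => Finset.sum_congr rfl fun c _ => ?_
        rw [gen, gen, ι_anticomm, smul_neg]
        congr 2
        have := hY.symp c b
        rw [Finset.sum_sub_distrib, sub_eq_zero] at this
        rw [this]
        exact Finset.sum_congr rfl fun j _ => mul_comm _ _
      _ = -S := by rw [hexp]; simp only [Finset.sum_neg_distrib]
  obtain ⟨t, ht⟩ := h2
  have h0 : (2 : R) • S = 0 := by rw [two_smul]; nth_rewrite 1 [hneg]; simp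
  rw [← ht] at h0
  exact (smul_eq_zero_iff_eq t).1 (by simpa [Units.smul_def] using h0)

theorem IsNilSymp.sum_gpf_eq_zero {Y : Fin (2 * r) → Fin (2 * r) → R} (hY : IsNilSymp Y)
    (h2 : IsUnit (2 : R)) (l : List (Fin (2 * r))) :
    ∑ j : Fin r, gpf Y (lo j :: hi j :: l) = 0 := by
  obtain ⟨G, hG⟩ := hY.exists_isGauss
  have h : ∑ j : Fin r, del R (hi j) (del R (lo j) G) = 0 := by
    have : ∀ j : Fin r, del R (hi j) (del R (lo j) G) =
        Y (lo j) (hi j) • G - lin Y (lo j) * lin Y (hi j) * G := by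
      intro j
      rw [hG.del_eq, lin, del_ι_mul, hG.del_eq, mul_assoc]
    simp only [this]
    rw [Finset.sum_sub_distrib, ← Finset.sum_smul, hY.trace, zero_smul, ← Finset.sum_mul,
      hY.sum_lin_eq_zero h2, zero_mul, sub_zero]
  have := congrArg (fun x => aug _ R (delL R l x)) h
  simp only [map_sum, map_zero] at this
  rw [← this]
  exact Finset.sum_congr rfl fun j _ => by rw [← hG.aug_delL, delL_cons, delL_cons]

/-- The concatenation of the pairs of positions of a list of levels. -/
def flat (l : List (Fin r)) : List (Fin (2 * r)) := l.flatMap fun j => [lo j, hi j]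

theorem flat_cons (j : Fin r) (l : List (Fin r)) : flat (j :: l) = lo j :: hi j :: flat l := by
  simp [flat]

theorem mem_flat {l : List (Fin r)} {a : Fin (2 * r)} : a ∈ flat l ↔ lev a ∈ l := by
  simp only [flat, List.mem_flatMap, List.mem_cons, List.not_mem_nil, or_false]
  constructor
  · rintro ⟨j, hj, rfl | rfl⟩
    · rwa [lev_lo]
    · rwa [lev_hi]
  · exact fun h => ⟨_, h, eq_lo_or_hi a⟩

theorem nodup_flat {l : List (Fin r)} (h : l.Nodup) : (flat l).Nodup := by
  induction l with
  | nil => simp [flat]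
  | cons j l ih =>
    rw [List.nodup_cons] at h
    rw [flat_cons, List.nodup_cons, List.nodup_cons, List.mem_cons, mem_flat, mem_flat, lev_lo,
      lev_hi]
    exact ⟨fun e => e.elim (lo_ne_hi _ _) h.1, h.1, ih h.2⟩

theorem delL_flat_perm {l m : List (Fin r)} (h : l.Perm m)
    (u : ExteriorAlgebra R (Fin (2 * r) → R)) : delL R (flat l) u = delL R (flat m) u := by
  induction h generalizing u with
  | nil => rfl
  | cons a _ ih => simp only [flat_cons, delL_cons, ih]
  | swap a b l =>
    simp only [flat_cons, delL_cons]
    rw [del_comm (lo a) (hi b), map_neg, del_comm (hi a) (hi b), del_comm (lo a) (lo b), map_neg,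
      map_neg, map_neg, del_comm (hi a) (lo b)]
    simp only [neg_neg]
  | trans _ _ ih1 ih2 => rw [ih1, ih2]

theorem IsAltM.gpf_flat_perm {Y : Fin (2 * r) → Fin (2 * r) → R} (hY : IsAltM Y)
    {l m : List (Fin r)} (h : l.Perm m) (s : List (Fin (2 * r))) :
    gpf Y (flat l ++ s) = gpf Y (flat m ++ s) := by
  obtain ⟨G, hG⟩ := hY.exists_isGauss
  rw [← hG.aug_delL, ← hG.aug_delL, delL_append, delL_append, delL_flat_perm h]

theorem IsNilSymp.sum_insert_eq_zero {Y : Fin (2 * r) → Fin (2 * r) → R} (hY : IsNilSymp Y)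
    (h2 : IsUnit (2 : R)) (Γ : Finset (Fin r)) (s : List (Fin (2 * r))) (E : Finset (Fin r))
    (hE : ∀ j ∉ E, lo j ∈ s ∨ hi j ∈ s) :
    ∑ j ∈ E \ Γ, gpf Y (flat (insert j Γ).sort ++ s) = 0 := by
  rw [← hY.sum_gpf_eq_zero h2 (flat Γ.sort ++ s)]
  refine (Finset.sum_congr rfl fun j hj => ?_).trans
    (Finset.sum_subset (Finset.subset_univ (E \ Γ)) fun j _ hj => ?_)
  · rw [← List.cons_append, ← List.cons_append, ← flat_cons]
    refine hY.gpf_flat_perm ?_ _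
    rw [List.perm_ext_iff_of_nodup (Finset.sort_nodup _ _) (List.nodup_cons.2
      ⟨fun h => (Finset.mem_sdiff.1 hj).2 ((Finset.mem_sort _).1 h), Finset.sort_nodup _ _⟩)]
    simp
  · refine hY.gpf_of_not_nodup fun hnd => ?_
    rw [Finset.mem_sdiff, not_and_or, not_not] at hj
    simp only [List.nodup_cons, List.mem_cons, List.mem_append, mem_flat, lev_lo, lev_hi,
      Finset.mem_sort] at hnd
    rcases hj with h | h
    · rcases hE j h with h | h <;> tauto
    · tauto

end Symplectic

section Reduction

variable {r : ℕ}

/-- The weight of a level. -/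
def lwt {r : ℕ} (j : Fin r) : ℕ := 2 ^ r - 2 ^ (j : ℕ)

theorem lwt_pos (j : Fin r) : 0 < lwt j :=
  Nat.sub_pos_of_lt (Nat.pow_lt_pow_right (by norm_num) j.2)

theorem sum_lwt (S : Finset (Fin r)) :
    ∑ j ∈ S, lwt j + ∑ j ∈ S, 2 ^ (j : ℕ) = S.card * 2 ^ r := by
  rw [← Finset.sum_add_distrib, Finset.card_eq_sum_ones, Finset.sum_mul]
  refine Finset.sum_congr rfl fun j _ => ?_
  rw [lwt, Nat.sub_add_cancel (Nat.pow_le_pow_right (by norm_num) j.2.le), one_mul]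

theorem sum_map_flat (w : Fin r → ℕ) (l : List (Fin r)) :
    ((flat l).map fun a => w (lev a)).sum = 2 * (l.map w).sum := by
  induction l with
  | nil => simp [flat]
  | cons j l ih => simp only [flat_cons, List.map_cons, List.sum_cons, ih, lev_lo, lev_hi]; ring

theorem rwt_toFinset_flat_append (w : Fin r → ℕ) (Γ : Finset (Fin r)) (s : List (Fin (2 * r)))
    (h : (flat Γ.sort ++ s).Nodup) :
    rwt (fun a => w (lev a)) (flat Γ.sort ++ s).toFinset =
      2 * ∑ j ∈ Γ, w j + (s.map fun a => w (lev a)).sum := by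
  rw [rwt, List.sum_toFinset _ h, List.map_append, List.sum_append, sum_map_flat,
    ← List.sum_toFinset _ (Finset.sort_nodup _ _), Finset.sort_toFinset]

theorem card_fiber_lev (L : Finset (Fin (2 * r))) (j : Fin r) :
    (L.filter fun x => lev x = j).card =
      (if lo j ∈ L then 1 else 0) + (if hi j ∈ L then 1 else 0) := by
  have : (L.filter fun x => lev x = j) = ({lo j, hi j} : Finset _).filter (· ∈ L) := by
    ext x
    simp only [Finset.mem_filter, Finset.mem_insert, Finset.mem_singleton]
    constructor
    · rintro ⟨h, rfl⟩; exact ⟨eq_lo_or_hi x, h⟩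
    · rintro ⟨rfl | rfl, h⟩
      · exact ⟨h, lev_lo j⟩
      · exact ⟨h, lev_hi j⟩
  rw [this, Finset.card_filter, Finset.sum_pair (lo_ne_hi j j)]

theorem cnt_add_card_le (L : Finset (Fin (2 * r))) (a : Fin (2 * r)) :
    cnt L a + (Finset.univ.filter fun j : Fin r => (lo j ∈ L ↔ hi j ∈ L) ∧ j ≤ lev a).card ≤
      a / 2 + 1 +
        2 * (Finset.univ.filter fun j : Fin r => (lo j ∈ L ∧ hi j ∈ L) ∧ j ≤ lev a).card := by
  have h1 : cnt L a ≤ ∑ j ∈ Finset.Iic (lev a), (L.filter fun x => lev x = j).card := by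
    rw [cnt, Finset.card_eq_sum_card_fiberwise (f := lev) (t := Finset.Iic (lev a))]
    · exact Finset.sum_le_sum fun j _ => Finset.card_le_card
        (Finset.filter_subset_filter _ (Finset.filter_subset _ _))
    · intro x hx
      have := (Finset.mem_filter.1 (Finset.mem_coe.1 hx)).2
      simp only [Finset.coe_Iic, Set.mem_Iic, Fin.le_def, lev] at this ⊢
      omega
  have h2 : ∀ P : Fin r → Prop, ∀ [DecidablePred P],
      (Finset.univ.filter fun j : Fin r => P j ∧ j ≤ lev a).card =
      ∑ j ∈ Finset.Iic (lev a), if P j then 1 else 0 := by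
    intro P _
    rw [← Finset.card_filter]
    congr 1
    ext j; simp [and_comm]
  have h3 : (a : ℕ) / 2 + 1 = ∑ j ∈ Finset.Iic (lev a), 1 := by
    simp [lev]
  rw [h2, h2, h3, Finset.mul_sum, ← Finset.sum_add_distrib]
  refine (Nat.add_le_add_right h1 _).trans ?_
  rw [← Finset.sum_add_distrib]
  refine Finset.sum_le_sum fun j _ => ?_
  rw [card_fiber_lev]
  by_cases h : lo j ∈ L <;> by_cases h' : hi j ∈ L <;> simp [h, h']

variable {F A : Type*} [Field F] [CommRing A] [Algebra F A]

theorem units_smul_mem (M : Submodule F A) (ε : ℤˣ) {x : A} (hx : x ∈ M) : ε • x ∈ M := by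
  rcases Int.units_eq_one_or ε with rfl | rfl
  · simpa using hx
  · simpa [Units.smul_def] using hx

theorem IsAltM.gpf_flat_mem {Y : Fin (2 * r) → Fin (2 * r) → A} (hY : IsAltM Y)
    (w : Fin r → ℕ) (Γ : Finset (Fin r)) (s : List (Fin (2 * r))) (b : ℕ)
    (h : 2 * ∑ j ∈ Γ, w j + (s.map fun a => w (lev a)).sum < b) :
    gpf Y (flat Γ.sort ++ s) ∈
      Submodule.span F {x | ∃ M, rwt (fun a => w (lev a)) M < b ∧ x = pfS Y M} := by
  by_cases hn : (flat Γ.sort ++ s).Nodup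
  · obtain ⟨ε, hε⟩ := hY.gpf_eq_pfS hn
    rw [hε]
    refine units_smul_mem _ _ (Submodule.subset_span ⟨_, ?_, rfl⟩)
    rwa [rwt_toFinset_flat_append w Γ s hn]
  · rw [hY.gpf_of_not_nodup hn]; exact zero_mem _

theorem IsNilSymp.pfS_mem {Y : Fin (2 * r) → Fin (2 * r) → A} (hY : IsNilSymp Y)
    (h2 : IsUnit (2 : A)) (hF : ∀ k : ℕ, 0 < k → k ≤ r → (k : F) ≠ 0)
    (L : Finset (Fin (2 * r))) (a : Fin (2 * r)) (ha : (a : ℕ) / 2 + 1 < cnt L a) :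
    pfS Y L ∈ Submodule.span F
      {x | ∃ M, rwt (fun a => lwt (lev a)) M < rwt (fun a => lwt (lev a)) L ∧ x = pfS Y M} := by
  set K := Submodule.span F
      {x | ∃ M, rwt (fun a => lwt (lev a)) M < rwt (fun a => lwt (lev a)) L ∧ x = pfS Y M} with hK
  have hcount := cnt_add_card_le L a
  set E1 := Finset.univ.filter fun j : Fin r => (lo j ∈ L ↔ hi j ∈ L) ∧ j ≤ lev a with hE1
  set G := Finset.univ.filter fun j : Fin r => (lo j ∈ L ∧ hi j ∈ L) ∧ j ≤ lev a with hG
  set Γ2 := Finset.univ.filter fun j : Fin r => (lo j ∈ L ∧ hi j ∈ L) ∧ ¬ j ≤ lev a with hΓ2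
  set E := Finset.univ.filter fun j : Fin r => (lo j ∈ L ↔ hi j ∈ L) with hE
  set s := (L.filter fun x => ¬ (lo (lev x) ∈ L ∧ hi (lev x) ∈ L)).sort with hs
  have hmemL : ∀ x, x ∈ flat (G ∪ Γ2).sort ++ s ↔ x ∈ L := by
    intro x
    simp only [List.mem_append, mem_flat, Finset.mem_sort, hs, Finset.mem_filter, hG, hΓ2,
      Finset.mem_union, Finset.mem_univ, true_and]
    have : (lo (lev x) ∈ L ∧ hi (lev x) ∈ L) → x ∈ L := by
      rcases eq_lo_or_hi x with h | h <;> rw [h] <;> simp only [lev_lo, lev_hi] <;> tauto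
    tauto
  have hnd : (flat (G ∪ Γ2).sort ++ s).Nodup := by
    refine List.Nodup.append (nodup_flat (Finset.sort_nodup _ _)) (Finset.sort_nodup _ _) ?_
    intro x hx hx'
    simp only [mem_flat, Finset.mem_sort, hs, Finset.mem_filter, hG, hΓ2,
      Finset.mem_union, Finset.mem_univ, true_and] at hx hx'
    tauto
  have hLs : (flat (G ∪ Γ2).sort ++ s).toFinset = L := by
    ext x; rw [List.mem_toFinset, hmemL]
  have hw := rwt_toFinset_flat_append lwt _ s hnd
  rw [hLs] at hw
  have hd : Disjoint G Γ2 := by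
    rw [Finset.disjoint_left]; intro j; simp only [hG, hΓ2, Finset.mem_filter]; tauto
  have hu : gpf Y (flat (G ∪ Γ2).sort ++ s) ∈ K := by
    refine mem_of_subset_relations K (fun G' => gpf Y (flat (G' ∪ Γ2).sort ++ s)) E1 G.card
      (fun k h h' => hF k h (h'.trans ?_)) (fun G' hG' hc => ?_) (by omega) ?_ rfl
    · simpa using Finset.card_le_univ G
    · have hrel := hY.sum_insert_eq_zero h2 (G' ∪ Γ2) s E (by
        intro j hj
        simp only [hE, Finset.mem_filter, Finset.mem_univ, true_and] at hj
        simp only [hs, Finset.mem_sort, Finset.mem_filter, lev_lo, lev_hi]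
        tauto)
      have hle : ∀ j ∈ G', j ≤ lev a := fun j hj => (Finset.mem_filter.1 (hG' hj)).2.2
      have hd' : Disjoint G' Γ2 := by
        rw [Finset.disjoint_left]; intro j h1 h2
        exact (Finset.mem_filter.1 h2).2.2 (hle j h1)
      rw [← Finset.sum_filter_add_sum_filter_not _ (fun j => j ≤ lev a)] at hrel
      have hset : ((E \ (G' ∪ Γ2)).filter fun j => j ≤ lev a) = E1 \ G' := by
        ext j
        simp only [hE, hE1, hΓ2, Finset.mem_filter, Finset.mem_sdiff, Finset.mem_union,
          Finset.mem_univ, true_and]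
        tauto
      rw [hset] at hrel
      simp only [Finset.insert_union]
      rw [eq_neg_of_add_eq_zero_left hrel]
      refine neg_mem (sum_mem fun j hj => ?_)
      rw [Finset.mem_filter, Finset.mem_sdiff] at hj
      refine hY.gpf_flat_mem lwt _ s _ ?_
      rw [hw]
      have hc1 := sum_lwt (insert j (G' ∪ Γ2))
      have hc2 := sum_lwt (G ∪ Γ2)
      rw [Finset.card_insert_of_notMem hj.1.2, Finset.card_union_of_disjoint hd',
        Finset.sum_insert (f := fun j : Fin r => 2 ^ (j : ℕ)) hj.1.2,
        Finset.sum_union (f := fun j : Fin r => 2 ^ (j : ℕ)) hd'] at hc1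
      rw [Finset.card_union_of_disjoint hd,
        Finset.sum_union (f := fun j : Fin r => 2 ^ (j : ℕ)) hd, ← hc] at hc2
      have hg : ∑ j ∈ G, 2 ^ (j : ℕ) < 2 ^ (j : ℕ) := by
        have := Nat.geomSum_lt (m := 2) (n := j) (s := G.map Fin.valEmbedding) le_rfl (by
          intro k hk
          obtain ⟨i, hi, rfl⟩ := Finset.mem_map.1 hk
          exact lt_of_le_of_lt (Fin.le_def.1 (Finset.mem_filter.1 hi).2.2)
            (Fin.lt_def.1 (not_le.1 hj.2)))
        simpa using this
      have : G'.card + Γ2.card + 1 = G'.card + 1 + Γ2.card := by ring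
      rw [this] at hc1
      omega
    · intro j
      simp only [hG, hE1, Finset.mem_filter]
      tauto
  obtain ⟨ε, hε⟩ := hY.gpf_eq_pfS hnd
  rw [hLs] at hε
  have : pfS Y L = ε⁻¹ • gpf Y (flat (G ∪ Γ2).sort ++ s) := by rw [hε, inv_smul_smul]
  rw [this]
  exact units_smul_mem _ _ hu

/-- The rows of even positive size with at most `a / 2 + 1` entries that are `≤ a`. -/
def sympRows (r : ℕ) : Finset (Finset (Fin (2 * r))) :=
  Finset.univ.filter fun N => Even N.card ∧ N.Nonempty ∧ ∀ a, cnt N a ≤ (a : ℕ) / 2 + 1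

theorem isUpper_sympRows (r : ℕ) : IsUpper (sympRows r) := by
  refine ⟨fun N h => (Finset.mem_filter.1 h).2.1, fun N h => (Finset.mem_filter.1 h).2.2.1,
    fun N h M h1 h2 h3 => Finset.mem_filter.2 ⟨Finset.mem_univ _, h1, h2, fun a => ?_⟩⟩
  exact (h3 a).trans ((Finset.mem_filter.1 h).2.2.2 a)

theorem IsNilSymp.span_std {Y : Fin (2 * r) → Fin (2 * r) → A} (hY : IsNilSymp Y)
    (h2 : IsUnit (2 : A)) (hF : ∀ k : ℕ, 0 < k → k ≤ r → (k : F) ≠ 0)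
    (π : MvPolynomial (Strict (2 * r)) F →ₐ[F] A) (hπ : ∀ a b, π (altY _ F a b) = Y a b)
    (p : MvPolynomial (Strict (2 * r)) F) :
    π p ∈ Submodule.span F {x | ∃ T, IsStd (sympRows r) T ∧ x = val Y T} := by
  have hY' : (fun a b => π (altY _ F a b)) = Y := by ext a b; exact hπ a b
  have hpf : ∀ N, π (pfS (altY _ F) N) = pfS Y N := fun N => by
    rw [← hY']; exact pfS_map π.toRingHom _ _
  have hval : ∀ T, π (val (altY _ F) T) = val Y T := fun T => by
    rw [← hY']; exact val_map π.toRingHom _ _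
  have := span_std_of_reduction π (fun a => lwt (lev a)) (fun a => lwt_pos _)
    (isUpper_sympRows r) (fun L h1 h2' h3 => ?_) p
  · simpa only [hval] using this
  · simp only [hpf]
    have : ∃ a : Fin (2 * r), (a : ℕ) / 2 + 1 < cnt L a := by
      by_contra h; push Not at h
      exact h3 (Finset.mem_filter.2 ⟨Finset.mem_univ _, h1, h2', h⟩)
    obtain ⟨a, ha⟩ := this
    exact hY.pfS_mem h2 hF L a ha

end Reduction

section Variety

variable {r : ℕ} {R : Type*} [CommRing R]

theorem sum_univ_emb {M : Type*} [AddCommMonoid M] (f : Fin (2 * r) → M) :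
    ∑ i, f i = ∑ j, f (emb r j) + ∑ j, f (embBar r j) := by
  have h : r + r = 2 * r := (two_mul r).symm
  rw [← (finCongr h).sum_comp f, Fin.sum_univ_add]
  rfl

theorem Jmat_mul_emb {α : Type*} (Q : Matrix (Fin (2 * r)) α R) (j : Fin r) (c : α) :
    (Jmat r R * Q) (emb r j) c = Q (embBar r j) c := by
  rw [Matrix.mul_apply, Finset.sum_eq_single (embBar r j)]
  · simp [Jmat, emb, embBar, add_comm]
  · intro i _ hi
    rw [Jmat, Matrix.of_apply, if_neg, if_neg, zero_mul]
    · simp only [emb]; omega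
    · simp only [emb, embBar, ne_eq, Fin.ext_iff] at hi ⊢; omega
  · simp

theorem Jmat_mul_embBar {α : Type*} (Q : Matrix (Fin (2 * r)) α R) (j : Fin r) (c : α) :
    (Jmat r R * Q) (embBar r j) c = -Q (emb r j) c := by
  rw [Matrix.mul_apply, Finset.sum_eq_single (emb r j)]
  · have := j.2
    rw [Jmat, Matrix.of_apply, if_neg, if_pos, neg_one_mul]
    · simp only [emb, embBar]; omega
    · simp only [emb, embBar]; omega
  · intro i _ hi
    rw [Jmat, Matrix.of_apply, if_neg, if_neg, zero_mul]
    · simp only [emb, embBar, ne_eq, Fin.ext_iff] at hi ⊢; omega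
    · simp only [embBar]; omega
  · simp

theorem mul_Jmat_mul_apply {α β : Type*} (P : Matrix α (Fin (2 * r)) R)
    (Q : Matrix (Fin (2 * r)) β R) (b : α) (c : β) :
    (P * Jmat r R * Q) b c =
      ∑ j : Fin r, (P b (emb r j) * Q (embBar r j) c - P b (embBar r j) * Q (emb r j) c) := by
  rw [Matrix.mul_assoc, Matrix.mul_apply, sum_univ_emb, Finset.sum_sub_distrib, sub_eq_add_neg,
    ← Finset.sum_neg_distrib]
  simp only [Jmat_mul_emb, Jmat_mul_embBar, mul_neg]

/-- The index at a given position. -/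
def posIdx {r : ℕ} (a : Fin (2 * r)) : Fin (2 * r) :=
  if (a : ℕ) % 2 = 0 then embBar r (lev a) else emb r (lev a)

theorem posIdx_lo (j : Fin r) : posIdx (lo j) = embBar r j := by
  rw [posIdx, if_pos (by simp [lo]), lev_lo]

theorem posIdx_hi (j : Fin r) : posIdx (hi j) = emb r j := by
  rw [posIdx, if_neg (by simp [hi]), lev_hi]

theorem posIdx_injective : Function.Injective (posIdx (r := r)) := by
  intro a b h
  have hr := (lev a).2
  have hr' := (lev b).2
  simp only [posIdx, emb, embBar, Fin.ext_iff] at h ⊢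
  split_ifs at h <;> simp only [lev] at h hr hr' <;> omega

theorem posIdx_surjective : Function.Surjective (posIdx (r := r)) :=
  Finite.surjective_of_injective posIdx_injective

theorem MemV.isNilSymp [Nontrivial R] (hr : 0 < r) (h2 : IsUnit (2 : R))
    {y : Matrix (Fin (2 * r)) (Fin (2 * r)) R} (h : MemV r y) :
    IsNilSymp fun a b => y (posIdx a) (posIdx b) where
  diag a := h.2.1 _
  swap a b := congrFun (congrFun h.1 (posIdx b)) (posIdx a)
  symp b c := by
    have := congrFun (congrFun h.2.2.1 (posIdx b)) (posIdx c)
    rw [mul_Jmat_mul_apply, Matrix.zero_apply] at this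
    simp only [posIdx_lo, posIdx_hi]
    rw [← neg_eq_zero, ← this, ← Finset.sum_neg_distrib]
    simp
  trace := by
    simp only [posIdx_lo, posIdx_hi]
    have hne : Nonempty (Fin (2 * r)) := ⟨⟨0, by omega⟩⟩
    have ht : Matrix.trace (Jmat r R * y) = 0 := by
      rw [← neg_eq_zero, ← Matrix.trace_neg, Matrix.trace_eq_neg_charpoly_coeff, h.2.2.2,
        Polynomial.coeff_X_pow, if_neg, neg_zero]
      rw [Fintype.card_fin]; omega
    rw [Matrix.trace, sum_univ_emb] at ht
    simp only [Matrix.diag_apply, Jmat_mul_emb, Jmat_mul_embBar] at ht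
    have hs : ∀ j, y (emb r j) (embBar r j) = -y (embBar r j) (emb r j) := fun j =>
      congrFun (congrFun h.1 (emb r j)) (embBar r j)
    simp only [hs, neg_neg] at ht
    rw [← two_mul] at ht
    exact (h2.mul_right_eq_zero).1 ht

variable {F : Type*} [Field F]

theorem VIdeal_le_ker {φ : PolyRing r F →+* R} {y : Matrix (Fin (2 * r)) (Fin (2 * r)) R}
    (hφ : (Ygen r F).map φ = y)
    (h : MemV r y) :
    VIdeal r F ≤ RingHom.ker φ := by
  obtain ⟨h1, hd, hJ, hc⟩ := h
  rw [← add_eq_zero_iff_eq_neg] at h1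
  have hJm : (Jmat r (PolyRing r F)).map φ = Jmat r R := by
    ext i j; simp only [Jmat, Matrix.map_apply, Matrix.of_apply]; split_ifs <;> simp
  rw [VIdeal, Ideal.span_le]
  rintro p (((⟨i, j, rfl⟩ | ⟨i, rfl⟩) | ⟨i, j, rfl⟩) | ⟨k, rfl⟩)
  · have := congrFun (congrFun h1 i) j
    rw [← hφ] at this
    simpa [RingHom.mem_ker] using this
  · have := hd i
    rw [← hφ] at this
    simpa [RingHom.mem_ker] using this
  · have : ((Ygen r F)ᵀ * Jmat r (PolyRing r F) * Ygen r F).map φ = 0 := by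
      rw [Matrix.map_mul, Matrix.map_mul, hJm, Matrix.transpose_map, hφ, hJ]
    exact congrFun (congrFun this i) j
  · have h : (-(Jmat r (PolyRing r F) * Ygen r F)).map φ = -(Jmat r R * y) := by
      rw [← hφ, ← hJm, ← Matrix.map_mul]; ext i j; exact map_neg φ _
    rw [SetLike.mem_coe, RingHom.mem_ker, ← Polynomial.coeff_map, Polynomial.map_sub,
      ← Matrix.charpoly_map, h, hc]
    simp

theorem isNilSymp_FV [Nontrivial (FV r F)] (hr : 0 < r) (h2 : (2 : F) ≠ 0) :
    IsNilSymp fun a b : Fin (2 * r) =>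
      Ideal.Quotient.mk (VIdeal r F) (Ygen r F (posIdx a) (posIdx b)) := by
  have hmem : ∀ p, p ∈ _ → Ideal.Quotient.mk (VIdeal r F) p = 0 := fun p hp =>
    Ideal.Quotient.eq_zero_iff_mem.2 (Ideal.subset_span hp)
  have hJm : (Jmat r (PolyRing r F)).map (Ideal.Quotient.mk (VIdeal r F)) = Jmat r (FV r F) := by
    ext i j; simp only [Jmat, Matrix.map_apply, Matrix.of_apply]; split_ifs <;> simp
  refine MemV.isNilSymp (y := (Ygen r F).map (Ideal.Quotient.mk (VIdeal r F))) hr ?_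
    ⟨add_eq_zero_iff_eq_neg.1 ?_, ?_, ?_, ?_⟩
  · have : IsUnit (algebraMap F (FV r F) 2) := (Ne.isUnit h2).map _
    rwa [map_ofNat] at this
  · ext i j
    have := hmem _ (Or.inl (Or.inl (Or.inl ⟨i, j, rfl⟩)))
    simpa using this
  · intro i
    exact hmem _ (Or.inl (Or.inl (Or.inr ⟨i, rfl⟩)))
  · rw [← hJm, ← Matrix.transpose_map, ← Matrix.map_mul, ← Matrix.map_mul]
    ext i j
    exact hmem _ (Or.inl (Or.inr ⟨i, j, rfl⟩))
  · rw [← hJm, ← Matrix.map_mul]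
    have h : (-((Jmat r (PolyRing r F) * Ygen r F).map (Ideal.Quotient.mk (VIdeal r F)))) =
      (-(Jmat r (PolyRing r F) * Ygen r F)).map (Ideal.Quotient.mk (VIdeal r F)) := by
      ext i j; exact (map_neg (Ideal.Quotient.mk (VIdeal r F)) _).symm
    rw [h, Matrix.charpoly_map]
    ext k
    have := hmem _ (Or.inr ⟨k, rfl⟩)
    rw [Polynomial.coeff_sub, map_sub, sub_eq_zero] at this
    rw [Polynomial.coeff_map, this, ← Polynomial.coeff_map, Polynomial.map_pow, Polynomial.map_X]

/-- The class in `F[V]` of the entry of `Y` at given positions. -/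
def posY (r : ℕ) (F : Type*) [Field F] (a b : Fin (2 * r)) : FV r F :=
  Ideal.Quotient.mk (VIdeal r F) (Ygen r F (posIdx a) (posIdx b))

theorem span_std_FV [Nontrivial (FV r F)] (hr : 0 < r)
    (hF : ∀ k : ℕ, 0 < k → k ≤ r → (k : F) ≠ 0) (h2 : (2 : F) ≠ 0) (x : FV r F) :
    x ∈ Submodule.span F {x | ∃ T, IsStd (sympRows r) T ∧ x = val (posY r F) T} := by
  have hY : IsNilSymp (posY r F) := isNilSymp_FV hr h2
  set π : MvPolynomial (Strict (2 * r)) F →ₐ[F] FV r F :=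
    MvPolynomial.aeval fun p => posY r F p.1.1 p.1.2 with hπ
  have hπY : ∀ a b, π (altY _ F a b) = posY r F a b := by
    intro a b
    rw [altY]
    split_ifs with h1 h3
    · rw [hπ, MvPolynomial.aeval_X]
    · rw [map_neg, hπ, MvPolynomial.aeval_X, hY.swap, neg_neg]
    · have : a = b := le_antisymm (not_lt.1 h3) (not_lt.1 h1)
      rw [map_zero, this, hY.diag]
  have h2' : IsUnit (2 : FV r F) := by
    have : IsUnit (algebraMap F (FV r F) 2) := (Ne.isUnit h2).map _
    rwa [map_ofNat] at this
  have hsurj : ∀ q : PolyRing r F, ∃ p, π p = Ideal.Quotient.mk (VIdeal r F) q := by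
    intro q
    change Ideal.Quotient.mkₐ F (VIdeal r F) q ∈ π.range
    have : (Ideal.Quotient.mkₐ F (VIdeal r F)) q ∈ (⊤ : Subalgebra F _).map
        (Ideal.Quotient.mkₐ F (VIdeal r F)) := ⟨q, trivial, rfl⟩
    refine (?_ : _ ≤ π.range) this
    rw [← MvPolynomial.adjoin_range_X, AlgHom.map_adjoin, Algebra.adjoin_le_iff]
    rintro _ ⟨_, ⟨⟨i, j⟩, rfl⟩, rfl⟩
    obtain ⟨a, rfl⟩ := posIdx_surjective i
    obtain ⟨b, rfl⟩ := posIdx_surjective j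
    exact ⟨altY _ F a b, hπY a b⟩
  obtain ⟨q, rfl⟩ := Ideal.Quotient.mk_surjective x
  obtain ⟨p, hp⟩ := hsurj q
  rw [← hp]
  exact hY.span_std h2' hF π hπY p

end Variety

section Independence

variable {n : ℕ} {R : Type*} [CommRing R]

/-- The alternating matrix obtained from the rows of `z` by pairing consecutive rows. -/
def wedgeY (h : ℕ) (z : ℕ → Fin n → R) (a b : Fin n) : R :=
  ∑ k ∈ Finset.range h, (z (2 * k) a * z (2 * k + 1) b - z (2 * k + 1) a * z (2 * k) b)

theorem wedgeY_isAltM (h : ℕ) (z : ℕ → Fin n → R) : IsAltM (wedgeY h z) where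
  diag a := Finset.sum_eq_zero fun k _ => by ring
  swap a b := by
    rw [wedgeY, wedgeY, ← Finset.sum_neg_distrib]
    exact Finset.sum_congr rfl fun k _ => by ring

theorem map_wedgeY {S : Type*} [CommRing S] (f : R →+* S) (h : ℕ) (z : ℕ → Fin n → R)
    (a b : Fin n) : f (wedgeY h z a b) = wedgeY h (fun t a => f (z t a)) a b := by
  simp only [wedgeY, map_sum, map_sub, map_mul]

theorem sum_mul_gpf_cons_eq_zero {Y : Fin n → Fin n → R} (A : Finset (Fin n)) (lam : Fin n → R)
    (h : ∀ b, ∑ a ∈ A, lam a * Y a b = 0) (l : List (Fin n)) :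
    ∑ a ∈ A, lam a * gpf Y (a :: l) = 0 := by
  simp only [gpf_cons, Finset.mul_sum]
  rw [Finset.sum_comm]
  refine Finset.sum_eq_zero fun i _ => ?_
  have := h l[i]
  calc _ = (-1) ^ (i : ℕ) * (∑ a ∈ A, lam a * Y a l[i]) * gpf Y (l.eraseIdx i) := by
        rw [Finset.mul_sum, Finset.sum_mul]
        exact Finset.sum_congr rfl fun a _ => by ring
    _ = 0 := by rw [this]; ring

theorem pfS_wedgeY_eq_zero [IsDomain R] (h : ℕ) (z : ℕ → Fin n → R) (q : Fin n) (c : ℕ)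
    (hz : ∀ t a, a ≤ q → c ≤ t → z t a = 0) {L : Finset (Fin n)}
    (hc : c < cnt L q) : pfS (wedgeY h z) L = 0 := by
  set A := L.filter (· ≤ q) with hA
  let f : (A → R) →ₗ[R] (Fin c → R) :=
    LinearMap.pi fun t => ∑ a : A, z t a • LinearMap.proj a
  have hf : ¬ Function.Injective f := fun hi => by
    have := card_le_of_injective R f hi
    rw [Fintype.card_coe, Fintype.card_fin] at this
    exact absurd hc (not_lt.2 this)
  rw [← LinearMap.ker_eq_bot, ← ne_eq, Submodule.ne_bot_iff] at hf
  obtain ⟨l0, hl0, hne⟩ := hf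
  obtain ⟨a0, ha0⟩ := Function.ne_iff.1 hne
  set lam : Fin n → R := fun a => if ha : a ∈ A then l0 ⟨a, ha⟩ else 0 with hlam
  have hz' : ∀ t, ∑ a ∈ A, lam a * z t a = 0 := by
    intro t
    by_cases ht : t < c
    · have := congrFun (LinearMap.mem_ker.1 hl0) ⟨t, ht⟩
      simp only [f, LinearMap.pi_apply, LinearMap.sum_apply, LinearMap.smul_apply,
        LinearMap.proj_apply, Pi.zero_apply, smul_eq_mul] at this
      rw [← this, ← Finset.sum_coe_sort A]
      refine Finset.sum_congr rfl fun a _ => ?_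
      simp only [hlam, a.2, dif_pos]
      exact mul_comm _ _
    · refine Finset.sum_eq_zero fun a ha => ?_
      rw [hz t a (Finset.mem_filter.1 ha).2 (not_lt.1 ht), mul_zero]
  have hY : ∀ b, ∑ a ∈ A, lam a * wedgeY h z a b = 0 := by
    intro b
    simp only [wedgeY, Finset.mul_sum]
    rw [Finset.sum_comm]
    refine Finset.sum_eq_zero fun k _ => ?_
    calc _ = (∑ a ∈ A, lam a * z (2 * k) a) * z (2 * k + 1) b -
          (∑ a ∈ A, lam a * z (2 * k + 1) a) * z (2 * k) b := by
          rw [Finset.sum_mul, Finset.sum_mul, ← Finset.sum_sub_distrib]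
          exact Finset.sum_congr rfl fun a _ => by ring
      _ = 0 := by rw [hz', hz']; ring
  have ha0L : (a0 : Fin n) ∈ L := (Finset.mem_filter.1 a0.2).1
  have hsum := sum_mul_gpf_cons_eq_zero A lam hY (L.erase a0).sort
  have halt := wedgeY_isAltM h z
  rw [Finset.sum_eq_single (a0 : Fin n)] at hsum
  · have hlam0 : lam a0 = l0 a0 := by simp only [hlam, a0.2, dif_pos]
    rw [hlam0] at hsum
    have h0 := (mul_eq_zero.1 hsum).resolve_left ha0
    have hnd : (a0.1 :: (L.erase a0).sort).Nodup :=
      List.nodup_cons.2 ⟨by simp, Finset.sort_nodup _ _⟩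
    obtain ⟨ε, hε⟩ := halt.gpf_eq_pfS hnd
    rw [List.toFinset_cons, Finset.sort_toFinset, Finset.insert_erase ha0L, h0] at hε
    exact ((smul_eq_zero_iff_eq ε).1 hε.symm)
  · intro a ha hne
    rw [halt.gpf_of_not_nodup, mul_zero]
    rw [List.nodup_cons, not_and_or, not_not]
    left
    simp only [Finset.mem_sort, Finset.mem_erase]
    exact ⟨hne, (Finset.mem_filter.1 ha).1⟩
  · exact fun hn => absurd a0.2 hn

theorem gpf_cons_cons {Y : Fin n → Fin n → R} (a b : Fin n) (l : List (Fin n))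
    (h : ∀ x ∈ l, Y a x = 0) : gpf Y (a :: b :: l) = Y a b * gpf Y l := by
  rw [gpf_cons]
  simp only [List.length_cons]
  rw [Fin.sum_univ_succ, Finset.sum_eq_zero]
  · simp
  · intro i _
    have : Y a ((b :: l)[(i.succ : Fin (l.length + 1))]) = 0 := h _ (by simp)
    rw [this]; ring

theorem gpf_wedgeY_of_indicator (h : ℕ) (z : ℕ → Fin n → R) (l : List (Fin n))
    (hz : ∀ t s (hs : s < l.length), z t l[s] = if s = t then 1 else 0)
    (hh : l.length ≤ 2 * h) (he : Even l.length) : gpf (wedgeY h z) l = 1 := by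
  obtain ⟨m, hm⟩ := he
  have hY : ∀ j i (hj : 2 * j < l.length) (hi : i < l.length), 2 * j < i →
      wedgeY h z l[2 * j] l[i] = if i = 2 * j + 1 then 1 else 0 := by
    intro j i hj hi hji
    rw [wedgeY, Finset.sum_eq_single j]
    · rw [hz, hz, hz, hz]
      split_ifs <;> first | omega | simp
    · intro k _ hk
      rw [hz, hz, hz, hz, if_neg (by omega : ¬ 2 * j = 2 * k),
        if_neg (by omega : ¬ 2 * j = 2 * k + 1)]
      ring
    · intro hn; exact absurd (Finset.mem_range.2 (by omega)) hn
  have key : ∀ k ≤ m, gpf (wedgeY h z) (l.drop (2 * (m - k))) = 1 := by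
    intro k
    induction k with
    | zero => intro _; rw [List.drop_eq_nil_of_le (by omega), gpf_nil]
    | succ k ih =>
      intro hk
      have e : 2 * (m - k) = 2 * (m - (k + 1)) + 1 + 1 := by omega
      have ih := ih (by omega)
      rw [e] at ih
      have h1 : 2 * (m - (k + 1)) < l.length := by omega
      rw [List.drop_eq_getElem_cons h1, List.drop_eq_getElem_cons (by omega), gpf_cons_cons, ih,
        hY _ _ h1 (by omega) (by omega), if_pos rfl, one_mul]
      intro x hx
      obtain ⟨i, hi, rfl⟩ := List.mem_iff_getElem.1 hx
      rw [List.length_drop] at hi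
      rw [List.getElem_drop, hY _ _ h1 (by omega) (by omega), if_neg (by omega)]
  simpa using key m le_rfl

theorem lt_cnt_sort (N : Finset (Fin n)) (s : ℕ) (hs : s < N.sort.length) :
    s < cnt N N.sort[s] := by
  have hs' : s < N.card := by rwa [Finset.length_sort] at hs
  have : ((Finset.Iic (⟨s, hs'⟩ : Fin N.card)).map (N.orderEmbOfFin rfl).toEmbedding).card ≤
      cnt N N.sort[s] := by
    refine Finset.card_le_card fun x hx => ?_
    obtain ⟨i, hi, rfl⟩ := Finset.mem_map.1 hx
    refine Finset.mem_filter.2 ⟨Finset.orderEmbOfFin_mem N rfl i, ?_⟩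
    exact (N.orderEmbOfFin rfl).monotone (Finset.mem_Iic.1 hi)
  rw [Finset.card_map, Fin.card_Iic] at this
  exact this

variable (F : Type*) [Field F]

/-- The generic matrix whose column `a` is truncated to its first `c a` entries. -/
def genZ (c : Fin n → ℕ) (t : ℕ) (a : Fin n) : MvPolynomial (ℕ × Fin n) F :=
  if t < c a then MvPolynomial.X (t, a) else 0

/-- The substitution truncating the columns of the generic matrix. -/
def truncHom (c : Fin n → ℕ) : MvPolynomial (ℕ × Fin n) F →ₐ[F] MvPolynomial (ℕ × Fin n) F :=
  MvPolynomial.aeval fun p => genZ F c p.1 p.2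

theorem truncHom_genZ {c d : Fin n → ℕ} (hcd : c ≤ d) (t : ℕ) (a : Fin n) :
    truncHom F c (genZ F d t a) = genZ F c t a := by
  rw [genZ]
  split_ifs with h
  · rw [truncHom, MvPolynomial.aeval_X]
  · rw [map_zero, genZ, if_neg]
    have : c a ≤ d a := hcd a
    omega

theorem truncHom_val (h : ℕ) {c d : Fin n → ℕ} (hcd : c ≤ d) (T : List (Finset (Fin n))) :
    truncHom F c (val (wedgeY h (genZ F d)) T) = val (wedgeY h (genZ F c)) T := by
  have := val_map (truncHom F c).toRingHom (wedgeY h (genZ F d)) T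
  simp only [map_wedgeY, AlgHom.toRingHom_eq_coe, RingHom.coe_coe, truncHom_genZ F hcd] at this
  exact this

theorem pfS_genZ_ne_zero (h : ℕ) (N : Finset (Fin n)) (he : Even N.card) (hN : N.card ≤ 2 * h) :
    pfS (wedgeY h (genZ F (cnt N))) N ≠ 0 := by
  intro h0
  let f : MvPolynomial (ℕ × Fin n) F →+* F :=
    MvPolynomial.eval fun p => if N.sort[p.1]? = some p.2 then 1 else 0
  have h1 := congrArg f h0
  rw [pfS_map, map_zero] at h1
  simp only [map_wedgeY] at h1
  rw [pfS, gpf_wedgeY_of_indicator] at h1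
  · exact one_ne_zero h1
  · intro t s hs
    rw [genZ]
    split_ifs with h1 h2 h2
    · rw [MvPolynomial.eval_X, if_pos]
      rw [← h2, List.getElem?_eq_getElem hs]
    · rw [MvPolynomial.eval_X, if_neg]
      intro h3
      obtain ⟨ht, h3⟩ := List.getElem?_eq_some_iff.1 h3
      exact h2 ((Finset.sort_nodup N _).getElem_inj_iff.1 h3).symm
    · exact absurd (h2 ▸ lt_cnt_sort N s hs) h1
    · rw [map_zero]
  · rwa [Finset.length_sort]
  · rwa [Finset.length_sort]

theorem pfS_genZ_eq_zero (h : ℕ) {c : Fin n → ℕ} (hc : Monotone c) {L : Finset (Fin n)}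
    {q : Fin n} (hq : c q < cnt L q) : pfS (wedgeY h (genZ F c)) L = 0 := by
  refine pfS_wedgeY_eq_zero h _ q (c q) (fun t a ha ht => ?_) hq
  rw [genZ, if_neg]
  have := hc ha
  omega

theorem cnt_mono (N : Finset (Fin n)) : Monotone (cnt N) := fun _ _ hab =>
  Finset.card_le_card fun _ hx => Finset.mem_filter.2
    ⟨(Finset.mem_filter.1 hx).1, (Finset.mem_filter.1 hx).2.trans hab⟩

variable {F}

open Classical in
/-- Standard tableaux whose rows are bounded by `c` have linearly independent values at the
generic matrix truncated by `c`. -/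
theorem eq_zero_of_sum_val_eq_zero (h : ℕ) (H : Finset (Finset (Fin n)))
    (hH : ∀ N ∈ H, Even N.card ∧ N.Nonempty ∧ N.card ≤ 2 * h) (k : ℕ) :
    ∀ (c : Fin n → ℕ) (S : Finset (List (Finset (Fin n)))) (g : List (Finset (Fin n)) → F),
      (∀ T ∈ S, IsStd H T ∧ T.length ≤ k ∧ ∀ N ∈ T, cnt N ≤ c) →
      ∑ T ∈ S, g T • val (wedgeY h (genZ F c)) T = 0 → ∀ T ∈ S, g T = 0 := by
  induction k with
  | zero =>
    intro c S g hS hsum T hT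
    have h0 : ∀ T ∈ S, T = [] := fun T hT =>
      List.length_eq_zero_iff.1 (Nat.le_zero.1 (hS T hT).2.1)
    have hS1 : S = {[]} := Finset.eq_singleton_iff_nonempty_unique_mem.2 ⟨⟨T, hT⟩, h0⟩
    rw [hS1, Finset.sum_singleton, val, List.map_nil, List.prod_nil] at hsum
    rw [h0 T hT]
    exact (smul_eq_zero.1 hsum).resolve_right one_ne_zero
  | succ k ih =>
    intro c S g hS hsum
    have htr : ∀ d ≤ c, ∑ T ∈ S, g T • val (wedgeY h (genZ F d)) T = 0 := by
      intro d hd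
      have := congrArg (truncHom F d) hsum
      simpa only [map_sum, map_smul, truncHom_val F h hd, map_zero] using this
    have hnil : [] ∈ S → g [] = 0 := by
      intro hm
      have := htr 0 (fun _ => Nat.zero_le _)
      rw [Finset.sum_eq_single [] _ (fun hn => absurd hm hn)] at this
      · rw [val, List.map_nil, List.prod_nil] at this
        exact (smul_eq_zero.1 this).resolve_right one_ne_zero
      · rintro (_ | ⟨N, T⟩) hT hne
        · exact absurd rfl hne
        · have hN := hH N ((hS _ hT).1.1 N List.mem_cons_self)
          obtain ⟨q, hq⟩ := exists_cnt_eq_card hN.2.1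
          rw [val, List.map_cons, List.prod_cons,
            pfS_genZ_eq_zero F h (c := 0) (fun _ _ _ => le_rfl) (q := q), zero_mul, smul_zero]
          rw [hq]
          exact Finset.card_pos.2 hN.2.1
    by_contra! hcon
    obtain ⟨T1, hT1, hgT1⟩ := hcon
    set S' := S.filter fun T => g T ≠ 0 with hS'
    have hcons : ∀ T ∈ S', T.headD ∅ :: T.tail = T := by
      rintro (_ | ⟨N, T⟩) hT
      · rw [hS', Finset.mem_filter] at hT
        exact absurd (hnil hT.1) hT.2
      · rfl
    obtain ⟨T0, hT0, hmin⟩ := Finset.exists_min_image S' (fun T => mu (T.headD ∅))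
      ⟨T1, Finset.mem_filter.2 ⟨hT1, hgT1⟩⟩
    set N := T0.headD ∅ with hN
    have hsub : ∀ T ∈ S', T ∈ S := fun T hT => (Finset.mem_filter.1 hT).1
    have hhead : ∀ T ∈ S', T.headD ∅ ∈ T := fun T hT => by
      have := List.mem_cons_self (a := T.headD ∅) (l := T.tail)
      rwa [hcons T hT] at this
    have hNc : cnt N ≤ c := (hS T0 (hsub T0 hT0)).2.2 N (hhead T0 hT0)
    have hNH := hH N ((hS T0 (hsub T0 hT0)).1.1 N (hhead T0 hT0))
    have hrel := htr (cnt N) hNc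
    have hrel1 : ∑ T ∈ S' with T.headD ∅ = N, g T • val (wedgeY h (genZ F (cnt N))) T = 0 := by
      rw [← hrel, hS', Finset.filter_filter]
      refine Finset.sum_subset (Finset.filter_subset _ _) fun T hT hn => ?_
      by_cases hg : g T = 0
      · rw [hg, zero_smul]
      have hT' : T ∈ S' := Finset.mem_filter.2 ⟨hT, hg⟩
      have hne : T.headD ∅ ≠ N := fun e => hn (Finset.mem_filter.2 ⟨hT, hg, e⟩)
      have : ∃ q, cnt N q < cnt (T.headD ∅) q := by
        by_contra! hle
        refine hne (eq_of_cnt_eq fun a => ?_)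
        have hsum' : mu (T.headD ∅) = mu N := le_antisymm
          (Finset.sum_le_sum fun a _ => hle a) (hmin T hT')
        exact (Finset.sum_eq_sum_iff_of_le fun a _ => hle a).1 hsum' a (Finset.mem_univ a)
      obtain ⟨q, hq⟩ := this
      rw [← hcons T hT', val, List.map_cons, List.prod_cons,
        pfS_genZ_eq_zero F h (cnt_mono N) hq, zero_mul, smul_zero]
    set S2 := (S'.filter fun T => T.headD ∅ = N).image List.tail with hS2
    have hmem2 : ∀ U ∈ S2, N :: U ∈ S' := by
      intro U hU
      obtain ⟨T, hT, rfl⟩ := Finset.mem_image.1 hU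
      rw [Finset.mem_filter] at hT
      rw [← hT.2, hcons T hT.1]
      exact hT.1
    have hrel2 : ∑ U ∈ S2, g (N :: U) • val (wedgeY h (genZ F (cnt N))) U = 0 := by
      have hpf := pfS_genZ_ne_zero F h N hNH.1 hNH.2.2
      refine (mul_eq_zero.1 ?_).resolve_left hpf
      rw [← hrel1, Finset.mul_sum, hS2, Finset.sum_image]
      · refine Finset.sum_congr rfl fun T hT => ?_
        rw [Finset.mem_filter] at hT
        have e := hcons T hT.1
        rw [hT.2] at e
        rw [mul_smul_comm, e]
        congr 1
        conv_rhs => rw [← e]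
        rw [val, val, List.map_cons, List.prod_cons]
      · intro T hT T' hT' he
        rw [Finset.mem_coe, Finset.mem_filter] at hT hT'
        rw [← hcons T hT.1, ← hcons T' hT'.1, hT.2, hT'.2, he]
    have hfin := ih (cnt N) S2 (fun U => g (N :: U)) (fun U hU => ?_) hrel2 T0.tail
      (Finset.mem_image.2 ⟨T0, Finset.mem_filter.2 ⟨hT0, rfl⟩, rfl⟩)
    · rw [hcons T0 hT0] at hfin
      exact (Finset.mem_filter.1 hT0).2 hfin
    · obtain ⟨⟨h1, h2⟩, h3, h4⟩ := hS _ (hsub _ (hmem2 U hU))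
      rw [List.pairwise_cons] at h2
      refine ⟨⟨fun M hM => h1 M (List.mem_cons_of_mem _ hM), h2.2⟩, ?_, fun M hM => h2.1 M hM⟩
      simpa using h3

end Independence

section Isotropic

variable {r : ℕ} {R : Type*} [CommRing R]

/-- The position of a given index. -/
def posOf {r : ℕ} (i : Fin (2 * r)) : Fin (2 * r) :=
  if h : (i : ℕ) < r then hi ⟨i, h⟩ else lo ⟨i - r, by omega⟩

theorem posOf_emb (j : Fin r) : posOf (emb r j) = hi j := by
  rw [posOf, dif_pos (by simp [emb])]; rfl

theorem posOf_embBar (j : Fin r) : posOf (embBar r j) = lo j := by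
  rw [posOf, dif_neg (by simp [embBar])]
  congr 1; ext; simp [embBar]

theorem posOf_posIdx (a : Fin (2 * r)) : posOf (posIdx a) = a := by
  rcases eq_lo_or_hi a with h | h <;> rw [h]
  · rw [posIdx_lo, posOf_embBar]
  · rw [posIdx_hi, posOf_emb]

/-- The rows of `f` span a totally isotropic subspace. -/
def IsIsotropic (f : ℕ → Fin (2 * r) → R) : Prop :=
  ∀ s t, ∑ j : Fin r, (f s (hi j) * f t (lo j) - f s (lo j) * f t (hi j)) = 0

theorem IsIsotropic.wedgeY_symp {f : ℕ → Fin (2 * r) → R} (hf : IsIsotropic f) (h : ℕ)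
    (b c : Fin (2 * r)) :
    ∑ j : Fin r, (wedgeY h f (hi j) b * wedgeY h f (lo j) c -
      wedgeY h f (lo j) b * wedgeY h f (hi j) c) = 0 := by
  have : ∀ j : Fin r, wedgeY h f (hi j) b * wedgeY h f (lo j) c -
      wedgeY h f (lo j) b * wedgeY h f (hi j) c =
      ∑ k ∈ Finset.range h, ∑ l ∈ Finset.range h,
      ((f (2 * k) (hi j) * f (2 * l) (lo j) - f (2 * k) (lo j) * f (2 * l) (hi j)) *
          (f (2 * k + 1) b * f (2 * l + 1) c) -
        (f (2 * k) (hi j) * f (2 * l + 1) (lo j) - f (2 * k) (lo j) * f (2 * l + 1) (hi j)) *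
          (f (2 * k + 1) b * f (2 * l) c) -
        (f (2 * k + 1) (hi j) * f (2 * l) (lo j) - f (2 * k + 1) (lo j) * f (2 * l) (hi j)) *
          (f (2 * k) b * f (2 * l + 1) c) +
        (f (2 * k + 1) (hi j) * f (2 * l + 1) (lo j) - f (2 * k + 1) (lo j) * f (2 * l + 1) (hi j))
          *
          (f (2 * k) b * f (2 * l) c)) := by
    intro j
    simp only [wedgeY, Finset.sum_mul_sum, ← Finset.sum_sub_distrib]
    exact Finset.sum_congr rfl fun k _ => Finset.sum_congr rfl fun l _ => by ring
  simp only [this]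
  rw [Finset.sum_comm]
  refine Finset.sum_eq_zero fun k _ => ?_
  rw [Finset.sum_comm]
  refine Finset.sum_eq_zero fun l _ => ?_
  simp only [Finset.sum_add_distrib, Finset.sum_sub_distrib, ← Finset.sum_mul]
  simp only [← Finset.sum_sub_distrib, hf _ _]
  ring

/-- The matrix with entries `wedgeY h f`, indexed as `Y`. -/
def wedgeMat (h : ℕ) (f : ℕ → Fin (2 * r) → R) : Matrix (Fin (2 * r)) (Fin (2 * r)) R :=
  Matrix.of fun i j => wedgeY h f (posOf i) (posOf j)

theorem IsIsotropic.memV [IsDomain R] {f : ℕ → Fin (2 * r) → R} (hf : IsIsotropic f) (h : ℕ) :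
    MemV r (wedgeMat h f) := by
  have halt := wedgeY_isAltM h f
  have h1 : wedgeMat h f = -(wedgeMat h f)ᵀ := by
    ext i j; exact halt.swap _ _
  have h3 : (wedgeMat h f)ᵀ * Jmat r R * wedgeMat h f = 0 := by
    ext b c
    rw [mul_Jmat_mul_apply]
    simp only [Matrix.transpose_apply, wedgeMat, Matrix.of_apply, posOf_emb, posOf_embBar]
    exact hf.wedgeY_symp h _ _
  refine ⟨h1, fun i => halt.diag _, h3, ?_⟩
  have hnil : IsNilpotent (-(Jmat r R * wedgeMat h f)) := by
    refine ⟨2, ?_⟩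
    rw [neg_sq, sq, Matrix.mul_assoc, ← Matrix.mul_assoc (wedgeMat h f)]
    have : wedgeMat h f * Jmat r R * wedgeMat h f = 0 := by
      nth_rewrite 1 [h1]
      rw [Matrix.neg_mul, Matrix.neg_mul, h3, neg_zero]
    rw [this, Matrix.mul_zero]
  have := Matrix.isNilpotent_charpoly_sub_pow_of_isNilpotent hnil
  rw [Fintype.card_fin] at this
  exact sub_eq_zero.1 this.eq_zero

theorem sum_range_two_mul {M : Type*} [AddCommMonoid M] (g : ℕ → M) (h : ℕ) :
    ∑ t ∈ Finset.range (2 * h), g t = ∑ k ∈ Finset.range h, (g (2 * k) + g (2 * k + 1)) := by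
  induction h with
  | zero => simp
  | succ h ih =>
    rw [Finset.sum_range_succ, ← ih, mul_add, mul_one, Finset.sum_range_succ,
      Finset.sum_range_succ, add_assoc]

/-- The exchange of `2 * k` and `2 * k + 1`. -/
def swapPair {h : ℕ} (t : Fin (2 * h)) : Fin (2 * h) :=
  ⟨if (t : ℕ) % 2 = 0 then t + 1 else t - 1, by split_ifs <;> omega⟩

theorem swapPair_involutive {h : ℕ} : Function.Involutive (swapPair (h := h)) := fun t => by
  ext
  simp only [swapPair]
  split_ifs <;> omega

theorem det_wedgeMat_ne_zero [IsDomain R] {h : ℕ} (hr : r = 2 * h) {f : ℕ → Fin (2 * r) → R}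
    (h0 : ∀ t j : Fin r, j < t → f t (lo j) = 0) (h1 : ∀ t : Fin r, f t (lo t) ≠ 0) :
    (Matrix.of fun i j : Fin r => wedgeMat h f (embBar r i) (embBar r j)).det ≠ 0 := by
  subst hr
  let P : Matrix (Fin (2 * h)) (Fin (2 * h)) R := Matrix.of fun t j => f t (lo j)
  have hP : P.det ≠ 0 := by
    rw [Matrix.det_of_isUpperTriangular (M := P) fun t j hjt => h0 t j hjt]
    exact Finset.prod_ne_zero_iff.2 fun t _ => h1 t
  let v : Fin (2 * h) → R := fun t => if (t : ℕ) % 2 = 0 then 1 else -1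
  have hM : (Matrix.of fun i j : Fin (2 * h) => wedgeMat h f (embBar _ i) (embBar _ j)) =
      Pᵀ * Matrix.of fun t j => v t * P.submatrix swapPair_involutive.toPerm id t j := by
    ext i j
    rw [Matrix.of_apply, wedgeMat, Matrix.of_apply, posOf_embBar, posOf_embBar, Matrix.mul_apply,
      wedgeY]
    have := Fin.sum_univ_eq_sum_range (fun t => f t (lo i) *
      ((if t % 2 = 0 then 1 else -1) * f (if t % 2 = 0 then t + 1 else t - 1) (lo j))) (2 * h)
    rw [sum_range_two_mul] at this
    trans
    swap
    · refine (Eq.trans (Finset.sum_congr rfl fun t _ => ?_) this).symm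
      simp only [Matrix.transpose_apply, P, Matrix.of_apply, v, Matrix.submatrix_apply, id,
        Function.Involutive.coe_toPerm, swapPair]
    · refine Finset.sum_congr rfl fun k _ => ?_
      have e1 : 2 * k % 2 = 0 := by omega
      have e2 : ¬ (2 * k + 1) % 2 = 0 := by omega
      simp only [e1, e2, if_true, if_false, Nat.add_sub_cancel]
      ring
  rw [hM, Matrix.det_mul, Matrix.det_transpose, Matrix.det_mul_column, Matrix.det_permute]
  refine mul_ne_zero hP (mul_ne_zero (Finset.prod_ne_zero_iff.2 fun t _ => ?_)
    (mul_ne_zero ?_ hP))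
  · simp only [v]; split_ifs <;> simp
  · rcases Int.units_eq_one_or (Equiv.Perm.sign (swapPair_involutive (h :=
      h)).toPerm) with e | e <;> rw [e] <;> simp

end Isotropic

section Point

theorem exists_eq_of_depends_gt {r : ℕ} {M : Type*} [Zero M] (Φ : Fin r → (Fin r → M) → M)
    (h : ∀ s w w', (∀ j, s < j → w j = w' j) → Φ s w = Φ s w') : ∃ w, ∀ s, w s = Φ s w := by
  have wf : WellFounded ((· > ·) : Fin r → Fin r → Prop) := wellFounded_gt
  refine ⟨wf.fix fun s rec => Φ s fun j => if hj : s < j then rec j hj else 0, fun s => ?_⟩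
  rw [wf.fix_eq]
  refine h _ _ _ fun j hj => ?_
  rw [dif_pos hj]

variable {r : ℕ} {K : Type*} [Field K]

open Polynomial

theorem exists_hi_entries (x : ℕ → Fin (2 * r) → K) (hx : ∀ s : Fin r, x s (lo s) ≠ 0)
    (t : Fin r) : ∃ w : Fin r → K[X], (∀ j, t ≤ j → w j = C (x t (hi j))) ∧
      (∀ j, j < t → (w j).eval 0 = 0) ∧
      ∀ s, s < t → C (x s (lo s)) * w s + ∑ j ∈ Finset.Ioi s, X ^ (2 * (j - s : ℕ)) *
        (C (x s (lo j)) * w j - C (x s (hi j)) * (if t ≤ j then C (x t (lo j)) else 0)) = 0 := by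
  obtain ⟨w, hw⟩ := exists_eq_of_depends_gt (fun s (w : Fin r → K[X]) =>
    if t ≤ s then C (x t (hi s)) else
      -(C (x s (lo s))⁻¹ * ∑ j ∈ Finset.Ioi s, X ^ (2 * (j - s : ℕ)) *
        (C (x s (lo j)) * w j - C (x s (hi j)) * (if t ≤ j then C (x t (lo j)) else 0)))) (by
    intro s w w' h
    split_ifs with hs
    · rfl
    · congr 2
      exact Finset.sum_congr rfl fun j hj => by rw [h j (Finset.mem_Ioi.1 hj)])
  refine ⟨w, fun j hj => ?_, fun j hj => ?_, fun s hs => ?_⟩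
  · rw [hw, if_pos hj]
  · rw [hw, if_neg (not_le.2 hj), eval_neg, eval_mul, eval_finsetSum, Finset.sum_eq_zero,
      mul_zero, neg_zero]
    intro i hi
    rw [eval_mul, eval_pow, eval_X, zero_pow, zero_mul]
    have := Fin.lt_def.1 (Finset.mem_Ioi.1 hi)
    omega
  · nth_rewrite 1 [hw]
    rw [if_neg (not_le.2 hs), mul_neg, ← mul_assoc, ← C_mul, mul_inv_cancel₀ (hx s), C_1, one_mul,
      neg_add_cancel]

/-- A family of isotropic rows degenerating at `0` to the generic truncated matrix. -/
theorem exists_isotropic (x : ℕ → Fin (2 * r) → K) (hx : ∀ s : Fin r, x s (lo s) ≠ 0) :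
    ∃ z : ℕ → Fin (2 * r) → K[X],
      (∀ t a, (z t a).eval 0 = if t < (lev a : ℕ) + 1 then x t a else 0) ∧
      (∀ t j : Fin r, j < t → z t (lo j) = 0) ∧
      (∀ t : Fin r, z t (lo t) ≠ 0) ∧
      IsIsotropic fun t a => X ^ (lev a : ℕ) * z t a := by
  choose w hw1 hw2 hw3 using exists_hi_entries x hx
  let z : ℕ → Fin (2 * r) → K[X] := fun t a =>
    if ht : t < r then
      (if (a : ℕ) % 2 = 0 then (if t ≤ (lev a : ℕ) then C (x t a) else 0) else w ⟨t, ht⟩ (lev a))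
    else 0
  have hlo : ∀ t j : Fin r, z t (lo j) = if t ≤ j then C (x t (lo j)) else 0 := by
    intro t j
    simp only [z, t.2, dif_pos, lev_lo]
    rw [if_pos (by simp [lo])]
    rfl
  have hhi : ∀ t j : Fin r, z t (hi j) = w t j := by
    intro t j
    simp only [z, t.2, dif_pos, lev_hi]
    rw [if_neg (by simp [hi])]
  have hbig : ∀ t a, ¬ t < r → z t a = 0 := fun t a ht => by simp only [z, ht, dif_neg,
    not_false_iff]
  refine ⟨z, ?_, ?_, ?_, ?_⟩
  · intro t a
    by_cases ht : t < r
    · lift t to Fin r using ht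
      rcases eq_lo_or_hi a with h | h <;> rw [h]
      · rw [hlo, lev_lo]
        split_ifs with h1 h2 h2 <;> rw [Fin.le_def] at h1
        · rw [eval_C]
        · omega
        · omega
        · rw [eval_zero]
      · rw [hhi, lev_hi]
        split_ifs with h1
        · rw [hw1 _ _ (Fin.le_def.2 (by omega)), eval_C]
        · rw [hw2 _ _ (Fin.lt_def.2 (by omega))]
    · rw [hbig t a ht, eval_zero, if_neg]
      have := (lev a).2
      omega
  · intro t j hj
    rw [hlo, if_neg (not_le.2 hj)]
  · intro t
    rw [hlo, if_pos le_rfl]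
    exact C_ne_zero.2 (hx t)
  · have key : ∀ s t : Fin r, s < t → ∑ j : Fin r,
        (X ^ (lev (hi j) : ℕ) * z s (hi j) * (X ^ (lev (lo j) : ℕ) * z t (lo j)) -
          X ^ (lev (lo j) : ℕ) * z s (lo j) * (X ^ (lev (hi j) : ℕ) * z t (hi j))) = 0 := by
      intro s t hst
      rw [← Finset.sum_subset (Finset.subset_univ (Finset.Ici s)), ← Finset.Ioi_insert,
        Finset.sum_insert (by simp)]
      · have := congrArg (fun p => -(X ^ (2 * (s : ℕ)) * p)) (hw3 t s hst)
        simp only [mul_zero, neg_zero] at this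
        rw [← this, mul_add, neg_add, Finset.mul_sum, ← Finset.sum_neg_distrib]
        congr 1
        · rw [lev_lo, lev_hi, hlo, hlo, hhi, hhi, if_neg (not_le.2 hst), if_pos le_rfl]
          ring
        · refine Finset.sum_congr rfl fun j hj => ?_
          have hj := Finset.mem_Ioi.1 hj
          rw [lev_lo, lev_hi, hlo, hlo, hhi, hhi, if_pos hj.le, hw1 s j hj.le]
          have e : (X : K[X]) ^ (2 * (s : ℕ)) * X ^ (2 * (j - s : ℕ)) = X ^ (j : ℕ) * X ^ (j : ℕ)
            := by
            rw [← pow_add, ← pow_add]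
            congr 1
            have := Fin.lt_def.1 hj
            omega
          simp only [← mul_assoc, e]
          ring
      · intro j _ hj
        have hj := not_le.1 (fun hh => hj (Finset.mem_Ici.2 hh))
        rw [hlo, hlo, if_neg (not_le.2 hj), if_neg (not_le.2 (hj.trans hst))]
        ring
    intro s t
    dsimp only
    by_cases hs : s < r
    swap
    · simp [hbig s _ hs]
    by_cases ht : t < r
    swap
    · simp [hbig t _ ht]
    rcases lt_trichotomy s t with h | h | h
    · exact key ⟨s, hs⟩ ⟨t, ht⟩ h
    · subst h
      exact Finset.sum_eq_zero fun j _ => by ring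
    · rw [← neg_eq_zero, ← key ⟨t, ht⟩ ⟨s, hs⟩ h, ← Finset.sum_neg_distrib]
      exact Finset.sum_congr rfl fun j _ => by ring

end Point

section Injectivity

open Polynomial

variable {r : ℕ}

/-- The total level of a row. -/
def rowLev (N : Finset (Fin (2 * r))) : ℕ := (N.sort.map fun a => (lev a : ℕ)).sum

/-- The total level of a tableau. -/
def tabLev (T : List (Finset (Fin (2 * r)))) : ℕ := (T.map rowLev).sum

theorem val_wedgeY_scale {K : Type*} [Field K] (h : ℕ) (z : ℕ → Fin (2 * r) → K[X])
    (T : List (Finset (Fin (2 * r)))) :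
    val (wedgeY h fun t a => X ^ (lev a : ℕ) * z t a) T =
      X ^ tabLev T * val (wedgeY h z) T := by
  have hY : (wedgeY h fun t a => X ^ (lev a : ℕ) * z t a) =
      fun a b => X ^ (lev a : ℕ) * X ^ (lev b : ℕ) * wedgeY h z a b := by
    ext1 a; ext1 b
    rw [wedgeY, wedgeY, Finset.mul_sum]
    exact Finset.sum_congr rfl fun k _ => by ring
  have hl : ∀ l : List (Fin (2 * r)), (l.map fun a => (X : K[X]) ^ (lev a : ℕ)).prod =
      X ^ (l.map fun a => (lev a : ℕ)).sum := by
    intro l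
    induction l with
    | nil => simp
    | cons a l ih => rw [List.map_cons, List.prod_cons, ih, List.map_cons, List.sum_cons, pow_add]
  induction T with
  | nil => simp [val, tabLev]
  | cons N T ih =>
    have e : ∀ Y : Fin (2 * r) → Fin (2 * r) → K[X], val Y (N :: T) = pfS Y N * val Y T :=
      fun Y => by rw [val, List.map_cons, List.prod_cons, val]
    have e' : tabLev (N :: T) = rowLev N + tabLev T := by
      rw [tabLev, List.map_cons, List.sum_cons, tabLev]
    rw [e, e, ih, e', pow_add, pfS, pfS, hY,
      gpf_scale (fun a => (X : K[X]) ^ (lev a : ℕ)), hl, rowLev]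
    ring

theorem card_le_of_mem_sympRows {N : Finset (Fin (2 * r))} (hN : N ∈ sympRows r) :
    N.card ≤ r := by
  obtain ⟨-, h1, h2⟩ := (Finset.mem_filter.1 hN).2
  obtain ⟨a, ha⟩ := exists_cnt_eq_card h1
  have := h2 a
  rw [ha] at this
  have := a.2
  omega

variable {F K : Type*} [Field F] [Field K] [Algebra F K]

theorem eq_zero_of_sum_val_isotropic {h : ℕ} (hr : r = 2 * h)
    (ψ : MvPolynomial (ℕ × Fin (2 * r)) F →ₐ[F] K) (hψ : Function.Injective ψ)
    (z : ℕ → Fin (2 * r) → K[X])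
    (hz : ∀ t a, (z t a).eval 0 = ψ (genZ F (fun a => (lev a : ℕ) + 1) t a))
    (S : Finset (List (Finset (Fin (2 * r))))) (g : List (Finset (Fin (2 * r))) → F)
    (hS : ∀ T ∈ S, IsStd (sympRows r) T)
    (hsum : ∑ T ∈ S, g T • val (wedgeY h fun t a => X ^ (lev a : ℕ) * z t a) T = 0) :
    ∀ T ∈ S, g T = 0 := by
  classical
  by_contra! hne
  obtain ⟨T0, hT0, hmin⟩ := Finset.exists_min_image (S.filter fun T => g T ≠ 0) tabLev
    (by obtain ⟨T, h1, h2⟩ := hne; exact ⟨T, Finset.mem_filter.2 ⟨h1, h2⟩⟩)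
  set S' := S.filter fun T => g T ≠ 0 with hS'
  have h1 : ∑ T ∈ S', g T • (X ^ (tabLev T - tabLev T0) * val (wedgeY h z) T) = 0 := by
    refine (mul_eq_zero.1 ?_).resolve_left (pow_ne_zero (tabLev T0) (X_ne_zero (R := K)))
    rw [← hsum, hS', Finset.sum_filter, Finset.mul_sum]
    refine Finset.sum_congr rfl fun T hT => ?_
    split_ifs with hg
    · rw [mul_smul_comm, ← mul_assoc, ← pow_add,
        Nat.add_sub_cancel' (hmin T (Finset.mem_filter.2 ⟨hT, hg⟩)), val_wedgeY_scale]
    · rw [not_not.1 hg, zero_smul, mul_zero]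
  have h2 : ∑ T ∈ S' with tabLev T = tabLev T0,
      g T • val (wedgeY h (genZ F fun a => (lev a : ℕ) + 1)) T = 0 := by
    apply hψ
    rw [map_zero, map_sum, ← eval_zero (x := (0 : K)), ← h1, eval_finsetSum, Finset.sum_filter]
    refine Finset.sum_congr rfl fun T hT => ?_
    have e := val_map (evalRingHom (0 : K)) (wedgeY h z) T
    have e' := val_map ψ.toRingHom (wedgeY h (genZ F fun a => (lev a : ℕ) + 1)) T
    simp only [map_wedgeY, AlgHom.toRingHom_eq_coe, RingHom.coe_coe, coe_evalRingHom, hz] at e e'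
    rw [map_smul, e', eval_smul, eval_mul, e, eval_pow, eval_X]
    split_ifs with hw
    · rw [hw, Nat.sub_self, pow_zero, one_mul]
    · have := hmin T hT
      rw [zero_pow (by omega), zero_mul, smul_zero]
  refine (Finset.mem_filter.1 hT0).2 (eq_zero_of_sum_val_eq_zero h (sympRows r) ?_
    (S.sup List.length) _ _ g ?_ h2 T0 (Finset.mem_filter.2 ⟨hT0, rfl⟩))
  · intro N hN
    have := (Finset.mem_filter.1 hN).2
    exact ⟨this.1, this.2.1, hr ▸ card_le_of_mem_sympRows hN⟩
  · intro T hT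
    have hTS := (Finset.mem_filter.1 (Finset.mem_filter.1 hT).1).1
    exact ⟨hS T hTS, Finset.le_sup (f := List.length) hTS, fun N hN a =>
      (Finset.mem_filter.1 ((hS T hTS).1 N hN)).2.2.2 a⟩

variable (r F) in
theorem exists_point {h : ℕ} (hr : r = 2 * h) :
    ∃ f : ℕ → Fin (2 * r) → (FractionRing (MvPolynomial (ℕ × Fin (2 * r)) F))[X],
      IsIsotropic f ∧ (∀ t j : Fin r, j < t → f t (lo j) = 0) ∧
      (∀ t : Fin r, f t (lo t) ≠ 0) ∧
      ∀ (S : Finset (List (Finset (Fin (2 * r))))) (g : List (Finset (Fin (2 * r))) → F),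
        (∀ T ∈ S, IsStd (sympRows r) T) → ∑ T ∈ S, g T • val (wedgeY h f) T = 0 →
        ∀ T ∈ S, g T = 0 := by
  let ψ := IsScalarTower.toAlgHom F (MvPolynomial (ℕ × Fin (2 * r)) F)
    (FractionRing (MvPolynomial (ℕ × Fin (2 * r)) F))
  have hψ : Function.Injective ψ := IsFractionRing.injective _ _
  obtain ⟨z, h1, h2, h3, h4⟩ := exists_isotropic
    (fun t a => ψ (MvPolynomial.X (t, a))) (fun s => by
      rw [Ne, map_eq_zero_iff _ hψ]
      exact MvPolynomial.X_ne_zero _)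
  refine ⟨_, h4, fun t j hj => ?_, fun t => ?_,
    eq_zero_of_sum_val_isotropic hr ψ hψ z fun t a => ?_⟩
  · exact mul_eq_zero_of_right _ (h2 t j hj)
  · exact mul_ne_zero (pow_ne_zero _ X_ne_zero) (h3 t)
  · rw [h1, genZ]
    split_ifs
    · rfl
    · rw [map_zero]

theorem det_mem_nonZeroDivisors_of_pos (hr : 0 < r) (h2r : Even r)
    (hF : ∀ k : ℕ, 0 < k → k ≤ r → (k : F) ≠ 0) :
    Ideal.Quotient.mk (VIdeal r F)
      (Matrix.det (Matrix.of fun i j : Fin r => Ygen r F (embBar r i) (embBar r j))) ∈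
      nonZeroDivisors (FV r F) := by
  obtain ⟨h, hh⟩ := even_iff_exists_two_mul.1 h2r
  have h2 : (2 : F) ≠ 0 := by exact_mod_cast hF 2 (by norm_num) (by omega)
  obtain ⟨f, hf, hlt, hne, hind⟩ := exists_point r F hh
  let φ : PolyRing r F →ₐ[F] (FractionRing (MvPolynomial (ℕ × Fin (2 * r)) F))[X] :=
    MvPolynomial.aeval fun p => wedgeMat h f p.1 p.2
  have hφ : (Ygen r F).map φ = wedgeMat h f := by
    ext1 i j
    rw [Matrix.map_apply, Ygen, Matrix.of_apply, MvPolynomial.aeval_X]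
  have hker : ∀ a ∈ VIdeal r F, φ a = 0 := fun a ha =>
    VIdeal_le_ker (φ := φ.toRingHom) hφ (hf.memV h) ha
  let Θ := Ideal.Quotient.liftₐ (VIdeal r F) φ hker
  have hΘ : ∀ p, Θ (Ideal.Quotient.mk (VIdeal r F) p) = φ p := fun p =>
    Ideal.Quotient.lift_mk _ _ _
  have : Nontrivial (FV r F) := Θ.toRingHom.domain_nontrivial
  have hΘY : ∀ a b, Θ (posY r F a b) = wedgeY h f a b := by
    intro a b
    rw [posY, hΘ, ← Matrix.map_apply (f := φ), hφ, wedgeMat, Matrix.of_apply, posOf_posIdx,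
      posOf_posIdx]
  have hΘval : ∀ T, Θ (val (posY r F) T) = val (wedgeY h f) T := by
    intro T
    have := val_map Θ.toRingHom (posY r F) T
    simp only [AlgHom.toRingHom_eq_coe, RingHom.coe_coe, hΘY] at this
    exact this
  have hinj : ∀ x, Θ x = 0 → x = 0 := by
    intro x hx
    have hmem := span_std_FV hr hF h2 x
    have himg : {x | ∃ T, IsStd (sympRows r) T ∧ x = val (posY r F) T} =
        val (posY r F) '' {T | IsStd (sympRows r) T} := by
      ext y
      exact ⟨fun ⟨T, h1, h2⟩ => ⟨T, h1, h2.symm⟩, fun ⟨T, h1, h2⟩ => ⟨T, h1, h2.symm⟩⟩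
    rw [himg, Finsupp.mem_span_image_iff_linearCombination] at hmem
    obtain ⟨l, hl, rfl⟩ := hmem
    rw [Finsupp.linearCombination_apply, Finsupp.sum] at hx ⊢
    simp only [map_sum, map_smul, hΘval] at hx
    have h0 := hind l.support l (fun T hT => (Finsupp.mem_supported _ _).1 hl hT) hx
    exact Finset.sum_eq_zero fun T hT => by rw [h0 T hT, zero_smul]
  have hdet : Θ (Ideal.Quotient.mk (VIdeal r F)
      (Matrix.det (Matrix.of fun i j : Fin r => Ygen r F (embBar r i) (embBar r j)))) ≠ 0 := by
    rw [hΘ, AlgHom.map_det]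
    have := det_wedgeMat_ne_zero hh hlt hne
    rw [← hφ] at this
    exact this
  refine mem_nonZeroDivisors_iff_right.2 fun x hx => hinj x ?_
  have := congrArg Θ hx
  rw [map_mul, map_zero] at this
  exact (mul_eq_zero.1 this).resolve_right hdet

end Injectivity

theorem natCast_ne_zero_of_ringChar {r : ℕ} (F : Type*) [Field F]
    (hchar : ringChar F = 0 ∨ r < ringChar F) (k : ℕ) (hk : 0 < k) (hkr : k ≤ r) :
    (k : F) ≠ 0 := by
  intro h
  have := (ringChar.spec F k).1 h
  rcases hchar with h0 | h0
  · rw [h0, zero_dvd_iff] at this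
    omega
  · have := Nat.le_of_dvd hk this
    omega

/-- For `n = 2r` divisible by 4 and a field `F` with `char F = 0` or
`char F > r`, the image in `F[V]` of the determinant `f` of the submatrix of `Y` on rows
and columns `r+1, …, n` is not a zero divisor. -/
theorem det_mem_nonZeroDivisors (r : ℕ) (h4 : 4 ∣ 2 * r) (F : Type*) [Field F]
    (hchar : ringChar F = 0 ∨ r < ringChar F) :
    Ideal.Quotient.mk (VIdeal r F)
        (Matrix.det (Matrix.of fun i j : Fin r => Ygen r F (embBar r i) (embBar r j)))
      ∈ nonZeroDivisors (FV r F) := by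
  rcases Nat.eq_zero_or_pos r with rfl | hr
  · rw [Matrix.det_isEmpty, map_one]
    exact one_mem _
  · exact det_mem_nonZeroDivisors_of_pos hr (Nat.even_iff.2 (by omega))
      (natCast_ne_zero_of_ringChar F hchar)

end PR
end
end

section
/- Let n = 2r be an even integer with n ≥ 4 and let F be a field with char F = 0 or char F > r. Then in the polynomial ring F[Y_{ij} : 1 ≤ i, j ≤ n], the ideal generated by the entries of Y + Yᵀ, the diagonal entries Y_{ii}, the entries of YᵀJY, and the coefficients of char_{−JY}(T) − T^n is equal to the ideal generated by the entries of Y + Yᵀ, the entries of YᵀJY, and the single element ∑_{i=1}^{r} Y_{i, r+i}. -/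
open scoped Matrix

noncomputable section

namespace PR

/-- The determinant of an alternating matrix over a field is a square, by taking Schur complements
of invertible alternating `2 × 2` blocks. -/
theorem isSquare_det_of_alternating_field {K : Type*} [Field K] :
    ∀ (n : ℕ) (A : Matrix (Fin n) (Fin n) K), Aᵀ = -A → (∀ i, A i i = 0) → IsSquare A.det
  | 0, A, _, _ => by simp
  | 1, A, _, h => by simp [h]
  | n + 2, A, hA, h => by
    by_cases h0 : ∀ j, A 0 j = 0
    · rw [Matrix.det_eq_zero_of_row_eq_zero 0 h0]
      exact IsSquare.zero
    push Not at h0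
    obtain ⟨j, hj⟩ := h0
    have hj0 : j ≠ 0 := by
      rintro rfl
      exact hj (h 0)
    have hskew : ∀ i k, A k i = -A i k := fun i k => congrFun (congrFun hA i) k
    let e : Fin 2 ⊕ Fin n ≃ Fin (n + 2) :=
      (finSumFinEquiv.trans (finCongr (Nat.add_comm 2 n))).trans (Equiv.swap 1 j)
    have he0 : e (Sum.inl 0) = 0 := by
      change Equiv.swap 1 j 0 = 0
      exact Equiv.swap_apply_of_ne_of_ne (by simp) hj0.symm
    have he1 : e (Sum.inl 1) = j := by
      change Equiv.swap 1 j 1 = j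
      exact Equiv.swap_apply_left 1 j
    set B := A.submatrix e e with hB
    have hB' : ∀ x y, B y x = -B x y := fun x y => hskew _ _
    have hBd : ∀ x, B x x = 0 := fun x => h _
    set a := A 0 j with ha
    have hB11 : B.toBlocks₁₁ = !![0, a; -a, 0] := by
      ext x y
      fin_cases x <;> fin_cases y <;>
        simp [Matrix.toBlocks₁₁, hB, he0, he1, h, ha, hskew 0 j]
    let : Invertible B.toBlocks₁₁ := ⟨!![0, -a⁻¹; a⁻¹, 0],
      by rw [hB11]; simp [hj, Matrix.one_fin_two],
      by rw [hB11]; simp [hj, Matrix.one_fin_two]⟩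
    have hinv : ⅟(B.toBlocks₁₁) = !![0, -a⁻¹; a⁻¹, 0] := rfl
    rw [← Matrix.det_submatrix_equiv_self e A, ← hB, ← Matrix.fromBlocks_toBlocks B,
      Matrix.det_fromBlocks₁₁, hinv]
    refine IsSquare.mul ⟨a, by rw [hB11]; simp [Matrix.det_fin_two]⟩
      (isSquare_det_of_alternating_field n _ ?_ ?_)
    · ext x y
      simp only [Matrix.transpose_apply, Matrix.sub_apply, Matrix.mul_apply, Fin.sum_univ_two,
        Matrix.toBlocks₁₂, Matrix.toBlocks₂₁, Matrix.toBlocks₂₂, Matrix.of_apply,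
        Matrix.neg_apply]
      simp
      rw [hB' (Sum.inr x) (Sum.inr y), hB' (Sum.inl 0), hB' (Sum.inl 1),
        hB' (Sum.inl 0) (Sum.inr x), hB' (Sum.inl 1) (Sum.inr x)]
      ring
    · intro x
      simp only [Matrix.sub_apply, Matrix.mul_apply, Fin.sum_univ_two,
        Matrix.toBlocks₁₂, Matrix.toBlocks₂₁, Matrix.toBlocks₂₂, Matrix.of_apply, hBd]
      simp
      rw [hB' (Sum.inl 0) (Sum.inr x), hB' (Sum.inl 1) (Sum.inr x)]
      ring

open Polynomial in
theorem derivative_det {R ι : Type*} [CommRing R] [Fintype ι] [DecidableEq ι]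
    (M : Matrix ι ι R[X]) :
    derivative M.det = ∑ i, (M.updateCol i fun k => derivative (M k i)).det := by
  simp only [Matrix.det_apply', derivative_sum, derivative_intCast_mul]
  rw [Finset.sum_comm]
  refine Finset.sum_congr rfl fun σ _ => ?_
  rw [← Finset.mul_sum, derivative_prod_finset]
  congr 1
  refine Finset.sum_congr rfl fun i _ => ?_
  rw [← Finset.mul_prod_erase _ _ (Finset.mem_univ i), mul_comm]
  simp only [Matrix.updateCol_self]
  congr 1
  refine Finset.prod_congr rfl fun j hj => ?_
  rw [Matrix.updateCol_ne (Finset.ne_of_mem_erase hj)]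

open Polynomial in
theorem derivative_charpoly {R ι : Type*} [CommRing R] [Fintype ι] [DecidableEq ι]
    (N : Matrix ι ι R) :
    derivative N.charpoly = N.charmatrix.adjugate.trace := by
  rw [Matrix.charpoly, derivative_det, Matrix.trace]
  refine Finset.sum_congr rfl fun i _ => ?_
  have hcol : (fun k => derivative (N.charmatrix k i)) = Pi.single i 1 := by
    ext1 k
    rcases eq_or_ne k i with rfl | hk
    · simp [Matrix.charmatrix_apply_eq]
    · simp [hk]
  rw [hcol, Matrix.diag_apply, ← Matrix.transpose_apply N.charmatrix.adjugate,
    Matrix.adjugate_transpose, Matrix.adjugate_apply, Matrix.updateRow_transpose,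
    Matrix.det_transpose]

open Polynomial in
theorem X_mul_derivative_charpoly {R ι : Type*} [CommRing R] [Fintype ι] [DecidableEq ι]
    {N : Matrix ι ι R} (hN : N * N = 0) (htr : N.trace = 0) :
    X * derivative N.charpoly = (Fintype.card ι : R[X]) * N.charpoly := by
  have h1 : N.charmatrix * (Matrix.scalar ι (X : R[X]) + N.map C) = Matrix.scalar ι (X ^ 2) := by
    have h2 : N.map C * N.map C = (0 : Matrix ι ι R[X]) := by
      rw [← Matrix.map_mul, hN]
      simp
    have h3 : Matrix.scalar ι (X : R[X]) * N.map C = N.map C * Matrix.scalar ι (X : R[X]) :=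
      Matrix.scalar_commute _ (fun _ => Commute.all _ _) _
    have h4 : N.charmatrix = Matrix.scalar ι (X : R[X]) - N.map C := rfl
    rw [h4, sub_mul, mul_add, mul_add, h2, h3, add_zero, add_sub_cancel_right, ← map_mul, sq]
  have h5 : Matrix.trace (N.map C) = (0 : R[X]) := by
    have := (AddMonoidHom.map_trace (C : R →+* R[X]) N)
    rw [htr] at this
    simpa using this.symm
  have h6 : X ^ 2 * N.charmatrix.adjugate.trace = X * ((Fintype.card ι : R[X]) * N.charpoly) := by
    have := congrArg (fun M => (N.charmatrix.adjugate * M).trace) h1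
    simp only [← mul_assoc, Matrix.adjugate_mul] at this
    rw [← Matrix.charpoly] at this
    have h7 (c : R[X]) (M : Matrix ι ι R[X]) : M * Matrix.scalar ι c = c • M := by
      rw [← Matrix.scalar_commute c (fun _ => Commute.all _ _), Matrix.scalar_apply,
        ← Matrix.smul_eq_diagonal_mul]
    rw [h7, Matrix.smul_mul, one_mul, Matrix.trace_smul, Matrix.trace_smul, Matrix.trace_add, h5,
      Matrix.scalar_apply, Matrix.trace_diagonal] at this
    simp only [Finset.sum_const, Finset.card_univ, nsmul_eq_mul, smul_eq_mul, add_zero] at this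
    rw [← this]
    ring
  rw [derivative_charpoly]
  have h7 : X * (X * N.charmatrix.adjugate.trace) = X * ((Fintype.card ι : R[X]) * N.charpoly) := by
    rw [← h6]
    ring
  exact isRegular_X.left h7

open Polynomial in
theorem eq_X_pow_of_X_mul_derivative_sq {R : Type*} [CommRing R] {q : R[X]} {r : ℕ}
    (hq : q.Monic) (hdeg : q.natDegree ≤ r) (hcoeff : q.coeff r = 1)
    (hunit : ∀ k : ℕ, 0 < k → k ≤ r → IsUnit (k : R)) (h2 : IsUnit (2 : R))
    (h : X * derivative (q ^ 2) = ((2 * r : ℕ) : R[X]) * q ^ 2) : q = X ^ r := by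
  have h3 : X * derivative q = (r : R[X]) * q := by
    have h4 : IsUnit (2 : R[X]) := by simpa only [map_ofNat] using h2.map (C : R →+* R[X])
    have h5 : 2 * ((X * derivative q - (r : R[X]) * q) * q) = 0 := by
      rw [derivative_pow] at h
      push_cast at h
      simp only [pow_one, map_ofNat] at h
      linear_combination h
    have h6 := h4.mul_right_eq_zero.1 h5
    exact sub_eq_zero.1 (hq.mul_left_eq_zero_iff.1 h6)
  ext k
  rw [coeff_X_pow]
  split_ifs with hk
  · rw [hk, hcoeff]
  rcases lt_or_gt_of_ne hk with hlt | hgt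
  · have h7 := congrArg (fun p => coeff p k) h3
    have h8 : ((r - k : ℕ) : R) * q.coeff k = 0 := by
      rw [Nat.cast_sub hlt.le]
      cases k with
      | zero => simpa using h7.symm
      | succ k =>
        simp [coeff_X_mul, coeff_derivative] at h7
        push_cast
        linear_combination -h7
    exact (hunit _ (by omega) (by omega)).mul_right_eq_zero.1 h8
  · exact coeff_eq_zero_of_natDegree_lt (by omega)

theorem Jmat_map (r : ℕ) {R S : Type*} [CommRing R] [CommRing S] (f : R →+* S) :
    (Jmat r R).map f = Jmat r S := by
  ext i j
  simp only [Jmat, Matrix.map_apply, Matrix.of_apply]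
  split_ifs <;> simp

theorem Jmat_transpose (r : ℕ) (R : Type*) [CommRing R] : (Jmat r R)ᵀ = -Jmat r R := by
  ext i j
  simp only [Jmat, Matrix.transpose_apply, Matrix.neg_apply, Matrix.of_apply]
  have := i.isLt
  split_ifs <;> first | omega | simp

theorem Jmat_apply_self (r : ℕ) (R : Type*) [CommRing R] (i : Fin (2 * r)) :
    Jmat r R i i = 0 := by
  have := i.isLt
  simp only [Jmat, Matrix.of_apply]
  split_ifs <;> first | omega | rfl

theorem Jmat_mul_self (r : ℕ) (R : Type*) [CommRing R] : Jmat r R * Jmat r R = -1 := by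
  ext i j
  have hi := i.isLt
  have hj := j.isLt
  obtain ⟨k, hk⟩ : ∃ k : Fin (2 * r), (k : ℕ) = i + r ∨ (i : ℕ) = k + r := by
    by_cases h : (i : ℕ) < r
    · exact ⟨⟨i + r, by omega⟩, Or.inl rfl⟩
    · exact ⟨⟨i - r, by omega⟩, Or.inr (by simp only; omega)⟩
  have hk' := k.isLt
  rw [Matrix.mul_apply, Finset.sum_eq_single k]
  · simp only [Jmat, Matrix.of_apply, Matrix.neg_apply, Matrix.one_apply, Fin.ext_iff]
    split_ifs <;> first | omega | simp
  · intro l _ hl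
    have hl' := l.isLt
    rw [ne_eq, Fin.ext_iff] at hl
    have h : Jmat r R i l = 0 := by
      simp only [Jmat, Matrix.of_apply]
      split_ifs <;> first | omega | rfl
    rw [h, zero_mul]
  · simp

theorem sum_fin_two_mul {M : Type*} [AddCommMonoid M] (r : ℕ) (f : Fin (2 * r) → M) :
    ∑ i, f i = ∑ i, f (emb r i) + ∑ i, f (embBar r i) := by
  rw [← (finSumFinEquiv.trans (finCongr (two_mul r).symm)).sum_comp, Fintype.sum_sum_type]
  rfl

theorem Jmat_emb_emb (r : ℕ) (R : Type*) [CommRing R] (i j : Fin r) :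
    Jmat r R (emb r i) (emb r j) = 0 := by
  simp only [Jmat, emb, Matrix.of_apply]
  split_ifs <;> first | omega | rfl

theorem Jmat_embBar_embBar (r : ℕ) (R : Type*) [CommRing R] (i j : Fin r) :
    Jmat r R (embBar r i) (embBar r j) = 0 := by
  simp only [Jmat, embBar, Matrix.of_apply]
  split_ifs <;> first | omega | rfl

theorem Jmat_emb_embBar (r : ℕ) (R : Type*) [CommRing R] (i j : Fin r) :
    Jmat r R (emb r i) (embBar r j) = if i = j then 1 else 0 := by
  simp only [Jmat, emb, embBar, Matrix.of_apply, Fin.ext_iff]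
  split_ifs <;> first | omega | rfl

theorem Jmat_embBar_emb (r : ℕ) (R : Type*) [CommRing R] (i j : Fin r) :
    Jmat r R (embBar r i) (emb r j) = if i = j then -1 else 0 := by
  simp only [Jmat, emb, embBar, Matrix.of_apply, Fin.ext_iff]
  split_ifs <;> first | omega | rfl

theorem trace_Jmat_mul (r : ℕ) {R : Type*} [CommRing R]
    (A : Matrix (Fin (2 * r)) (Fin (2 * r)) R) :
    (Jmat r R * A).trace =
      ∑ i, A (embBar r i) (emb r i) - ∑ i, A (emb r i) (embBar r i) := by
  simp [Matrix.trace, Matrix.mul_apply, sum_fin_two_mul, Jmat_emb_emb, Jmat_emb_embBar,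
    Jmat_embBar_emb, Jmat_embBar_embBar, sub_eq_add_neg]

theorem trace_neg_Jmat_mul_of_skew (r : ℕ) {R : Type*} [CommRing R]
    {A : Matrix (Fin (2 * r)) (Fin (2 * r)) R} (hA : A + Aᵀ = 0) :
    (-(Jmat r R * A)).trace = 2 * ∑ i, A (emb r i) (embBar r i) := by
  have h : ∀ i, A (embBar r i) (emb r i) = -A (emb r i) (embBar r i) := fun i =>
    eq_neg_of_add_eq_zero_left (congrFun (congrFun hA (embBar r i)) (emb r i))
  rw [Matrix.trace_neg, trace_Jmat_mul, Finset.sum_congr rfl fun i _ => h i,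
    Finset.sum_neg_distrib]
  ring

open Polynomial in
theorem charmatrix_neg_Jmat_mul (r : ℕ) {D : Type*} [CommRing D]
    (Z : Matrix (Fin (2 * r)) (Fin (2 * r)) D) :
    (-(Jmat r D * Z)).charmatrix =
      Jmat r D[X] * (Z.map C - (X : D[X]) • Jmat r D[X]) := by
  rw [mul_sub, Matrix.mul_smul, Jmat_mul_self, ← Jmat_map r (C : D →+* D[X]), ← Matrix.map_mul]
  have h : (-(Jmat r D * Z)).charmatrix =
    Matrix.scalar _ (X : D[X]) - (-(Jmat r D * Z)).map C := rfl
  rw [h, Matrix.scalar_apply, ← Matrix.smul_one_eq_diagonal, Matrix.map_neg _ (map_neg C), smul_neg]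
  abel

theorem isSquare_det_of_alternating {D : Type*} [CommRing D] [IsDomain D] [IsIntegrallyClosed D]
    {n : ℕ} {A : Matrix (Fin n) (Fin n) D} (hA : Aᵀ = -A) (h : ∀ i, A i i = 0) :
    IsSquare A.det := by
  obtain ⟨x, hx⟩ := isSquare_det_of_alternating_field n (A.map (algebraMap D (FractionRing D)))
    (by rw [← Matrix.transpose_map, hA]; ext; simp) (by simp [h])
  rw [← RingHom.mapMatrix_apply, ← RingHom.map_det] at hx
  obtain ⟨y, rfl⟩ := IsIntegrallyClosed.exists_algebraMap_eq_of_isIntegral_pow (R := D) (x := x)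
    two_pos (by rw [sq, ← hx]; exact isIntegral_algebraMap)
  exact ⟨y, IsFractionRing.injective D (FractionRing D) (by rw [hx, map_mul])⟩

open Polynomial in
/-- For alternating `Z`, the characteristic polynomial of `-JZ` is the square of a monic polynomial
(a pfaffian). -/
theorem exists_monic_sq_eq_charpoly (r : ℕ) {D : Type*} [CommRing D] [IsDomain D]
    [IsIntegrallyClosed D[X]] {Z : Matrix (Fin (2 * r)) (Fin (2 * r)) D} (hZ : Zᵀ = -Z)
    (hd : ∀ i, Z i i = 0) :
    ∃ q : D[X], q.Monic ∧ q.natDegree = r ∧ (-(Jmat r D * Z)).charpoly = q ^ 2 := by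
  obtain ⟨p, hp⟩ : IsSquare (-(Jmat r D * Z)).charpoly := by
    rw [Matrix.charpoly, charmatrix_neg_Jmat_mul, Matrix.det_mul]
    refine IsSquare.mul (isSquare_det_of_alternating (Jmat_transpose r _) (Jmat_apply_self r _))
      (isSquare_det_of_alternating ?_ ?_)
    · rw [Matrix.transpose_sub, Matrix.transpose_smul, Jmat_transpose, ← Matrix.transpose_map, hZ]
      ext1 i j
      simp
      ring
    · simp [hd, Jmat_apply_self]
  have hm := Matrix.charpoly_monic (-(Jmat r D * Z))
  have hlc : p.leadingCoeff * p.leadingCoeff = 1 := by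
    rw [← leadingCoeff_mul, ← hp]
    exact hm
  have hq : (C p.leadingCoeff * p).Monic := by
    rw [Monic, leadingCoeff_mul, leadingCoeff_C, hlc]
  refine ⟨C p.leadingCoeff * p, hq, ?_, ?_⟩
  · have h2 := Matrix.charpoly_natDegree_eq_dim (-(Jmat r D * Z))
    rw [hp, ← sq, natDegree_pow, Fintype.card_fin] at h2
    have h3 : p.leadingCoeff ≠ 0 := left_ne_zero_of_mul_eq_one hlc
    rw [natDegree_C_mul h3]
    omega
  · rw [mul_pow, ← C_pow, sq p.leadingCoeff, hlc, C_1, one_mul, hp, sq]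

theorem natCast_ne_zero_of_le_of_lt_ringChar {F : Type*} [Field F] {r k : ℕ}
    (hchar : ringChar F = 0 ∨ r < ringChar F) (hk : 0 < k) (hkr : k ≤ r) : (k : F) ≠ 0 := by
  intro h0
  have hdvd := (ringChar.spec F k).1 h0
  rcases hchar with h | h
  · rw [h] at hdvd
    exact hk.ne' (Nat.eq_zero_of_zero_dvd hdvd)
  · exact absurd (Nat.le_of_dvd hk hdvd) (by omega)

open Polynomial in
theorem charpoly_neg_Jmat_mul_eq_X_pow {r : ℕ} (hr : 2 ≤ r) {F : Type*} [Field F]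
    (hchar : ringChar F = 0 ∨ r < ringChar F) {S : Type*} [CommRing S] (φ : PolyRing r F →+* S)
    (hskew : (Ygen r F).map φ + ((Ygen r F).map φ)ᵀ = 0)
    (hJ : ((Ygen r F).map φ)ᵀ * Jmat r S * (Ygen r F).map φ = 0)
    (htr : ∑ i, (Ygen r F).map φ (emb r i) (embBar r i) = 0) :
    (-(Jmat r S * (Ygen r F).map φ)).charpoly = X ^ (2 * r) := by
  set y := (Ygen r F).map φ with hy
  have hyT : yᵀ = -y := eq_neg_of_add_eq_zero_right hskew
  have hunit : ∀ k : ℕ, 0 < k → k ≤ r → IsUnit (k : S) := fun k hk hkr => by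
    simpa only [map_natCast] using
      (IsUnit.mk0 _ (natCast_ne_zero_of_le_of_lt_ringChar hchar hk hkr)).map
        (φ.comp (MvPolynomial.C : F →+* PolyRing r F))
  have h2F : (2 : F) ≠ 0 := by
    simpa only [Nat.cast_ofNat] using natCast_ne_zero_of_le_of_lt_ringChar hchar two_pos hr
  have h2S : IsUnit (2 : S) := by simpa only [Nat.cast_ofNat] using hunit 2 two_pos hr
  let Z : Matrix (Fin (2 * r)) (Fin (2 * r)) (PolyRing r F) :=
    (MvPolynomial.C (2⁻¹ : F) : PolyRing r F) • (Ygen r F - (Ygen r F)ᵀ)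
  have hZ : Z.map φ = y := by
    have hc : φ (MvPolynomial.C (2⁻¹ : F)) * 2 = 1 := by
      rw [← map_ofNat (φ.comp (MvPolynomial.C : F →+* PolyRing r F)) 2, RingHom.comp_apply,
        ← map_mul, ← map_mul, inv_mul_cancel₀ h2F, map_one, map_one]
    ext i j
    have hij : φ (Ygen r F j i) = -φ (Ygen r F i j) := congrFun (congrFun hyT i) j
    simp only [Z, hy, Matrix.map_apply, Matrix.smul_apply, Matrix.sub_apply,
      Matrix.transpose_apply, smul_eq_mul, map_mul, map_sub, hij]
    linear_combination φ (Ygen r F i j) * hc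
  obtain ⟨q, hq, hqdeg, hqsq⟩ := exists_monic_sq_eq_charpoly r (Z := Z)
    (by rw [Matrix.transpose_smul, Matrix.transpose_sub, Matrix.transpose_transpose, ← smul_neg,
      neg_sub]) (by simp [Z])
  have hqr : q.coeff r = 1 := by
    have h := hq.coeff_natDegree
    rwa [hqdeg] at h
  have hsq : (-(Jmat r S * y)).charpoly = q.map φ ^ 2 := by
    rw [← Polynomial.map_pow, ← hqsq, ← Matrix.charpoly_map, Matrix.map_neg _ (map_neg φ),
      Matrix.map_mul, Jmat_map, hZ]
  have hnil : -(Jmat r S * y) * -(Jmat r S * y) = 0 := by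
    have h : y * Jmat r S * y = 0 := by
      rw [hyT, Matrix.neg_mul, Matrix.neg_mul, neg_eq_zero] at hJ
      exact hJ
    rw [neg_mul_neg, Matrix.mul_assoc, ← Matrix.mul_assoc y, h, Matrix.mul_zero]
  have hder := X_mul_derivative_charpoly hnil
    (by rw [trace_neg_Jmat_mul_of_skew r hskew, htr, mul_zero])
  rw [hsq, Fintype.card_fin] at hder
  rw [hsq, eq_X_pow_of_X_mul_derivative_sq (hq.map φ) (natDegree_map_le.trans hqdeg.le)
    (by rw [coeff_map, hqr, map_one]) hunit h2S hder]
  ring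

/-- For `n = 2r ≥ 4` and a field `F` with `char F = 0` or `char F > r`,
the defining ideal of `V` equals the ideal generated by the entries of `Y + Yᵀ`, the
entries of `YᵀJY`, and the element `∑_{i=1}^{r} Y_{i, r+i}`. -/
theorem VIdeal_eq_traceIdeal (r : ℕ) (hn : 4 ≤ 2 * r) (F : Type*) [Field F]
    (hchar : ringChar F = 0 ∨ r < ringChar F) :
    VIdeal r F =
      Ideal.span
        ({p | ∃ i j, p = (Ygen r F + (Ygen r F)ᵀ) i j} ∪
         {p | ∃ i j, p = ((Ygen r F)ᵀ * Jmat r (PolyRing r F) * Ygen r F) i j} ∪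
         {∑ i : Fin r, Ygen r F (emb r i) (embBar r i)}) := by
  have hr : 2 ≤ r := by omega
  have h2 : IsUnit (2 : PolyRing r F) := by
    have h2F : (2 : F) ≠ 0 := by
      simpa only [Nat.cast_ofNat] using natCast_ne_zero_of_le_of_lt_ringChar hchar two_pos hr
    simpa only [map_ofNat] using (IsUnit.mk0 _ h2F).map (MvPolynomial.C : F →+* PolyRing r F)
  apply le_antisymm
  · set I := Ideal.span (_ : Set (PolyRing r F))
    have hS : _ ⊆ (I : Set (PolyRing r F)) := Ideal.subset_span
    set φ := Ideal.Quotient.mk I with hφ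
    have hskew : (Ygen r F).map φ + ((Ygen r F).map φ)ᵀ = 0 := by
      ext i j
      exact Ideal.Quotient.eq_zero_iff_mem.2 (hS (Or.inl (Or.inl ⟨i, j, rfl⟩)))
    have hJ : ((Ygen r F).map φ)ᵀ * Jmat r _ * (Ygen r F).map φ = 0 := by
      rw [← Jmat_map r φ, ← Matrix.transpose_map, ← Matrix.map_mul, ← Matrix.map_mul]
      ext i j
      exact Ideal.Quotient.eq_zero_iff_mem.2 (hS (Or.inl (Or.inr ⟨i, j, rfl⟩)))
    have htr : ∑ i, (Ygen r F).map φ (emb r i) (embBar r i) = 0 := by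
      simp only [Matrix.map_apply]
      rw [← map_sum]
      exact Ideal.Quotient.eq_zero_iff_mem.2 (hS (Or.inr rfl))
    have hchi := charpoly_neg_Jmat_mul_eq_X_pow hr hchar φ hskew hJ htr
    refine Ideal.span_le.2 ?_
    rintro p (((⟨i, j, rfl⟩ | ⟨i, rfl⟩) | ⟨i, j, rfl⟩) | ⟨k, rfl⟩)
    · exact hS (Or.inl (Or.inl ⟨i, j, rfl⟩))
    · refine (Ideal.unit_mul_mem_iff_mem I h2).1 ?_
      rw [two_mul (Ygen r F i i)]
      exact hS (Or.inl (Or.inl ⟨i, i, rfl⟩))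
    · exact hS (Or.inl (Or.inr ⟨i, j, rfl⟩))
    · refine Ideal.Quotient.eq_zero_iff_mem.1 ?_
      rw [← Jmat_map r φ, ← Matrix.map_mul, ← Matrix.map_neg _ (map_neg φ),
        Matrix.charpoly_map] at hchi
      rw [← hφ, ← Polynomial.coeff_map, Polynomial.map_sub, hchi, Polynomial.map_pow,
        Polynomial.map_X, sub_self, Polynomial.coeff_zero]
  · have hS : _ ⊆ (VIdeal r F : Set (PolyRing r F)) := Ideal.subset_span
    refine Ideal.span_le.2 ?_
    rintro p ((⟨i, j, rfl⟩ | ⟨i, j, rfl⟩) | rfl)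
    · exact hS (Or.inl (Or.inl (Or.inl ⟨i, j, rfl⟩)))
    · exact hS (Or.inl (Or.inr ⟨i, j, rfl⟩))
    · set φ := Ideal.Quotient.mk (VIdeal r F) with hφ
      have hskew : (Ygen r F).map φ + ((Ygen r F).map φ)ᵀ = 0 := by
        ext i j
        exact Ideal.Quotient.eq_zero_iff_mem.2 (hS (Or.inl (Or.inl (Or.inl ⟨i, j, rfl⟩))))
      have htr := trace_neg_Jmat_mul_of_skew r hskew
      have : Nonempty (Fin (2 * r)) := ⟨⟨0, by omega⟩⟩
      have hcoeff := Ideal.Quotient.eq_zero_iff_mem.2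
        (hS (Or.inr ⟨Fintype.card (Fin (2 * r)) - 1, rfl⟩))
      rw [Polynomial.coeff_sub, Polynomial.coeff_X_pow, if_neg (by rw [Fintype.card_fin]; omega),
        sub_zero, ← neg_eq_zero, ← map_neg, ← Matrix.trace_eq_neg_charpoly_coeff, ← hφ,
        AddMonoidHom.map_trace, Matrix.map_neg _ (map_neg φ), Matrix.map_mul, Jmat_map, htr] at hcoeff
      refine (Ideal.unit_mul_mem_iff_mem _ h2).1
        (Ideal.Quotient.eq_zero_iff_mem.1 ?_)
      rw [map_mul, map_ofNat, map_sum]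
      exact hcoeff

end PR
end
end
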